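/- The image in (QP_5)_67 of the subspace {f ∈ (P_5^+)_67 : S_5(f) is hit} is an 𝔽₂-vector space of dimension 161. -/

import Mathlib

open MvPolynomial

noncomputable section

/-- `P n` is the polynomial algebra `𝔽₂[x_1, …, x_n]`. -/
abbrev P (n : ℕ) : Type := MvPolynomial (Fin n) (ZMod 2)

/-- The total Steenrod square: the `𝔽₂`-algebra endomorphism of `P n`
with `Sq (x_j) = x_j + x_j ^ 2`. -/
def SqT (n : ℕ) : P n →ₐ[ZMod 2] P n := aeval fun j => X j + X j ^ 2

/-- `u` is hit (in degree `d`): `u = ∑_{i ≥ 1} Sq^i (f i)` where `f i` is homogeneous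
of degree `d - i`; here `Sq^i (f i)` is the degree-`d` homogeneous component of
`Sq (f i)`. -/
def IsHit (n d : ℕ) (u : P n) : Prop :=
  ∃ f : ℕ → P n,
    (∀ i, f i ∈ homogeneousSubmodule (Fin n) (ZMod 2) (d - i)) ∧
    u = ∑ i ∈ Finset.Icc 1 d, homogeneousComponent d (SqT n (f i))

/-- The homogeneous part `(P_n)_d`. -/
abbrev homSub (n d : ℕ) : Submodule (ZMod 2) (P n) := homogeneousSubmodule (Fin n) (ZMod 2) d

/-- The subspace of hit elements of degree `d` (the span of the set of hit elements;
this set is already closed under addition, so this is just the set of hit elements). -/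
def hitSub (n d : ℕ) : Submodule (ZMod 2) (P n) := Submodule.span (ZMod 2) {u | IsHit n d u}

/-- The cohit space `(QP_n)_d = (P_n)_d / (A⁺P_n)_d`. -/
abbrev QP (n d : ℕ) : Type :=
  ↥(homSub n d) ⧸ (hitSub n d).comap (homSub n d).subtype

/-- The class `[f]` in `(QP_n)_d` of a polynomial `f` (via its degree-`d` homogeneous
component; for `f` homogeneous of degree `d` this is the class of `f` itself). -/
def cls (n d : ℕ) (f : P n) : QP n d :=
  Submodule.Quotient.mk
    ⟨homogeneousComponent d f,
      (mem_homogeneousSubmodule _ _).2 (homogeneousComponent_isHomogeneous d f)⟩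

/-- The monomial `x^a = x_1^{a_1} ⋯ x_n^{a_n}`. -/
def mono {n : ℕ} (a : Fin n →₀ ℕ) : P n := monomial a 1

/-- The (total) degree of the monomial with exponent vector `a`. -/
def degA {n : ℕ} (a : Fin n →₀ ℕ) : ℕ := ∑ i, a i

/-- The weight vector: `wVec a t = ω_{t+1}(x^a) = ∑_j α_t(a_j)`. -/
def wVec {n : ℕ} (a : Fin n →₀ ℕ) : ℕ → ℕ :=
  fun t => ∑ j, if Nat.testBit (a j) t then 1 else 0

/-- Left lexicographic (strict) order on sequences. -/
def lexLtN (f g : ℕ → ℕ) : Prop := ∃ i, (∀ j, j < i → f j = g j) ∧ f i < g i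

/-- Left lexicographic (strict) order on exponent vectors. -/
def lexLtS {n : ℕ} (a b : Fin n →₀ ℕ) : Prop :=
  ∃ i : Fin n, (∀ j, j < i → a j = b j) ∧ a i < b i

/-- The order on monomials: `u < v` iff `ω(u) < ω(v)` lexicographically, or
`ω(u) = ω(v)` and `σ(u) < σ(v)` lexicographically. -/
def monLt {n : ℕ} (a b : Fin n →₀ ℕ) : Prop :=
  lexLtN (wVec a) (wVec b) ∨ (wVec a = wVec b ∧ lexLtS a b)

/-- A monomial is admissible iff it is not inadmissible, i.e. there is no finite set of
monomials of the same degree, all smaller than it, such that subtracting their sum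
yields a hit polynomial. -/
def Admissible {n : ℕ} (a : Fin n →₀ ℕ) : Prop :=
  ¬ ∃ S : Finset (Fin n →₀ ℕ),
      (∀ b ∈ S, degA b = degA a ∧ monLt b a) ∧
      IsHit n (degA a) (mono a - ∑ b ∈ S, mono b)

/-- `P_n^0`: the span of the monomials in which some variable has exponent `0`. -/
def PzeroSub (n : ℕ) : Submodule (ZMod 2) (P n) :=
  Submodule.span (ZMod 2) {x : P n | ∃ a : Fin n →₀ ℕ, (∃ i, a i = 0) ∧ x = mono a}

/-- `P_n^+`: the span of the monomials in which every variable occurs. -/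
def PplusSub (n : ℕ) : Submodule (ZMod 2) (P n) :=
  Submodule.span (ZMod 2) {x : P n | ∃ a : Fin n →₀ ℕ, (∀ i, 0 < a i) ∧ x = mono a}

/-- `(QP_n^0)_d`: the image of `(P_n^0)_d` in `(QP_n)_d`. -/
def Qzero (n d : ℕ) : Submodule (ZMod 2) (QP n d) :=
  (((PzeroSub n).comap (homSub n d).subtype)).map
    ((hitSub n d).comap (homSub n d).subtype).mkQ

/-- `(QP_n^+)_d`: the image of `(P_n^+)_d` in `(QP_n)_d`. -/
def Qplus (n d : ℕ) : Submodule (ZMod 2) (QP n d) :=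
  (((PplusSub n).comap (homSub n d).subtype)).map
    ((hitSub n d).comap (homSub n d).subtype).mkQ

/-- Kameko-type map `S_5 : P_5 → P_5`, the `𝔽₂`-linear map with
`S_5(x_1x_2x_3x_4x_5 · y²) = y` on monomials of that form and `S_5 = 0` on all
other monomials. -/
def S5 : P 5 →ₗ[ZMod 2] P 5 :=
  (basisMonomials (Fin 5) (ZMod 2)).constr (ZMod 2) fun a =>
    if ∀ i, Odd (a i) then mono (Finsupp.equivFunOnFinite.symm fun i => a i / 2) else 0

/-- `Φ(f) = x_1x_2x_3x_4x_5 · f²`. -/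
def Phi (f : P 5) : P 5 := (∏ i : Fin 5, X i) * f ^ 2

/-! ### Combinatorics of the dual relations -/

abbrev Vn (n : ℕ) := Fin n → ℕ

def sz {n : ℕ} (a : Vn n) : ℕ := ∑ i, a i

def Bset {n : ℕ} (f : Vn n) (j : ℕ) : Finset (Vn n) :=
  (Fintype.piFinset fun i => Finset.range (f i + 1)).filter
    fun b => (∀ i, b i &&& f i = b i) ∧ sz b = j

theorem mem_Bset {n : ℕ} {f b : Vn n} {j : ℕ} :
    b ∈ Bset f j ↔ (∀ i, b i &&& f i = b i) ∧ sz b = j := by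
  unfold Bset
  simp only [Finset.mem_filter, Fintype.mem_piFinset, Finset.mem_range, and_iff_right_iff_imp]
  rintro ⟨h, -⟩ i
  have : b i &&& f i ≤ f i := Nat.and_le_right
  rw [h i] at this
  omega

def odds (a : Vn 5) : ℕ := ∑ i, a i % 2

def half (a : Vn 5) : Vn 5 := fun i => a i / 2

def lower : List ℕ → Vn 5 → Prop
  | [], _ => False
  | w :: ω, a => odds a < w ∨ (odds a = w ∧ lower ω (half a))

def has : List ℕ → Vn 5 → Prop
  | [], _ => True
  | w :: ω, a => odds a = w ∧ has ω (half a)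

theorem bsub_half {b f : ℕ} (h : b &&& f = b) : (b / 2) &&& (f / 2) = b / 2 := by
  have := congrArg (· / 2) h
  simpa [Nat.and_div_two] using this

theorem bsub_mod {b f : ℕ} (h : b &&& f = b) : b % 2 ≤ f % 2 := by
  have h0 := Nat.testBit_and b f 0
  rw [h] at h0
  simp only [Nat.testBit_zero] at h0
  rcases Nat.mod_two_eq_zero_or_one b with hb | hb <;>
  rcases Nat.mod_two_eq_zero_or_one f with hf | hf <;> simp_all

theorem bsub_of_parts {b f : ℕ} (h : b % 2 ≤ f % 2) (h2 : (b / 2) &&& (f / 2) = b / 2) :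
    b &&& f = b := by
  apply Nat.eq_of_testBit_eq
  intro k
  rcases k with _ | k
  · rw [Nat.testBit_and]; simp only [Nat.testBit_zero]
    rcases Nat.mod_two_eq_zero_or_one b with hb | hb <;>
    rcases Nat.mod_two_eq_zero_or_one f with hf | hf <;> simp_all
  · have := congrArg (fun x => x.testBit k) h2
    simpa [Nat.testBit_and, Nat.testBit_div_two] using this

theorem half_add_even {F b : Vn 5} (h : ∀ i, b i % 2 = 0) : half (F + b) = half F + half b := by
  funext i
  have := h i
  simp only [half, Pi.add_apply]
  omega

theorem key_lower (Ω : List ℕ) : ∀ (F b : Vn 5), has Ω F → (∀ i, b i &&& F i = b i) →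
    (¬ ∀ i, 2 ^ Ω.length ∣ b i) → lower Ω (F + b) := by
  induction Ω with
  | nil => intro F b _ _ h; simp at h
  | cons w ω ih =>
    intro F b hF hb hn
    obtain ⟨h1, h2⟩ := hF
    by_cases he : ∀ i, b i % 2 = 0
    · right
      constructor
      · rw [← h1]; unfold odds
        apply Finset.sum_congr rfl
        intro i _
        have := he i
        simp only [Pi.add_apply]; omega
      · rw [half_add_even he]
        apply ih _ _ h2 (fun i => bsub_half (hb i))
        intro hall
        apply hn
        intro i
        have h3 : 2 ^ ω.length ∣ b i / 2 := hall i
        have h4 := he i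
        rw [List.length_cons, pow_succ']
        have : b i = 2 * (b i / 2) := by omega
        rw [this]
        exact Nat.mul_dvd_mul_left 2 h3
    · left
      push Not at he
      obtain ⟨i, hi⟩ := he
      rw [← h1]; unfold odds
      apply Finset.sum_lt_sum
      · intro k _
        have := bsub_mod (hb k)
        simp only [Pi.add_apply]; omega
      · refine ⟨i, Finset.mem_univ i, ?_⟩
        have := bsub_mod (hb i)
        simp only [Pi.add_apply]; omega

theorem lower_append (Ω Ω' : List ℕ) : ∀ v, lower Ω v → lower (Ω ++ Ω') v := by
  induction Ω with
  | nil => intro v h; exact h.elim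
  | cons w ω ih =>
    intro v h
    rcases h with h | ⟨h, h'⟩
    · exact Or.inl h
    · exact Or.inr ⟨h, ih _ h'⟩

theorem has_append (Ω Ω' : List ℕ) : ∀ v, has (Ω ++ Ω') v ↔
    has Ω v ∧ has Ω' (fun i => v i / 2 ^ Ω.length) := by
  induction Ω with
  | nil => intro v; simp [has]
  | cons w ω ih =>
    intro v
    simp only [List.cons_append, has, ih, List.length_cons]
    have : (fun i => half v i / 2 ^ ω.length) = (fun i => v i / 2 ^ (ω.length + 1)) := by
      funext i; simp only [half]; rw [Nat.div_div_eq_div_mul, pow_succ']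
    rw [this]; tauto

theorem lower_append_right (Ω Ω' : List ℕ) : ∀ v, has Ω v →
    lower Ω' (fun i => v i / 2 ^ Ω.length) → lower (Ω ++ Ω') v := by
  induction Ω with
  | nil => intro v _ h; simpa using h
  | cons w ω ih =>
    intro v h h'
    refine Or.inr ⟨h.1, ih _ h.2 ?_⟩
    have : (fun i => half v i / 2 ^ ω.length) = (fun i => v i / 2 ^ (ω.length + 1)) := by
      funext i; simp only [half]; rw [Nat.div_div_eq_div_mul, pow_succ']
    rw [this]; exact h'

theorem half_add_pow (x v : Vn 5) (r : ℕ) :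
    half (fun i => x i + 2 ^ (r + 1) * v i) = fun i => half x i + 2 ^ r * v i := by
  funext i; simp only [half]
  have : x i + 2 ^ (r + 1) * v i = x i + 2 * (2 ^ r * v i) := by ring
  rw [this]; omega

theorem odds_add_pow (x v : Vn 5) (r : ℕ) :
    odds (fun i => x i + 2 ^ (r + 1) * v i) = odds x := by
  unfold odds
  apply Finset.sum_congr rfl
  intro i _
  have : x i + 2 ^ (r + 1) * v i = x i + 2 * (2 ^ r * v i) := by ring
  simp only [this]; omega

theorem has_shift (Ω : List ℕ) : ∀ x v : Vn 5,
    has Ω (fun i => x i + 2 ^ Ω.length * v i) ↔ has Ω x := by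
  induction Ω with
  | nil => intro x v; simp [has]
  | cons w ω ih =>
    intro x v
    simp only [has, List.length_cons, odds_add_pow, half_add_pow, ih]

theorem lower_shift (Ω : List ℕ) : ∀ x v : Vn 5,
    lower Ω (fun i => x i + 2 ^ Ω.length * v i) ↔ lower Ω x := by
  induction Ω with
  | nil => intro x v; simp [lower]
  | cons w ω ih =>
    intro x v
    simp only [lower, List.length_cons, odds_add_pow, half_add_pow, ih]

/-- A functional which kills relations and everything of lower weight. -/
structure Kam (Ω : List ℕ) (Z : Finset (Fin 5)) (D : ℕ) (μ : Vn 5 → ZMod 2) : Prop where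
  rel : ∀ f j, 0 < j → sz f + j = D → (∀ i ∈ Z, 0 < f i) → ∑ b ∈ Bset f j, μ (f + b) = 0
  low : ∀ v, sz v = D → (∀ i ∈ Z, 0 < v i) → lower Ω v → μ v = 0

theorem Kam.weaken {Ω Ω' : List ℕ} {Z D μ} (h : Kam (Ω ++ Ω') Z D μ) : Kam Ω Z D μ :=
  ⟨h.rel, fun v h1 h2 h3 => h.low v h1 h2 (lower_append _ _ _ h3)⟩

theorem bsub_shift {r x f b : ℕ} (hx : x < 2 ^ r) :
    (2 ^ r * b) &&& (x + 2 ^ r * f) = 2 ^ r * b ↔ b &&& f = b := by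
  have h : (2 ^ r * b) &&& (x + 2 ^ r * f) = 2 ^ r * (b &&& f) := by
    apply Nat.eq_of_testBit_eq
    intro k
    rw [add_comm, Nat.testBit_and, Nat.testBit_two_pow_mul_add _ hx, Nat.testBit_two_pow_mul,
      Nat.testBit_two_pow_mul, Nat.testBit_and]
    by_cases hk : k < r
    · simp [hk, not_le.mpr hk]
    · simp [hk, not_lt.mp hk]
  rw [h]
  constructor
  · intro h'; exact Nat.eq_of_mul_eq_mul_left (by positivity) h'
  · intro h'; rw [h']

theorem sz_shift (r : ℕ) (x v : Vn 5) :
    sz (fun i => x i + 2 ^ r * v i) = sz x + 2 ^ r * sz v := by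
  unfold sz; rw [Finset.sum_add_distrib, Finset.mul_sum]

theorem Kam.shift {Ω1 Ω2 : List ℕ} {Z D D' μ} {x : Vn 5} (h : Kam (Ω1 ++ Ω2) Z D' μ)
    (hx : has Ω1 x) (hlt : ∀ i, x i < 2 ^ Ω1.length) (hD : sz x + 2 ^ Ω1.length * D = D') :
    Kam Ω2 (Z.filter fun i => x i = 0) D (fun v => μ (fun i => x i + 2 ^ Ω1.length * v i)) := by
  set r := Ω1.length with hr
  have hpos : ∀ v : Vn 5, (∀ i ∈ Z.filter (fun i => x i = 0), 0 < v i) →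
      ∀ i ∈ Z, 0 < x i + 2 ^ r * v i := by
    intro v hv i hi
    by_cases h0 : x i = 0
    · have := hv i (by simp [hi, h0])
      have : 0 < 2 ^ r * v i := by positivity
      omega
    · omega
  constructor
  · intro f j hj hs hf
    have h1 := h.rel (fun i => x i + 2 ^ r * f i) (2 ^ r * j) (by positivity)
      (by rw [sz_shift, ← hD, ← hs]; ring) (hpos f hf)
    rw [← h1]
    symm
    rw [← Finset.sum_subset (s₁ := (Bset f j).image fun b => fun i => 2 ^ r * b i)]
    · rw [Finset.sum_image]
      · apply Finset.sum_congr rfl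
        intro b _
        congr 1
        funext i
        simp only [Pi.add_apply]; ring
      · intro b _ c _ hbc
        funext i
        exact Nat.eq_of_mul_eq_mul_left (by positivity) (congrFun hbc i)
    · intro b hb
      simp only [Finset.mem_image] at hb
      obtain ⟨c, hc, rfl⟩ := hb
      rw [mem_Bset] at hc ⊢
      refine ⟨fun i => (bsub_shift (hlt i)).2 (hc.1 i), ?_⟩
      rw [← hc.2]; unfold sz; rw [Finset.mul_sum]
    · intro b hb hb'
      have hb2 := mem_Bset.1 hb
      have hF : has Ω1 (fun i => x i + 2 ^ r * f i) := (has_shift Ω1 x f).2 hx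
      refine h.low _ ?_ ?_ (lower_append _ _ _ (key_lower Ω1 _ b hF hb2.1 ?_))
      · have : sz ((fun i => x i + 2 ^ r * f i) + b) = sz (fun i => x i + 2 ^ r * f i) + sz b := by
          unfold sz; rw [← Finset.sum_add_distrib]; rfl
        rw [this, hb2.2, sz_shift, ← hD, ← hs]; ring
      · intro i hi
        have := hpos f hf i hi
        simp only [Pi.add_apply]; omega
      · intro hall
        apply hb'
        simp only [Finset.mem_image]
        have hbb : (fun i => 2 ^ r * (b i / 2 ^ r)) = b := by
          funext i; exact Nat.mul_div_cancel' (hall i)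
        refine ⟨fun i => b i / 2 ^ r, ?_, hbb⟩
        rw [mem_Bset]
        constructor
        · intro i
          rw [← bsub_shift (hlt i), Nat.mul_div_cancel' (hall i)]
          exact hb2.1 i
        · have h3 : 2 ^ r * sz (fun i => b i / 2 ^ r) = 2 ^ r * j := by
            rw [← hb2.2]; conv_rhs => rw [← hbb]
            unfold sz; rw [Finset.mul_sum]
          exact Nat.eq_of_mul_eq_mul_left (by positivity) h3
  · intro v hs hv hl
    refine h.low _ (by rw [sz_shift, ← hD, ← hs]) (hpos v hv) ?_
    apply lower_append_right
    · exact (has_shift Ω1 x v).2 hx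
    · have : (fun i => (x i + 2 ^ r * v i) / 2 ^ Ω1.length) = v := by
        funext i
        rw [← hr, Nat.add_mul_div_left _ _ (by positivity), Nat.div_eq_of_lt (hlt i), zero_add]
      rw [this]; exact hl

/-- All monomials whose low weight is `Ω` vanish. -/
def ZeroW (Ω : List ℕ) : Prop :=
  ∀ Z D μ, Kam Ω Z D μ → ∀ v, sz v = D → (∀ i ∈ Z, 0 < v i) → has Ω v → μ v = 0

theorem split_mod (v : Vn 5) (r : ℕ) :
    (fun i => v i % 2 ^ r + 2 ^ r * (v i / 2 ^ r)) = v := by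
  funext i; exact Nat.mod_add_div _ _

theorem ZeroW.infix {Ω1 Ω2 Ω3 : List ℕ} (hz : ZeroW Ω2) {Z D μ}
    (h : Kam (Ω1 ++ (Ω2 ++ Ω3)) Z D μ) {v : Vn 5} (hs : sz v = D) (hp : ∀ i ∈ Z, 0 < v i)
    (hv : has (Ω1 ++ (Ω2 ++ Ω3)) v) : μ v = 0 := by
  rw [has_append, has_append] at hv
  obtain ⟨h1, h2, -⟩ := hv
  set r := Ω1.length with hr
  have h1' : has Ω1 (fun i => v i % 2 ^ r) := by
    rw [← has_shift Ω1 _ (fun i => v i / 2 ^ r), ← hr, split_mod]; exact h1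
  have hK := Kam.weaken (Kam.shift (D := sz fun i => v i / 2 ^ r) h h1'
    (fun i => Nat.mod_lt _ (by positivity))
    (by rw [← sz_shift, ← hr, split_mod, hs]))
  have := hz _ _ _ hK (fun i => v i / 2 ^ r) rfl ?_ h2
  · rw [← hr] at this
    simp only [split_mod] at this
    exact this
  · intro i hi
    simp only [Finset.mem_filter] at hi
    have h3 := hp i hi.1
    rcases Nat.eq_zero_or_pos (v i / 2 ^ r) with h0 | h0
    · exfalso
      have := Nat.mod_add_div (v i) (2 ^ r)
      rw [hi.2, h0] at this
      omega
    · exact h0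

theorem zero_Z (k : ℕ) (hk : 0 < k) : ZeroW [0, k] := by
  intro Z D μ h v hs hp hv
  obtain ⟨h0, h1, -⟩ := hv
  have he : ∀ i, v i % 2 = 0 := by
    intro i
    have := (Finset.sum_eq_zero_iff (s := Finset.univ)).1 h0 i (Finset.mem_univ i)
    exact this
  set u := half v with hu
  have hvu : v = u + u := by
    funext i; have := he i; simp only [hu, half, Pi.add_apply]; omega
  have hup : 0 < sz u := by
    rcases Nat.eq_zero_or_pos (sz u) with h | h
    · exfalso
      have h3 : ∀ i, u i = 0 := fun i => (Finset.sum_eq_zero_iff (s := Finset.univ)).1 h i (Finset.mem_univ i)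
      have : odds u = 0 := by unfold odds; simp [h3]
      omega
    · exact h
  have hB : Bset u (sz u) = {u} := by
    ext b
    rw [mem_Bset, Finset.mem_singleton]
    constructor
    · rintro ⟨ha, hb⟩
      have hle : ∀ i ∈ Finset.univ, b i ≤ u i := by
        intro i _
        rw [← ha i]; exact Nat.and_le_right
      have := (Finset.sum_eq_sum_iff_of_le hle).1 hb
      funext i; exact this i (Finset.mem_univ i)
    · rintro rfl
      exact ⟨fun i => Nat.and_self _, rfl⟩
  have h4 := h.rel u (sz u) hup ?_ ?_
  · rw [hB, Finset.sum_singleton, ← hvu] at h4; exact h4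
  · rw [← hs, hvu]; unfold sz; rw [← Finset.sum_add_distrib]; rfl
  · intro i hi
    have := hp i hi
    rw [hvu] at this
    simp only [Pi.add_apply] at this
    omega

/-! ### The relation checker -/

/-- The vector given by a list. -/
def ve (l : List ℕ) : Vn 5 := fun i => l.getD i 0

def terms : List ℕ → ℕ → List (List ℕ)
  | [], j => bif Nat.beq j 0 then [[]] else []
  | a :: as, j => ((List.range (j + 1)).filter fun b => Nat.beq (b &&& a) b).flatMap
      fun b => (terms as (j - b)).map fun l => (a + b) :: l

theorem mem_terms_nil {j : ℕ} {l : List ℕ} : l ∈ terms [] j ↔ j = 0 ∧ l = [] := by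
  unfold terms
  cases h : Nat.beq j 0
  · have : j ≠ 0 := by rintro rfl; simp at h
    simp [this]
  · have := Nat.eq_of_beq_eq_true h
    simp [this]

theorem mem_terms_cons {a j : ℕ} {as l : List ℕ} : l ∈ terms (a :: as) j ↔
    ∃ b, b ≤ j ∧ b &&& a = b ∧ ∃ l', l' ∈ terms as (j - b) ∧ l = (a + b) :: l' := by
  rw [terms]
  simp only [List.mem_flatMap, List.mem_filter, List.mem_range, List.mem_map]
  constructor
  · rintro ⟨b, ⟨h1, h2⟩, l', h3, rfl⟩
    exact ⟨b, by omega, Nat.eq_of_beq_eq_true h2, l', h3, rfl⟩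
  · rintro ⟨b, h1, h2, l', h3, rfl⟩
    exact ⟨b, ⟨by omega, by rw [h2]; simp⟩, l', h3, rfl⟩

theorem nodup_terms : ∀ (f : List ℕ) (j : ℕ), (terms f j).Nodup := by
  intro f
  induction f with
  | nil => intro j; unfold terms; cases Nat.beq j 0 <;> simp
  | cons a as ih =>
    intro j
    rw [terms, List.nodup_flatMap]
    constructor
    · intro b _
      exact (ih _).map (fun x y h => by simpa using h)
    · apply List.Nodup.pairwise_of_forall_ne
      · exact List.Nodup.filter _ List.nodup_range
      · intro b _ c _ hbc
        simp only [Function.onFun, List.disjoint_left, List.mem_map]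
        rintro l ⟨l1, _, rfl⟩ ⟨l2, _, h⟩
        simp only [List.cons.injEq] at h
        omega

theorem mem_terms5 {f0 f1 f2 f3 f4 j : ℕ} {l : List ℕ} : l ∈ terms [f0, f1, f2, f3, f4] j ↔
    ∃ b : Vn 5, b ∈ Bset (ve [f0, f1, f2, f3, f4]) j ∧
      l = [f0 + b 0, f1 + b 1, f2 + b 2, f3 + b 3, f4 + b 4] := by
  simp only [mem_terms_cons, mem_terms_nil, mem_Bset]
  constructor
  · rintro ⟨b0, h0, g0, l0, ⟨b1, h1, g1, l1, ⟨b2, h2, g2, l2, ⟨b3, h3, g3, l3,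
      ⟨b4, h4, g4, l4, ⟨h5, rfl⟩, rfl⟩, rfl⟩, rfl⟩, rfl⟩, rfl⟩
    refine ⟨![b0, b1, b2, b3, b4], ⟨?_, ?_⟩, rfl⟩
    · intro i; fin_cases i <;> simp [ve, g0, g1, g2, g3, g4]
    · simp [sz, Fin.sum_univ_five]; omega
  · rintro ⟨b, ⟨h, hs⟩, rfl⟩
    simp only [sz, Fin.sum_univ_five] at hs
    refine ⟨b 0, by omega, h 0, _, ⟨b 1, by omega, h 1, _, ⟨b 2, by omega, h 2, _,
      ⟨b 3, by omega, h 3, _, ⟨b 4, by omega, h 4, _, ⟨by omega, rfl⟩, rfl⟩, rfl⟩, rfl⟩, rfl⟩, rfl⟩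

theorem ve5 (v : Vn 5) : ve [v 0, v 1, v 2, v 3, v 4] = v := by
  funext i; fin_cases i <;> rfl

theorem ve_ofFn (v : Vn 5) : ve (List.ofFn v) = v := by
  have : List.ofFn v = [v 0, v 1, v 2, v 3, v 4] := by simp [List.ofFn_succ]
  rw [this, ve5]

theorem len5 {f : List ℕ} (hf : f.length = 5) : ∃ a b c d e, f = [a, b, c, d, e] := by
  match f, hf with
  | [a, b, c, d, e], _ => exact ⟨a, b, c, d, e, rfl⟩

theorem terms_spec {f : List ℕ} (hf : f.length = 5) {j : ℕ} {t : List ℕ} (ht : t ∈ terms f j) :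
    t.length = 5 ∧ ∃ b ∈ Bset (ve f) j, ve t = ve f + b := by
  obtain ⟨a, b, c, d, e, rfl⟩ := len5 hf
  rw [mem_terms5] at ht
  obtain ⟨b, hb, rfl⟩ := ht
  refine ⟨rfl, b, hb, ?_⟩
  funext i; fin_cases i <;> rfl

theorem terms_sum {f : List ℕ} (hf : f.length = 5) (j : ℕ) (g : Vn 5 → ZMod 2) :
    ((terms f j).map fun t => g (ve t)).sum = ∑ b ∈ Bset (ve f) j, g (ve f + b) := by
  obtain ⟨f0, f1, f2, f3, f4, rfl⟩ := len5 hf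
  rw [← List.sum_toFinset _ (nodup_terms _ _)]
  symm
  apply Finset.sum_bij (fun b _ => [f0 + b 0, f1 + b 1, f2 + b 2, f3 + b 3, f4 + b 4])
  · intro b hb
    rw [List.mem_toFinset, mem_terms5]
    exact ⟨b, hb, rfl⟩
  · intro b _ c _ h
    simp only [List.cons.injEq, Nat.add_left_cancel_iff] at h
    funext i; fin_cases i <;> simp [h]
  · intro l hl
    rw [List.mem_toFinset, mem_terms5] at hl
    obtain ⟨b, hb, rfl⟩ := hl
    exact ⟨b, hb, rfl⟩
  · intro b _
    congr 1
    funext i; fin_cases i <;> rfl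

/-- Comparison of the weight with `Ω`: `0` lower, `1` equal, `2` higher. -/
def oddsL : List ℕ → ℕ
  | [] => 0
  | a :: l => a % 2 + oddsL l

def halfL (l : List ℕ) : List ℕ := l.map fun a => a / 2

def cmpW : List ℕ → List ℕ → ℕ
  | [], _ => 1
  | w :: ω, t => bif Nat.beq (oddsL t) w then cmpW ω (halfL t) else
      bif Nat.ble (oddsL t) w then 0 else 2

theorem odds_ve {t : List ℕ} (h : t.length = 5) : odds (ve t) = oddsL t := by
  obtain ⟨f0, f1, f2, f3, f4, rfl⟩ := len5 h
  simp [odds, ve, oddsL, Fin.sum_univ_five]; omega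

theorem half_ve {t : List ℕ} (h : t.length = 5) : half (ve t) = ve (halfL t) := by
  obtain ⟨f0, f1, f2, f3, f4, rfl⟩ := len5 h
  funext i; fin_cases i <;> rfl

theorem cmpW_spec (Ω : List ℕ) : ∀ t : List ℕ, t.length = 5 →
    (cmpW Ω t = 0 ↔ lower Ω (ve t)) ∧ (cmpW Ω t = 1 ↔ has Ω (ve t)) := by
  induction Ω with
  | nil => intro t _; simp [cmpW, lower, has]
  | cons w ω ih =>
    intro t ht
    have h1 := ih (halfL t) (by simpa [halfL] using ht)
    simp only [cmpW, lower, has, odds_ve ht, half_ve ht]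
    cases h : Nat.beq (oddsL t) w
    · have hne : oddsL t ≠ w := by rintro rfl; simp at h
      cases h' : Nat.ble (oddsL t) w
      · have : ¬ oddsL t ≤ w := by intro h3; rw [Nat.ble_eq_true_of_le h3] at h'; simp at h'
        simp [hne]; omega
      · have := Nat.le_of_ble_eq_true h'
        simp [hne]; omega
    · have := Nat.eq_of_beq_eq_true h
      simp [this, h1]

/-- terms of a relation, where at most `r` odd exponents may be changed -/
def termsR : List ℕ → ℕ → ℕ → List (List ℕ)
  | [], j, _ => bif Nat.beq j 0 then [[]] else []
  | a :: as, j, r => match as with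
    | [] => bif Nat.beq (j &&& a) j && Nat.ble (j % 2) r then [[a + j]] else []
    | _ :: _ => ((List.range (j + 1)).filter
        fun b => Nat.beq (b &&& a) b && Nat.ble (b % 2) r).flatMap
          fun b => (termsR as (j - b) (r - b % 2)).map fun l => (a + b) :: l

theorem termsR_single (a j r : ℕ) : termsR [a] j r =
    ((List.range (j + 1)).filter fun b => Nat.beq (b &&& a) b && Nat.ble (b % 2) r).flatMap
      fun b => (termsR [] (j - b) (r - b % 2)).map fun l => (a + b) :: l := by
  rw [List.range_succ, List.filter_append, List.flatMap_append]
  have h1 : ((List.range j).filter fun b => Nat.beq (b &&& a) b && Nat.ble (b % 2) r).flatMap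
      (fun b => (termsR [] (j - b) (r - b % 2)).map fun l => (a + b) :: l) = [] := by
    rw [List.flatMap_eq_nil_iff]
    intro b hb
    have hb' : b < j := List.mem_range.1 (List.mem_filter.1 hb).1
    have : Nat.beq (j - b) 0 = false := by
      cases h : Nat.beq (j - b) 0
      · rfl
      · have := Nat.eq_of_beq_eq_true h
        omega
    simp [termsR, this]
  rw [h1, List.nil_append]
  simp only [termsR]
  cases h : (Nat.beq (j &&& a) j && Nat.ble (j % 2) r)
  · simp [h]
  · simp [h, termsR]

theorem termsR_cons (a : ℕ) (as : List ℕ) (j r : ℕ) : termsR (a :: as) j r =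
    ((List.range (j + 1)).filter fun b => Nat.beq (b &&& a) b && Nat.ble (b % 2) r).flatMap
      fun b => (termsR as (j - b) (r - b % 2)).map fun l => (a + b) :: l := by
  cases as with
  | nil => exact termsR_single a j r
  | cons c as => rw [termsR]

theorem oddsL_terms : ∀ (f : List ℕ) (j : ℕ) (t : List ℕ), t ∈ terms f j → oddsL t ≤ oddsL f := by
  intro f
  induction f with
  | nil => intro j t h; rw [mem_terms_nil] at h; rw [h.2]
  | cons a as ih =>
    intro j t h
    rw [mem_terms_cons] at h
    obtain ⟨b, _, hb, l, hl, rfl⟩ := h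
    have := ih _ _ hl
    have := bsub_mod hb
    simp only [oddsL]; omega

theorem termsR_sum : ∀ (f : List ℕ) (j r : ℕ) (g : List ℕ → ZMod 2),
    (∀ t ∈ terms f j, oddsL t + r < oddsL f → g t = 0) →
    ((termsR f j r).map g).sum = ((terms f j).map g).sum := by
  intro f
  induction f with
  | nil => intro j r g _; rfl
  | cons a as ih =>
    intro j r g hg
    rw [termsR_cons, terms]
    have hmem : ∀ b ∈ List.range (j + 1), b &&& a = b → ∀ l ∈ terms as (j - b),
        (a + b) :: l ∈ terms (a :: as) j := by
      intro b hb hba l hl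
      rw [mem_terms_cons]
      exact ⟨b, by have := List.mem_range.1 hb; omega, hba, l, hl, rfl⟩
    generalize List.range (j + 1) = R at hmem
    induction R with
    | nil => rfl
    | cons b R ihR =>
      have ih2 := ihR (fun b' hb' => hmem b' (by simp [hb']))
      have hm := hmem b (by simp)
      rw [List.filter_cons, List.filter_cons]
      cases h1 : Nat.beq (b &&& a) b
      · simpa using ih2
      · have hba := Nat.eq_of_beq_eq_true h1
        have hm1 := bsub_mod hba
        cases h2 : Nat.ble (b % 2) r
        · have hr : r = 0 ∧ b % 2 = 1 := by
            have : ¬ b % 2 ≤ r := by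
              intro h3; rw [Nat.ble_eq_true_of_le h3] at h2; simp at h2
            omega
          simp only [Bool.and_false, Bool.false_eq_true, if_false, if_true, List.flatMap_cons,
            List.map_append, List.sum_append, List.map_map]
          rw [ih2]
          have : ((terms as (j - b)).map (g ∘ fun l => (a + b) :: l)).sum = 0 := by
            apply List.sum_eq_zero
            intro x hx
            rw [List.mem_map] at hx
            obtain ⟨l, hl, rfl⟩ := hx
            apply hg _ (hm hba l hl)
            have := oddsL_terms _ _ _ hl
            simp only [oddsL]; omega
          rw [this, zero_add]
        · have hr := Nat.le_of_ble_eq_true h2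
          simp only [Bool.and_true, if_true, List.flatMap_cons,
            List.map_append, List.sum_append, List.map_map]
          rw [ih2]
          congr 1
          apply ih
          intro t ht hlt
          apply hg _ (hm hba t ht)
          simp only [oddsL]; omega

theorem termsR_sub : ∀ (f : List ℕ) (j r : ℕ), ∀ t ∈ termsR f j r, t ∈ terms f j := by
  intro f
  induction f with
  | nil => intro j r t h; exact h
  | cons a as ih =>
    intro j r t h
    rw [termsR_cons] at h
    simp only [List.mem_flatMap, List.mem_filter, List.mem_range, List.mem_map,
      Bool.and_eq_true] at h
    obtain ⟨b, ⟨h1, h2, _⟩, l, h3, rfl⟩ := h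
    rw [mem_terms_cons]
    exact ⟨b, by omega, Nat.eq_of_beq_eq_true h2, l, ih _ _ l h3, rfl⟩

/-! sorting -/
def insD (a : ℕ) : List ℕ → List ℕ
  | [] => [a]
  | b :: l => bif Nat.ble b a then a :: b :: l else b :: insD a l

def sortD : List ℕ → List ℕ
  | [] => []
  | a :: l => insD a (sortD l)

theorem insD_perm (a : ℕ) (l : List ℕ) : List.Perm (insD a l) (a :: l) := by
  induction l with
  | nil => exact List.Perm.refl _
  | cons b l ih =>
    unfold insD
    cases Nat.ble b a
    · exact (List.Perm.cons b ih).trans (List.Perm.swap a b l)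
    · exact List.Perm.refl _

theorem sortD_perm (l : List ℕ) : List.Perm (sortD l) l := by
  induction l with
  | nil => exact List.Perm.refl _
  | cons b l ih => exact (insD_perm b _).trans (List.Perm.cons b ih)

theorem insD_sorted (a : ℕ) (l : List ℕ) (h : l.Pairwise (· ≥ ·)) :
    (insD a l).Pairwise (· ≥ ·) := by
  induction l with
  | nil => simp [insD]
  | cons b l ih =>
    unfold insD
    rw [List.pairwise_cons] at h
    cases h' : Nat.ble b a
    · have hba : ¬ b ≤ a := by intro h3; rw [Nat.ble_eq_true_of_le h3] at h'; simp at h'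
      simp only [cond_false, List.pairwise_cons]
      refine ⟨?_, ih h.2⟩
      intro x hx
      rw [(insD_perm a l).mem_iff, List.mem_cons] at hx
      rcases hx with rfl | hx
      · omega
      · exact h.1 x hx
    · have := Nat.le_of_ble_eq_true h'
      simp only [cond_true, List.pairwise_cons]
      refine ⟨?_, h⟩
      intro x hx
      rw [List.mem_cons] at hx
      rcases hx with rfl | hx
      · exact this
      · have := h.1 x hx
        omega

theorem sortD_sorted (l : List ℕ) : (sortD l).Pairwise (· ≥ ·) := by
  induction l with
  | nil => simp [sortD]
  | cons b l ih => exact insD_sorted b _ ih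

def pack : List ℕ → ℕ
  | [] => 0
  | a :: l => a + 64 * pack l

theorem pack_inj : ∀ l l' : List ℕ, l.length = l'.length → (∀ a ∈ l, a < 64) →
    (∀ a ∈ l', a < 64) → pack l = pack l' → l = l' := by
  intro l
  induction l with
  | nil => intro l' h _ _ _; exact (List.length_eq_zero_iff.1 h.symm).symm
  | cons a l ih =>
    intro l' h h1 h2 hp
    match l', h with
    | b :: l', h =>
      simp only [pack] at hp
      have ha := h1 a (by simp)
      have hb := h2 b (by simp)
      have : a = b := by omega
      subst this
      congr 1
      exact ih l' (by simpa using h) (fun x hx => h1 x (by simp [hx]))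
        (fun x hx => h2 x (by simp [hx])) (by omega)

def keyL (l : List ℕ) : ℕ := pack (sortD l)

def keyV (v : Vn 5) : ℕ := keyL (List.ofFn v)

theorem perm_of_ofFn {x y : Vn 5} (h : List.Perm (List.ofFn x) (List.ofFn y)) :
    ∃ σ : Equiv.Perm (Fin 5), x = y ∘ σ := by
  have h1 : x ∘ Tuple.sort x = y ∘ Tuple.sort y := by
    apply List.ofFn_injective
    refine List.Perm.eq_of_pairwise' (r := (· ≤ ·)) ?_ ?_
      (((Tuple.sort x).ofFn_comp_perm x).trans (h.trans ((Tuple.sort y).ofFn_comp_perm y).symm))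
    · exact (Tuple.monotone_sort x).sortedLE_ofFn.pairwise
    · exact (Tuple.monotone_sort y).sortedLE_ofFn.pairwise
  refine ⟨(Tuple.sort x).symm.trans (Tuple.sort y), ?_⟩
  funext i
  have := congrFun h1 ((Tuple.sort x).symm i)
  simpa using this

theorem keyV_eq {x y : Vn 5} (hx : ∀ i, x i < 64) (hy : ∀ i, y i < 64) (h : keyV x = keyV y) :
    ∃ σ : Equiv.Perm (Fin 5), x = y ∘ σ := by
  apply perm_of_ofFn
  have h1 := sortD_perm (List.ofFn x)
  have h2 := sortD_perm (List.ofFn y)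
  have h3 := pack_inj _ _ (by rw [h1.length_eq, h2.length_eq]; simp) ?_ ?_ h
  · rw [h3] at h1; exact h1.symm.trans h2
  · intro a ha
    rw [h1.mem_iff, List.mem_ofFn] at ha
    obtain ⟨i, rfl⟩ := ha; exact hx i
  · intro a ha
    rw [h2.mem_iff, List.mem_ofFn] at ha
    obtain ⟨i, rfl⟩ := ha; exact hy i

/-! search trees -/
inductive Tr where
  | nil : Tr
  | node : Tr → ℕ → Tr → Tr

def Tr.memA : Tr → ℕ → ℕ → Bool
  | .nil, _, _ => false
  | .node l a r, k, h => bif Nat.beq k a then true else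
      bif Nat.beq (h % 2) 0 then l.memA k (h / 2) else r.memA k (h / 2)

def Tr.insA : Tr → ℕ → ℕ → Tr
  | .nil, k, _ => .node .nil k .nil
  | .node l a r, k, h => bif Nat.beq (h % 2) 0 then .node (l.insA k (h / 2)) a r
      else .node l a (r.insA k (h / 2))

/-- a hash used to keep the search trees balanced -/
def hsh (k : ℕ) : ℕ := (k * 2654435769 / 65536) % 4294967296

def Tr.mem (t : Tr) (k : ℕ) : Bool := t.memA k (hsh k)

def Tr.ins (t : Tr) (k : ℕ) : Tr := t.insA k (hsh k)

def Tr.All (p : ℕ → Prop) : Tr → Prop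
  | .nil => True
  | .node l a r => l.All p ∧ p a ∧ r.All p

theorem Tr.All.memA {p : ℕ → Prop} {t : Tr} (h : t.All p) {k : ℕ} :
    ∀ {c : ℕ}, t.memA k c = true → p k := by
  induction t with
  | nil => intro c hk; simp [Tr.memA] at hk
  | node l a r ihl ihr =>
    intro c hk
    obtain ⟨h1, h2, h3⟩ := h
    unfold Tr.memA at hk
    cases h4 : Nat.beq k a
    · rw [h4] at hk
      cases h5 : Nat.beq (c % 2) 0
      · rw [h5] at hk; exact ihr h3 hk
      · rw [h5] at hk; exact ihl h1 hk
    · rw [Nat.eq_of_beq_eq_true h4]; exact h2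

theorem Tr.All.mem {p : ℕ → Prop} {t : Tr} (h : t.All p) {k : ℕ} (hk : t.mem k = true) : p k :=
  h.memA hk

theorem Tr.All.insA {p : ℕ → Prop} {t : Tr} (h : t.All p) {k : ℕ} (hk : p k) :
    ∀ c, (t.insA k c).All p := by
  induction t with
  | nil => intro c; exact ⟨trivial, hk, trivial⟩
  | node l a r ihl ihr =>
    intro c
    obtain ⟨h1, h2, h3⟩ := h
    unfold Tr.insA
    cases Nat.beq (c % 2) 0
    · exact ⟨h1, h2, ihr h3 _⟩
    · exact ⟨ihl h1 _, h2, h3⟩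

theorem Tr.All.ins {p : ℕ → Prop} {t : Tr} (h : t.All p) {k : ℕ} (hk : p k) : (t.ins k).All p :=
  h.insA hk _

/-! toggling -/
def eqL : List ℕ → List ℕ → Bool
  | [], [] => true
  | a :: l, b :: l' => Nat.beq a b && eqL l l'
  | _, _ => false

theorem eqL_eq : ∀ l l', eqL l l' = true → l = l' := by
  intro l
  induction l with
  | nil => intro l' h; cases l' <;> simp_all [eqL]
  | cons a l ih =>
    intro l' h
    cases l' with
    | nil => simp [eqL] at h
    | cons b l' =>
      simp only [eqL, Bool.and_eq_true] at h
      rw [Nat.eq_of_beq_eq_true h.1, ih _ h.2]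

def tog (x : List ℕ) : List (List ℕ) → List (List ℕ)
  | [] => [x]
  | y :: L => bif eqL x y then L else y :: tog x L

theorem zm2 (a : ZMod 2) : a + a = 0 := CharTwo.add_self_eq_zero a

theorem tog_sum (g : List ℕ → ZMod 2) (x : List ℕ) (L : List (List ℕ)) :
    ((tog x L).map g).sum = g x + (L.map g).sum := by
  induction L with
  | nil => simp [tog]
  | cons y L ih =>
    unfold tog
    cases h : eqL x y
    · simp only [cond_false, List.map_cons, List.sum_cons, ih]; ring
    · rw [eqL_eq _ _ h]
      simp only [cond_true, List.map_cons, List.sum_cons, ← add_assoc, zm2, zero_add]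

theorem tog_mem {x t : List ℕ} {L : List (List ℕ)} (h : t ∈ tog x L) : t = x ∨ t ∈ L := by
  induction L with
  | nil => left; simpa [tog] using h
  | cons y L ih =>
    unfold tog at h
    cases h' : eqL x y
    · rw [h'] at h
      simp only [cond_false, List.mem_cons] at h ⊢
      tauto
    · rw [h'] at h
      simp only [cond_true] at h
      simp [h]

def togs (M : List (List ℕ)) (L : List (List ℕ)) : List (List ℕ) := M.foldr tog L

theorem togs_sum (g : List ℕ → ZMod 2) (M L : List (List ℕ)) :
    ((togs M L).map g).sum = (M.map g).sum + (L.map g).sum := by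
  unfold togs
  induction M with
  | nil => simp
  | cons y M ih => simp only [List.foldr_cons, tog_sum, ih, List.map_cons, List.sum_cons, add_assoc]

/-! one relation: packed as `f + 64^5 j` -/
def unp : ℕ → ℕ → List ℕ
  | 0, _ => []
  | k + 1, n => n % 64 :: unp k (n / 64)

theorem unp_len (k : ℕ) : ∀ n, (unp k n).length = k := by
  induction k with
  | zero => intro n; rfl
  | succ k ih => intro n; simp [unp, ih]

def relF (r : ℕ) : List ℕ := unp 5 r
def relJ (r : ℕ) : ℕ := r / 1073741824

theorem relF_len (r : ℕ) : (relF r).length = 5 := unp_len 5 r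

def allLt (m : ℕ) : List ℕ → Bool
  | [] => true
  | a :: l => Nat.ble (a + 1) m && allLt m l

theorem allLt_spec {m : ℕ} : ∀ {l : List ℕ}, l.length = 5 → allLt m l = true → ∀ i, ve l i < m := by
  intro l hl h
  obtain ⟨a, b, c, d, e, rfl⟩ := len5 hl
  simp only [allLt, Bool.and_eq_true, Nat.ble_eq] at h
  intro i; fin_cases i <;> simp [ve] <;> omega

/-- terms of a relation that are kept -/
def keep (Ω : List ℕ) (m : ℕ) (K : Tr) (t : List ℕ) : Bool :=
  match cmpW Ω t with
  | 0 => false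
  | 1 => !(allLt m t && K.mem (keyL t))
  | _ => true

def relTerms (Ω : List ℕ) (m : ℕ) (K : Tr) (r : ℕ) : List (List ℕ) :=
  (termsR (relF r) (relJ r) (oddsL (relF r) - Ω.headD 0)).filter (keep Ω m K)

def stepOut (Ω : List ℕ) (m : ℕ) (K : Tr) (rs : List ℕ) : List (List ℕ) :=
  rs.foldr (fun r L => togs (relTerms Ω m K r) L) []

def sumL : List ℕ → ℕ
  | [] => 0
  | a :: l => a + sumL l

def suppLe : List ℕ → List ℕ → Bool
  | a :: l, b :: l' => (Nat.beq a 0 || Nat.ble 1 b) && suppLe l l'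
  | _, _ => true

/-- relation is fine for deriving facts about `x` -/
def relOk (m : ℕ) (x : List ℕ) (r : ℕ) : Bool :=
  allLt m (relF r) && Nat.ble 1 (relJ r) && Nat.ble (relJ r + 1) m &&
    Nat.beq (sumL (relF r) + relJ r) (sumL x) && suppLe x (relF r)

theorem sz_ve {l : List ℕ} (h : l.length = 5) : sz (ve l) = sumL l := by
  obtain ⟨f0, f1, f2, f3, f4, rfl⟩ := len5 h
  simp [sz, ve, sumL, Fin.sum_univ_five]; omega

theorem suppLe_spec {l l' : List ℕ} (h : l.length = 5) (h' : l'.length = 5)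
    (hs : suppLe l l' = true) : ∀ i, 0 < ve l i → 0 < ve l' i := by
  obtain ⟨f0, f1, f2, f3, f4, rfl⟩ := len5 h
  obtain ⟨g0, g1, g2, g3, g4, rfl⟩ := len5 h'
  simp only [suppLe, Bool.and_eq_true, Bool.or_eq_true, Nat.beq_eq, Nat.ble_eq, and_true] at hs
  intro i; fin_cases i <;> simp [ve] <;> omega

theorem Bset_shift {s : ℕ} {f y : Vn 5} {j : ℕ} (hj : j < 2 ^ s) (hf : ∀ i, f i < 2 ^ s) :
    Bset (fun i => f i + 2 ^ s * y i) j = Bset f j := by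
  ext b
  simp only [mem_Bset]
  have : ∀ (_ : sz b = j) (i : Fin 5), b i &&& (f i + 2 ^ s * y i) = b i &&& f i := by
    intro hb i
    have hbi : b i ≤ sz b := Finset.single_le_sum (f := b) (fun _ _ => Nat.zero_le _) (Finset.mem_univ i)
    have hlt : b i < 2 ^ s := by omega
    apply Nat.eq_of_testBit_eq
    intro k
    rw [Nat.testBit_and, Nat.testBit_and, add_comm, Nat.testBit_two_pow_mul_add _ (hf i)]
    by_cases hk : k < s
    · simp [hk]
    · have : (b i).testBit k = false := Nat.testBit_lt_two_pow
        (lt_of_lt_of_le hlt (Nat.pow_le_pow_right (by norm_num) (not_lt.1 hk)))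
      simp [this]
  constructor
  · rintro ⟨h1, h2⟩; exact ⟨fun i => by rw [← this h2]; exact h1 i, h2⟩
  · rintro ⟨h1, h2⟩; exact ⟨fun i => by rw [this h2]; exact h1 i, h2⟩

abbrev Cls := Finset (Fin 5) → ℕ → (Vn 5 → ZMod 2) → Prop

/-- all monomials with (low part) key `k` vanish, for the functionals in the class `C` -/
def Good (Ω : List ℕ) (C : Cls) (k : ℕ) : Prop :=
  ∀ Z D μ, C Z D μ → ∀ v, sz v = D → (∀ i ∈ Z, 0 < v i) → has Ω v →
    keyV (fun i => v i % 2 ^ Ω.length) = k → μ v = 0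

theorem stepOut_sum {Ω : List ℕ} {C : Cls} (hC : ∀ Z D μ, C Z D μ → Kam Ω Z D μ)
    {K : Tr} (hK : K.All (Good Ω C)) {rs : List ℕ} {x : List ℕ} (hx : x.length = 5)
    (hrs : ∀ r ∈ rs, relOk (2 ^ Ω.length) x r = true)
    {Z D μ} (hμ : C Z D μ) {y : Vn 5} (hD : sz (ve x) + 2 ^ Ω.length * sz y = D)
    (hp : ∀ i ∈ Z, 0 < ve x i + 2 ^ Ω.length * y i) :
    ((stepOut Ω (2 ^ Ω.length) K rs).map
      fun t => μ (fun i => ve t i + 2 ^ Ω.length * y i)).sum = 0 := by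
  set s := Ω.length with hs
  induction rs with
  | nil => simp [stepOut]
  | cons r rs ih =>
    unfold stepOut
    rw [List.foldr_cons, togs_sum]
    have ih' := ih (fun r' hr' => hrs r' (by simp [hr']))
    unfold stepOut at ih'
    rw [ih', add_zero]
    have hr := hrs r (by simp)
    simp only [relOk, Bool.and_eq_true, Nat.ble_eq, Nat.beq_eq] at hr
    obtain ⟨⟨⟨⟨h1, h2⟩, h3⟩, h4⟩, h5⟩ := hr
    have hf := allLt_spec (relF_len r) h1
    have hsupp := suppLe_spec hx (relF_len r) h5
    have hfp : ∀ i ∈ Z, 0 < ve (relF r) i + 2 ^ s * y i := by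
      intro i hi
      have h6 := hp i hi
      rcases Nat.eq_zero_or_pos (ve x i) with h7 | h7
      · omega
      · have := hsupp i h7; omega
    have hsz : sz (fun i => ve (relF r) i + 2 ^ s * y i) + relJ r = D := by
      rw [sz_shift, sz_ve (relF_len r), ← hD, sz_ve hx]; omega
    have hrel := (hC _ _ _ hμ).rel (fun i => ve (relF r) i + 2 ^ s * y i) (relJ r) h2 hsz hfp
    rw [Bset_shift h3 hf] at hrel
    have e1 : ∀ b : Vn 5, (fun i => ve (relF r) i + 2 ^ s * y i) + b =
        fun i => (ve (relF r) + b) i + 2 ^ s * y i := by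
      intro b; funext i; simp only [Pi.add_apply]; ring
    simp only [e1] at hrel
    rw [← terms_sum (relF_len r) (relJ r) (fun v => μ fun i => v i + 2 ^ s * y i)] at hrel
    rw [← hrel]
    unfold relTerms
    have hall : ∀ t ∈ terms (relF r) (relJ r), keep Ω (2 ^ s) K t = false →
        μ (fun i => ve t i + 2 ^ s * y i) = 0 := by
      intro t ht hk
      obtain ⟨htl, b, hb, htb⟩ := terms_spec (relF_len r) ht
      have hb' := mem_Bset.1 hb
      have tsz : sz (fun i => ve t i + 2 ^ s * y i) = D := by
        rw [← hsz, sz_shift, sz_shift, htb, ← hb'.2]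
        have : sz (ve (relF r) + b) = sz (ve (relF r)) + sz b := by
          unfold sz; rw [← Finset.sum_add_distrib]; rfl
        rw [this]; ring
      have tp : ∀ i ∈ Z, 0 < ve t i + 2 ^ s * y i := by
        intro i hi
        have := hfp i hi
        rw [htb]; simp only [Pi.add_apply]; omega
      have hsp := cmpW_spec Ω t htl
      unfold keep at hk
      split at hk
      · rename_i h0
        exact (hC _ _ _ hμ).low _ tsz tp ((lower_shift Ω _ _).2 (hsp.1.1 h0))
      · rename_i h0
        simp only [Bool.not_eq_false', Bool.and_eq_true] at hk
        have hg := hK.mem hk.2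
        refine hg Z D μ hμ _ tsz tp ((has_shift Ω _ _).2 (hsp.2.1 h0)) ?_
        have hlt := allLt_spec htl hk.1
        have : (fun i => (ve t i + 2 ^ s * y i) % 2 ^ Ω.length) = ve t := by
          funext i
          rw [← hs, Nat.add_mul_mod_self_left, Nat.mod_eq_of_lt (hlt i)]
        rw [this]
        unfold keyV
        congr 1
        obtain ⟨a, b, c, d, e, rfl⟩ := len5 htl
        simp [List.ofFn_succ, ve]
      · simp at hk
    have hlow : ∀ t ∈ terms (relF r) (relJ r),
        oddsL t + (oddsL (relF r) - Ω.headD 0) < oddsL (relF r) → keep Ω (2 ^ s) K t = false := by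
      intro t ht hlt
      have hc : cmpW Ω t = 0 := by
        rw [(cmpW_spec Ω t (terms_spec (relF_len r) ht).1).1]
        cases hΩ : Ω with
        | nil => rw [hΩ] at hlt; simp only [List.headD_nil] at hlt; omega
        | cons w ω =>
          left
          rw [hΩ] at hlt
          simp only [List.headD_cons] at hlt
          rw [odds_ve (terms_spec (relF_len r) ht).1]; omega
      unfold keep
      rw [hc]
      rfl
    rw [← termsR_sum (relF r) (relJ r) (oddsL (relF r) - Ω.headD 0)
      (fun t => μ fun i => ve t i + 2 ^ s * y i)
      (fun t ht hlt => hall t ht (hlow t ht hlt))]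
    have hall := fun t ht => hall t (termsR_sub (relF r) (relJ r) (oddsL (relF r) - Ω.headD 0) t ht)
    generalize termsR (relF r) (relJ r) (oddsL (relF r) - Ω.headD 0) = M at hall
    clear hrel
    induction M with
    | nil => simp
    | cons t M ihM =>
      have h8 := ihM (fun t' ht' => hall t' (by simp [ht']))
      rw [List.filter_cons]
      cases hk : keep Ω (2 ^ s) K t
      · simp only [Bool.false_eq_true, if_false, List.map_cons, List.sum_cons, h8,
          hall t (by simp) hk, zero_add]
      · simp only [if_true, List.map_cons, List.sum_cons, h8]

def allB (p : ℕ → Bool) : List ℕ → Bool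
  | [] => true
  | a :: l => p a && allB p l

theorem allB_spec {p : ℕ → Bool} {l : List ℕ} (h : allB p l = true) : ∀ a ∈ l, p a = true := by
  induction l with
  | nil => simp
  | cons b l ih =>
    simp only [allB, Bool.and_eq_true] at h
    intro a ha
    rcases List.mem_cons.1 ha with rfl | ha
    · exact h.1
    · exact ih h.2 a ha

def stepK (Ω : List ℕ) (m : ℕ) (K : Tr) (rs : List ℕ) : Option Tr :=
  match stepOut Ω m K rs with
  | [x] => bif Nat.beq x.length 5 && allLt m x && Nat.beq (cmpW Ω x) 1 && allB (relOk m x) rs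
      then some (K.ins (keyL x)) else none
  | _ => none

def runK (Ω : List ℕ) (m : ℕ) : List (List ℕ) → Tr → Option Tr
  | [], K => some K
  | rs :: L, K => match stepK Ω m K rs with
    | some K' => runK Ω m L K'
    | none => none

/-- permutation-invariant classes -/
def PermInv (C : Cls) : Prop :=
  ∀ (σ : Equiv.Perm (Fin 5)) Z D μ, C Z D μ →
    C (Z.map σ.toEmbedding) D (fun v => μ (v ∘ σ))

theorem sz_comp (v : Vn 5) (σ : Equiv.Perm (Fin 5)) : sz (v ∘ σ) = sz v :=
  Equiv.sum_comp σ v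

theorem odds_comp (v : Vn 5) (σ : Equiv.Perm (Fin 5)) : odds (v ∘ σ) = odds v :=
  Equiv.sum_comp σ (fun i => v i % 2)

theorem has_comp (Ω : List ℕ) (σ : Equiv.Perm (Fin 5)) : ∀ v : Vn 5, has Ω (v ∘ σ) ↔ has Ω v := by
  induction Ω with
  | nil => intro v; simp [has]
  | cons w ω ih =>
    intro v
    have : half (v ∘ σ) = half v ∘ σ := rfl
    simp only [has, odds_comp, this, ih]

theorem lower_comp (Ω : List ℕ) (σ : Equiv.Perm (Fin 5)) :
    ∀ v : Vn 5, lower Ω (v ∘ σ) ↔ lower Ω v := by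
  induction Ω with
  | nil => intro v; simp [lower]
  | cons w ω ih =>
    intro v
    have : half (v ∘ σ) = half v ∘ σ := rfl
    simp only [lower, odds_comp, this, ih]

theorem Bset_comp (f : Vn 5) (j : ℕ) (σ : Equiv.Perm (Fin 5)) (g : Vn 5 → ZMod 2) :
    ∑ b ∈ Bset f j, g ((f + b) ∘ σ) = ∑ b ∈ Bset (f ∘ σ) j, g (f ∘ σ + b) := by
  apply Finset.sum_bij (fun b _ => b ∘ σ)
  · intro b hb
    rw [mem_Bset] at hb ⊢
    exact ⟨fun i => hb.1 (σ i), by rw [sz_comp]; exact hb.2⟩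
  · intro b _ c _ h
    funext i
    have := congrFun h (σ.symm i)
    simpa using this
  · intro b hb
    rw [mem_Bset] at hb
    refine ⟨b ∘ σ.symm, ?_, ?_⟩
    · rw [mem_Bset]
      refine ⟨fun i => ?_, by rw [sz_comp]; exact hb.2⟩
      have := hb.1 (σ.symm i)
      simpa using this
    · funext i; simp
  · intro b _; rfl

theorem Kam.comp {Ω : List ℕ} {Z D μ} (h : Kam Ω Z D μ) (σ : Equiv.Perm (Fin 5)) :
    Kam Ω (Z.map σ.toEmbedding) D (fun v => μ (v ∘ σ)) := by
  have hp : ∀ v : Vn 5, (∀ i ∈ Z.map σ.toEmbedding, 0 < v i) → ∀ i ∈ Z, 0 < (v ∘ σ) i := by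
    intro v hv i hi
    exact hv (σ i) (Finset.mem_map_of_mem _ hi)
  constructor
  · intro f j hj hs hf
    rw [Bset_comp f j σ μ]
    exact h.rel (f ∘ σ) j hj (by rw [sz_comp]; exact hs) (hp f hf)
  · intro v hs hv hl
    exact h.low _ (by rw [sz_comp]; exact hs) (hp v hv) ((lower_comp Ω σ v).2 hl)

theorem permInv_Kam (Ω : List ℕ) : PermInv (Kam Ω) := fun σ _ _ _ h => h.comp σ

theorem stepK_sound {Ω : List ℕ} (hΩ : Ω.length ≤ 6) {C : Cls}
    (hC : ∀ Z D μ, C Z D μ → Kam Ω Z D μ) (hP : PermInv C)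
    {K K' : Tr} (hK : K.All (Good Ω C)) {rs : List ℕ}
    (h : stepK Ω (2 ^ Ω.length) K rs = some K') : K'.All (Good Ω C) := by
  unfold stepK at h
  split at h
  · rename_i x hx
    cases hb : (Nat.beq x.length 5 && allLt (2 ^ Ω.length) x && Nat.beq (cmpW Ω x) 1 &&
      allB (relOk (2 ^ Ω.length) x) rs)
    · rw [hb] at h; simp at h
    · rw [hb] at h
      simp only [cond_true, Option.some.injEq] at h
      rw [← h]
      apply hK.ins
      simp only [Bool.and_eq_true, Nat.beq_eq] at hb
      obtain ⟨⟨⟨h1, h2⟩, h3⟩, h4⟩ := hb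
      have h2' := allLt_spec h1 h2
      intro Z D μ hμ v hs hp hv hk
      have hle : 2 ^ Ω.length ≤ 64 := by
        calc 2 ^ Ω.length ≤ 2 ^ 6 := Nat.pow_le_pow_right (by norm_num) hΩ
          _ = 64 := by norm_num
      have hkx : keyL x = keyV (ve x) := by
        unfold keyV
        congr 1
        obtain ⟨a, b, c, d, e, rfl⟩ := len5 h1
        simp [List.ofFn_succ, ve]
      rw [hkx] at hk
      obtain ⟨σ, hσ⟩ := keyV_eq (fun i => lt_of_lt_of_le (Nat.mod_lt _ (by positivity)) hle)
        (fun i => lt_of_lt_of_le (h2' i) hle) hk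
      have hμ' := hP σ _ _ _ hμ
      have hvs : (fun i => ve x i + 2 ^ Ω.length * (v (σ.symm i) / 2 ^ Ω.length)) = v ∘ σ.symm := by
        funext i
        have := congrFun hσ (σ.symm i)
        simp only [Function.comp_apply, Equiv.apply_symm_apply] at this
        rw [← this, Function.comp_apply]
        exact Nat.mod_add_div _ _
      have hfin := stepOut_sum hC hK (rs := rs) h1 (allB_spec h4) hμ'
        (y := fun i => v (σ.symm i) / 2 ^ Ω.length) ?_ ?_
      · rw [hx] at hfin
        simp only [List.map_cons, List.map_nil, List.sum_cons, List.sum_nil, add_zero, hvs] at hfin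
        have : (v ∘ σ.symm) ∘ σ = v := by funext i; simp
        rw [this] at hfin
        exact hfin
      · rw [← sz_shift, hvs, sz_comp, hs]
      · intro i hi
        have := congrFun hvs i
        rw [this]
        rw [Finset.mem_map] at hi
        obtain ⟨k, hk, rfl⟩ := hi
        simpa using hp k hk
  · simp at h

theorem runK_sound {Ω : List ℕ} (hΩ : Ω.length ≤ 6) {C : Cls}
    (hC : ∀ Z D μ, C Z D μ → Kam Ω Z D μ) (hP : PermInv C) (L : List (List ℕ)) :
    ∀ {K K' : Tr}, K.All (Good Ω C) → runK Ω (2 ^ Ω.length) L K = some K' → K'.All (Good Ω C) := by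
  induction L with
  | nil => intro K K' hK h; simp only [runK, Option.some.injEq] at h; rw [← h]; exact hK
  | cons rs L ih =>
    intro K K' hK h
    unfold runK at h
    split at h
    · rename_i K1 h1
      exact ih (stepK_sound hΩ hC hP hK h1) h
    · simp at h

/-! ### Enumerating sorted vectors of a given weight -/

def colsL : ℕ → ℕ → List (List ℕ)
  | 0, w => bif Nat.beq w 0 then [[]] else []
  | n + 1, w => (colsL n w).map (fun l => 0 :: l) ++
      (bif Nat.beq w 0 then [] else (colsL n (w - 1)).map fun l => 1 :: l)

theorem mem_colsL : ∀ l : List ℕ, (∀ a ∈ l, a < 2) → l ∈ colsL l.length (sumL l) := by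
  intro l
  induction l with
  | nil => intro _; simp [colsL, sumL]
  | cons a l ih =>
    intro h
    have h1 := ih (fun b hb => h b (by simp [hb]))
    have h2 := h a (by simp)
    simp only [List.length_cons, colsL, sumL, List.mem_append, List.mem_map]
    interval_cases a
    · left; exact ⟨l, by simpa using h1, rfl⟩
    · right
      have : Nat.beq (1 + sumL l) 0 = false := by
        rw [Nat.add_comm]; rfl
      rw [this]
      simp only [cond_false, List.mem_map]
      exact ⟨l, by simpa using h1, rfl⟩

def addCol : List ℕ → List ℕ → List ℕ
  | a :: l, c :: l' => (2 * a + c) :: addCol l l'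
  | _, _ => []

def isDesc : List ℕ → Bool
  | a :: b :: l => Nat.ble b a && isDesc (b :: l)
  | _ => true

def genL : List ℕ → List (List ℕ)
  | [] => [[0, 0, 0, 0, 0]]
  | w :: ω => (genL ω).flatMap fun u => ((colsL 5 w).map (addCol u)).filter isDesc

theorem mem_genL (Ω : List ℕ) : ∀ l : List ℕ, l.length = 5 → l.Pairwise (· ≥ ·) →
    has Ω (ve l) → (∀ i, ve l i < 2 ^ Ω.length) → l ∈ genL Ω := by
  induction Ω with
  | nil =>
    intro l hl _ _ h
    obtain ⟨a, b, c, d, e, rfl⟩ := len5 hl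
    have h0 := h 0; have h1 := h 1; have h2 := h 2; have h3 := h 3; have h4 := h 4
    simp [ve] at h0 h1 h2 h3 h4
    simp [genL, h0, h1, h2, h3, h4]
  | cons w ω ih =>
    intro l hl hp hh hlt
    have e1 := half_ve hl
    rw [genL, List.mem_flatMap]
    refine ⟨halfL l, ih _ (by simpa [halfL] using hl) ?_ (by rw [← e1]; exact hh.2) ?_, ?_⟩
    · unfold halfL
      rw [List.pairwise_map]
      exact hp.imp (fun h => Nat.div_le_div_right h)
    · intro i
      rw [← e1]
      have := hlt i
      simp only [half]
      rw [List.length_cons, pow_succ] at this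
      omega
    · rw [List.mem_filter, List.mem_map]
      constructor
      · refine ⟨l.map (fun a => a % 2), ?_, ?_⟩
        · have hw := hh.1
          rw [odds_ve hl] at hw
          have := mem_colsL (l.map (fun a => a % 2)) (by
            intro a ha
            rw [List.mem_map] at ha
            obtain ⟨b, _, rfl⟩ := ha
            omega)
          rw [List.length_map, hl] at this
          have e2 : sumL (l.map fun a => a % 2) = w := by
            rw [← hw]
            clear * -
            induction l with
            | nil => rfl
            | cons a l ih => simp [sumL, oddsL, ih]
          rw [e2] at this; exact this
        · obtain ⟨a, b, c, d, e, rfl⟩ := len5 hl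
          simp [halfL, addCol]; omega
      · obtain ⟨a, b, c, d, e, rfl⟩ := len5 hl
        simp only [List.pairwise_cons, List.mem_cons] at hp
        simp only [isDesc, Bool.and_eq_true, Nat.ble_eq, and_true]
        refine ⟨hp.1 b (by simp), hp.2.1 c (by simp), hp.2.2.1 d (by simp), hp.2.2.2.1 e (by simp)⟩

def allLL (p : List ℕ → Bool) : List (List ℕ) → Bool
  | [] => true
  | a :: l => p a && allLL p l

theorem allLL_spec {p : List ℕ → Bool} {l : List (List ℕ)} (h : allLL p l = true) :
    ∀ a ∈ l, p a = true := by
  induction l with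
  | nil => simp
  | cons b l ih =>
    simp only [allLL, Bool.and_eq_true] at h
    intro a ha
    rcases List.mem_cons.1 ha with rfl | ha
    · exact h.1
    · exact ih h.2 a ha

theorem final_cert {Ω : List ℕ} {C : Cls} {K : Tr} (hK : K.All (Good Ω C)) {p : List ℕ → Bool}
    (hall : allLL (fun l => !p l || K.mem (pack l)) (genL Ω) = true)
    {Z D μ} (hμ : C Z D μ) {v : Vn 5} (hs : sz v = D) (hp : ∀ i ∈ Z, 0 < v i) (hv : has Ω v)
    (hpv : p (sortD (List.ofFn fun i => v i % 2 ^ Ω.length)) = true) : μ v = 0 := by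
  set x : Vn 5 := fun i => v i % 2 ^ Ω.length with hx
  set l := sortD (List.ofFn x) with hl
  have hperm := sortD_perm (List.ofFn x)
  have hlen : l.length = 5 := by rw [hl, hperm.length_eq]; simp
  have hle : l = List.ofFn (ve l) := by
    obtain ⟨a, b, c, d, e, h⟩ := len5 hlen
    rw [h]; simp [List.ofFn_succ, ve]
  obtain ⟨σ, hσ⟩ := perm_of_ofFn (x := ve l) (y := x) (by rw [← hle]; exact hperm)
  have hmem : l ∈ genL Ω := by
    apply mem_genL Ω l hlen (sortD_sorted _)
    · rw [hσ, has_comp, ← has_shift Ω x (fun i => v i / 2 ^ Ω.length), hx, split_mod]; exact hv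
    · intro i; rw [hσ]; exact Nat.mod_lt _ (by positivity)
  have h1 := allLL_spec hall l hmem
  rw [hpv] at h1
  simp only [Bool.not_true, Bool.false_or] at h1
  exact hK.mem h1 Z D μ hμ v hs hp hv rfl

def certOk (Ω : List ℕ) (m : ℕ) (L : List (List ℕ)) (p : List ℕ → Bool) : Bool :=
  match runK Ω m L .nil with
  | some K => allLL (fun l => !p l || K.mem (pack l)) (genL Ω)
  | none => false

theorem zero_of_cert {Ω : List ℕ} {m : ℕ} {L : List (List ℕ)} (hΩ : Ω.length ≤ 6)
    (hm : m = 2 ^ Ω.length) (h : certOk Ω m L (fun _ => true) = true) : ZeroW Ω := by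
  intro Z D μ hμ v hs hp hv
  subst hm
  unfold certOk at h
  split at h
  · rename_i K hK
    exact final_cert (runK_sound hΩ (fun _ _ _ h => h) (permInv_Kam Ω) L (by trivial) hK) h hμ hs hp hv rfl
  · simp at h

def valW : List ℕ → ℕ
  | [] => 0
  | w :: ω => w + 2 * valW ω

theorem sz_has (Ω : List ℕ) : ∀ v : Vn 5, has Ω v →
    sz v = valW Ω + 2 ^ Ω.length * sz (fun i => v i / 2 ^ Ω.length) := by
  induction Ω with
  | nil => intro v _; simp [valW]
  | cons w ω ih =>
    intro v h
    have h1 := ih _ h.2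
    have : (fun i => half v i / 2 ^ ω.length) = (fun i => v i / 2 ^ (ω.length + 1)) := by
      funext i; simp only [half]; rw [Nat.div_div_eq_div_mul, pow_succ']
    rw [this] at h1
    have h2 : sz v = odds v + 2 * sz (half v) := by
      unfold sz odds half
      rw [Finset.mul_sum, ← Finset.sum_add_distrib]
      apply Finset.sum_congr rfl
      intro i _; omega
    rw [h2, h.1, h1, valW, List.length_cons, pow_succ]; ring

theorem lt_of_has {Ω : List ℕ} {v : Vn 5} (h : has Ω v) (hs : sz v = valW Ω) (i : Fin 5) :
    v i < 2 ^ Ω.length := by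
  have h1 := sz_has Ω v h
  have h2 : sz (fun i => v i / 2 ^ Ω.length) = 0 := by
    have : 2 ^ Ω.length * sz (fun i => v i / 2 ^ Ω.length) = 0 := by omega
    rcases Nat.mul_eq_zero.1 this with h | h
    · exact absurd h (by positivity)
    · exact h
  have h3 := (Finset.sum_eq_zero_iff (s := Finset.univ)).1 h2 i (Finset.mem_univ i)
  simp only [Nat.div_eq_zero_iff] at h3
  rcases h3 with h3 | h3
  · exact absurd h3 (by positivity)
  · exact h3

/-- last entry positive, for sorted lists: all positive -/
def allPos : List ℕ → Bool
  | [] => true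
  | a :: l => Nat.ble 1 a && allPos l

theorem allPos_spec {l : List ℕ} (h : ∀ a ∈ l, 0 < a) : allPos l = true := by
  induction l with
  | nil => rfl
  | cons a l ih =>
    simp only [allPos, Bool.and_eq_true, Nat.ble_eq]
    exact ⟨h a (by simp), ih fun b hb => h b (by simp [hb])⟩

theorem allPos_v {Ω : List ℕ} {v : Vn 5} (h : has Ω v) (hs : sz v = valW Ω) (hp : ∀ i, 0 < v i) :
    allPos (sortD (List.ofFn fun i => v i % 2 ^ Ω.length)) = true := by
  apply allPos_spec
  intro a ha
  rw [(sortD_perm _).mem_iff, List.mem_ofFn] at ha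
  obtain ⟨i, rfl⟩ := ha
  show 0 < v i % 2 ^ Ω.length
  rw [Nat.mod_eq_of_lt (lt_of_has h hs i)]; exact hp i

theorem zero_of_cert_pos {Ω : List ℕ} {m : ℕ} {L : List (List ℕ)} (hΩ : Ω.length ≤ 6)
    (hm : m = 2 ^ Ω.length) (h : certOk Ω m L allPos = true) {μ : Vn 5 → ZMod 2}
    (hμ : Kam Ω Finset.univ (valW Ω) μ) {v : Vn 5} (hs : sz v = valW Ω) (hp : ∀ i, 0 < v i)
    (hv : has Ω v) : μ v = 0 := by
  subst hm
  unfold certOk at h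
  split at h
  · rename_i K hK
    exact final_cert (runK_sound hΩ (fun _ _ _ h => h) (permInv_Kam Ω) L (by trivial) hK) h hμ hs
      (fun i _ => hp i) hv (allPos_v hv hs hp)
  · simp at h

/-! ### Certificates -/

def cert12 : List (List ℕ) :=
  [[1073741891], [2147487809, 1073750081]]

theorem zero12 : ZeroW [1, 2] :=
  zero_of_cert (m := 4) (L := cert12) (by decide) (by decide) (by decide +kernel)

def cert15 : List (List ℕ) :=
  [[1091051651]]

theorem zero15 : ZeroW [1, 5] :=
  zero_of_cert (m := 4) (L := cert15) (by decide) (by decide) (by decide +kernel)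

def cert25 : List (List ℕ) :=
  [[1091051715]]

theorem zero25 : ZeroW [2, 5] :=
  zero_of_cert (m := 4) (L := cert25) (by decide) (by decide) (by decide +kernel)

def cert45 : List (List ℕ) :=
  [[1091317955]]

theorem zero45 : ZeroW [4, 5] :=
  zero_of_cert (m := 4) (L := cert45) (by decide) (by decide) (by decide +kernel)

def cert35 : List (List ℕ) :=
  [[1091055811]]

theorem zero35 : ZeroW [3, 5] :=
  zero_of_cert (m := 4) (L := cert35) (by decide) (by decide) (by decide +kernel)

def cert114 : List (List ℕ) :=
  [[1074544903], [2148024646], [2164801798], [1091584261], [2198356228]]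

theorem zero114 : ZeroW [1, 1, 4] :=
  zero_of_cert (m := 8) (L := cert114) (by decide) (by decide) (by decide +kernel)

def cert133 : List (List ℕ) :=
  [[1073762695], [1074020743], [1074544966], [1091059975], [1091322118], [2148020614],
   [2181578950], [1074024838], [1091060038]]

theorem zero133 : ZeroW [1, 3, 3] :=
  zero_of_cert (m := 8) (L := cert133) (by decide) (by decide) (by decide +kernel)

def cert132 : List (List ℕ) :=
  [[1073746311], [1073754438], [1074012423], [1074016518], [1091055876], [2148016326],
   [2181570819], [1074012486], [1091051781]]

theorem zero132 : ZeroW [1, 3, 2] :=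
  zero_of_cert (m := 8) (L := cert132) (by decide) (by decide) (by decide +kernel)

def cert234 : List (List ℕ) :=
  [[1074553287], [2148295047], [2164810119], [2165072262], [1091584455], [1091588487],
   [2198356359], [1091850630], [2198360454]]

theorem zero234 : ZeroW [2, 3, 4] :=
  zero_of_cert (m := 8) (L := cert234) (by decide) (by decide) (by decide +kernel)

def cert4241 : List (List ℕ) :=
  [[2148291023], [2164806095], [2165068175], [2165068238], [1091850575], [2198360399],
   [2148299213], [2164814285], [2165072333], [2165076428], [1091850701], [2198360525],
   [2182369739], [2182377929], [2199151049], [2199155144], [1158959561], [2199146954],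
   [4380184967], [2199146891], [1125405005]]

theorem zero4241 : ZeroW [4, 2, 4, 1] :=
  zero_of_cert (m := 16) (L := cert4241) (by decide) (by decide) (by decide +kernel)

def cert2113 : List (List ℕ) :=
  [[2147508815], [2147770895], [2147512910], [2147770958], [2164548110], [4294984397],
   [4294988429], [4295246477], [4294988492], [4295246540], [4295250572], [4312023692],
   [1074037325], [4295770637], [4312285709], [1074041420], [4295770700], [4312285772],
   [4312547852], [2148041291], [2148303371], [2164818443], [2148045386], [2148303434],
   [2164818506], [2165080586], [1075085897], [2149343753], [4313334281], [2166120968],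
   [1091600969], [1091863049], [2198372873], [4346626568]]

theorem zero2113 : ZeroW [2, 1, 1, 3] :=
  zero_of_cert (m := 16) (L := cert2113) (by decide) (by decide) (by decide +kernel)

def cert2322 : List (List ℕ) :=
  [[1073746895], [1073754959], [1074017039], [1074541325], [1091318540], [1073763023],
   [1073771087], [1073771213], [1074021071], [1074545231], [1074545357], [1074033167],
   [1074549263], [4295782670], [1091322383], [1124876813], [1074033356], [1074549452],
   [1074557516], [1091322572], [1124876876], [1091334668], [1124880908], [1074553547],
   [1074557579], [2148299402], [1091584715], [1125139019], [1075081739], [1075081802],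
   [4296831242], [1091596811], [1125143051], [1125151241], [1092383240], [1125413384],
   [2148016847], [2148020879], [1074287183], [2181575183], [2148037259], [2181591563],
   [4296303239], [1075077707], [2181853706], [1108636169], [1074013007], [1074025103],
   [1074033293], [1091064335], [1074033230], [1091072525], [4329062735], [4295516621],
   [2148295307], [4329062861], [1091858954], [4329857543], [2181571277], [4295254478],
   [1091060303], [1074025166], [4312285646], [1074549389], [1074549326], [2181849611],
   [1091854859], [2164793999], [2148020942], [2164794062], [1091330573], [1091326478],
   [4329324941], [2182099595], [1108365899], [4329599306], [1074017102], [1090790222],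
   [4312547726], [1091322446], [2181587531], [2181591626], [1091588747], [1091596874],
   [2181575246], [1091072588], [1107841613], [4329066956], [2181575309], [1091064524],
   [1091056397], [2164798094], [1091064398], [1091064461], [1090802318],
   [1108628042, 2182631882, 1142182346, 2182373834, 1108627916],
   [4330119497, 8625086789, 4330119749],
   [1125143114, 2198888906, 1125142988, 1158701513, 2248696265],
   [2165072522, 1091326730, 2181845642, 1091326604],
   [1091330636, 2181849674, 1141658186, 1091854922, 4313342282], [1091326604], [1091330636],
   [4313342282], [1091854922], [2198364746], [4346634506], [1125409289]]

theorem zero2322 : ZeroW [2, 3, 2, 2] :=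
  zero_of_cert (m := 16) (L := cert2322) (by decide) (by decide) (by decide +kernel)

def cert1311 : List (List ℕ) :=
  [[1073746063], [1073746126], [1074012364], [1073746315], [1073746378], [1073754442],
   [1074012427], [1074016522], [1074012616], [1074016648], [1091055880], [2148016267],
   [2148016330], [1074274633], [2181570760], [1074012301], [1074012490], [1091051848],
   [4329054469], [1091051785], [2164793482]]

theorem zero1311 : ZeroW [1, 3, 1, 1] :=
  zero_of_cert (m := 16) (L := cert1311) (by decide) (by decide) (by decide +kernel)

def cert34222 : List (List ℕ) :=
  [[1194128401], [1128068113], [1194120211], [1193604115], [1160573971], [1127543827],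
   [1094513683], [1194116179], [1193342035], [1143796819], [1127281747], [1194112147],
   [1127019667], [1193592019], [1160561875], [1193333971], [1143788755], [1127273683],
   [1159787731], [1143272659], [1093727443], [1193587924], [1160557780], [1127011540],
   [1126495444], [1093465300], [1194112021], [1127019541], [1193325781], [1143780565],
   [1127007445], [1126233301], [1127003413], [1193587735], [1160557591], [1127011351],
   [1126495255], [1093465111], [1193325655], [1143780439], [1127007319], [1126233175],
   [1193317591], [1159771351], [1143256279], [1126483159], [1093453015], [1126225111],
   [1092678871], [1126479127], [1093448983], [1126217047], [1126208983], [1092662743],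
   [1193063512], [1125971032], [1193055448], [1159509208], [1125962968], [1125446872],
   [1092416728], [1125954904], [1124922712], [1125946840], [1125430744], [1092400600],
   [1124914648], [1091368408], [1193063449], [1125970969], [1193051353], [1142731993],
   [1125958873], [1125184729], [1125954841], [1124922649], [1125942745], [1125168601],
   [1124910553], [1125938713], [1193055259], [1159509019], [1125962779], [1125446683],
   [1092416539], [1193051227], [1142731867], [1125958747], [1125184603], [1125954715],
   [1124922523], [1159496923], [1142723803], [1142207707], [1125434587], [1092404443],
   [1125176539], [1091630299], [1125946651], [1125430555], [1092400411], [1124914459],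
   [1091368219], [1125942619], [1125168475], [1124910427], [1124906395], [1125418459],
   [1092388315], [1125160411], [1124902363], [1091614171], [1091356123], [1125414427],
   [1092384283], [1125152347], [1124890267], [1125144283], [1091598043], [1125946588],
   [1125430492], [1092400348], [1124914396], [1091368156], [1091352028], [1124882140],
   [1091335900], [1125954589], [1124922397], [1125942493], [1125168349], [1124910301],
   [1124906269], [1124894173], [1124890141], [1124878045], [1124874013], [1125946399],
   [1125430303], [1092400159], [1124914207], [1091367967], [1125942367], [1125168223],
   [1124910175], [1125418207], [1092388063], [1125160159], [1124902111], [1091613919],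
   [1091355871], [1091351839], [1124894047], [1091339743], [1124881951], [1091335711],
   [1124877919], [1091323615], [1091319583],
   [2168255569, 2167223377, 4315731025, 4315214929, 8609649745, 1111290961], [1094513746],
   [2164601947, 2164585567, 4312069213, 4312061023, 8607028315, 1107620959], [1091105887],
   [4329100255], [4312327135], [6476575711], [7533540319], [8624051167], [8607278047],
   [12919010143], [12902232991], [12919002079], [12902228959], [15066477535], [16123442143],
   [2164529119, 2164528867, 4312012765, 4312012639, 8606979805, 1107564511],
   [2334438481, 2267346001, 4514427985, 4414821457, 4447335505, 8742286417, 1193604241],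
   [1193604178], [4397528146], [4380750994], [6494680210], [7568421970], [8710038607],
   [8709776527], [4349027407], [4348765327],
   [2168779855, 2166682711, 4316263501, 4314166357, 8609150029, 8609141839, 1109718103],
   [1093203031], [1092940951], [4330157143], [4329895063], [4313379991], [6476854423],
   [7550596183], [7533819031], [8625890263], [8609375191], [8625099739], [8624841691],
   [8608326619], [8624317405], [8624313310], [8607540190], [12919792603], [12903277531],
   [12919268317], [12919264222], [12902491102], [15066739678], [16123704286], [4329366493],
   [4329362398], [4312589278], [8624321437], [8624321374], [8607544222], [12919272349],
   [12919272286], [12902495134], [15066755806], [16140497629], [16123720414], [2181854875],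
   [3255596635], [3238819483], [4330382557], [4330378462], [4313605342], [8625369757],
   [8625369694], [8608592542], [2182919323], [2182915291], [3256661083], [3239883931],
   [3256653019], [3239879899], [4330415191], [4330411159], [4313638039], [4330124635],
   [4329862555], [4313347483], [6477608155], [6476821915], [7551087835], [7534572763],
   [7550563675], [7533786523], [4330149079], [4329891031], [4313375959], [4329366997],
   [4329362902], [4312589782], [6478656727], [6476838358], [7552136407], [7535621335],
   [7550580181], [7533802966], [8625350101], [8625346006], [8608572886], [8625386137],
   [8625124057], [8624337817], [8625386074], [8608608922], [8624861914], [8608346842],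
   [8624337754], [8607560602], [12920353870], [12920353933], [12903576718], [12920091853],
   [12919829710], [12903314638], [15067837579], [16141579339], [16124802187], [4331987923],
   [4315472851],
   [2166133855, 2166166615, 4313093215, 4313125975, 8608060507, 8608584793, 1109169247],
   [1092396127], [1092392095], [4330124383], [4329862303], [4313347231], [6476837791],
   [7550579551], [7533802399], [8625099487], [8624841439], [8608326367], [8624317279],
   [8624313247], [8607540127], [12919268191], [12919264159], [12902491039],
   [2164585945, 2164569817, 4312061401, 4312069717, 4312053589, 8607020629, 1107621337],
   [1091106265], [4329108823], [4312331671], [6476592343], [7533556951], [8624067547],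
   [8607294427], [8624059357], [8607282142], [12919010269], [12902233054],
   [2198639713, 2199165007, 2232194143, 4346123359, 4346124367, 17231025235, 17264579665, 1125684319],
   [1125426271], [1125422239],
   [2202301525, 2200245331, 2233791571, 4349785171, 4347720787, 8642671699, 8676217939, 1126757461],
   [1126495381], [1126495318], [2200499347], [3274241107], [3273979027], [4346934421],
   [4346934358], [4346672278], [8693265487], [8642946127], [8693003407], [8676488335],
   [8642942095], [8642684047], [8692999375], [8676484303], [8642929999], [8642667919],
   [8641881049], [8641876954], [8641618906], [12987442255], [12987184207], [12936864847],
   [12987438223], [12970665103], [12970407055], [12936860815], [12936602767], [12987176143],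
   [12970403023], [12936848719], [12936844687], [12936586639], [12936832591], [12936570511],
   [15084594319], [15084336271], [15083562127], [15084332239], [15083545999], [15083529871],
   [16158336079], [16158078031], [16157303887], [16158332047], [16157815951], [16157299855],
   [16158069967], [16157811919], [16157287759], [16157283727], [16157271631], [16157267599],
   [2334430291, 2301400147, 2266797145, 4515451987, 4449391699, 4447835221, 4414805077, 8743310419, 1193055385],
   [1193059417], [1193055385],
   [2167182931, 2166666835, 2166126169, 4315190611, 4314158419, 4314134101, 4313618005, 8609109331, 1092384409],
   [1092384346],
   [2233250905, 2233250401, 4348212313, 4348211809, 4346664025, 4346663521, 8642131033, 8642130529, 8641647193, 1125962905],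
   [1125966937], [1125962905], [2199696538], [3273438361], [3273438298], [4347192469],
   [4347192406], [4347188374], [6495724687], [6494663830], [7569466447], [7569462415],
   [7568405653], [7568405590], [8692474585], [8642143129], [8692470490], [8675697370],
   [8642143066], [8642139034], [12937885006], [12937622422], [12987167449], [12970390234],
   [4414039123], [4414035091], [4413777043], [4414026901], [4414026838], [4413764758],
   [8710317130], [8710312594], [8710038733], [8709776590], [8642945749], [8642941654],
   [8642683606], [12988216525], [12987954382], [12971439310], [15135699667], [17282949835],
   [17266434763], [4346930389], [4346926294], [4346668246], [6494401750], [6493627606],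
   [7568143573], [7567369429], [7567881430], [7567365334], [8641869142], [8641607062],
   [2166141793, 2166666457, 2166150361, 4314657505, 4314658009, 4313109217, 4313109721, 8608576225, 8608576729, 8608092889, 1109177689],
   [1092400537], [1092400474], [2182919386], [3256661209], [3239883994], [4330415317],
   [4330411222], [4313638102], [4330403158], [4313626006]]

theorem ok34222 : certOk [3, 4, 2, 2, 2, 0] 64 cert34222 allPos = true := by decide +kernel

/-! ### The weight (3,4,4,3,1) -/

def cert34431 : List (List ℕ) :=
  [[1091630047], [1125176287], [1125184477], [1092404191], [1125434335], [1125958495],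
   [1125958621], [1092416476], [1125446620], [1125962716], [1125692383], [1125950431],
   [2199430111], [1125954463], [2199692191], [1125954526], [2199692254], [1159238623],
   [1159496671], [1159500703], [2266784671], [1159500766], [2266784734], [1159504735],
   [1159508767], [1193055007], [1193063197], [1159504861], [1159508956], [1193055196],
   [1193063260], [1125708763], [1125966811], [1125970906], [2199450586], [2199708634],
   [1159513051], [1193063323], [1159517146], [1193063386], [2266805146], [1159263193],
   [1159521241], [1193071513], [1159525336], [1193071576], [1093727191], [1127273431],
   [1127281621], [1094513620], [1127543764], [1126757335], [1127015383], [2200495063],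
   [1127019478], [2200499158], [1159787479], [1160045527], [2266555351], [1160049622],
   [2266559446], [1160303575], [1160561623], [1193591767], [1194115927], [1194116053],
   [1160311765], [1160573908], [1193604052], [1194120148], [1127805907], [1128068050],
   [2201547730], [1160836051], [1194124243], [1161098194], [1194128338], [2267866066],
   [1161360337], [1194648529], [1161622480], [1194652624], [2181882847], [2181886942],
   [1108661215], [2182919071], [2182919134], [1108669405], [1109185501], [4380455839],
   [4380455902], [1159246687], [2266800862], [1159246813], [1193059165], [4380484567],
   [1159255003], [2183979991], [2183984086], [1110766549], [2267591575], [2267591638],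
   [1193858005], [1091888095], [1092408223], [1091892190], [1092408286], [2199434143],
   [2199434206], [1125700573], [1193055070], [1093985239], [1093989334], [1193595799],
   [1193595862], [4397519830], [4397523925], [2251088851], [1125438367], [1125438430],
   [4380746710], [8693535631], [1161094099], [4397519767], [2200757206], [1127539669],
   [1160565655], [2250027931], [1159517083], [2200757143], [2199708571], [1159508893],
   [1159508830], [2199696286]]

def tau34431 : List (List ℕ) :=
  [[4667789767], [2520298183], [1446302407],
   [8826708811, 8711103307, 4665959239, 2519524039, 1446302407, 4418233159, 2337858247, 1297666759, 1194681163, 2267898763, 4414333837, 2333959051, 1293771595, 1194648907, 2267866507, 4414301581, 2333926795, 1293739339, 1194648403, 2267866003, 4414301077, 2333926291, 1293738835]]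

def ext34431 : List (List ℕ) :=
  [[1194120085], [2267866003]]

def b0L : List ℕ := [7, 11, 13, 14, 22]

def tauC : List (List ℕ) := [[11, 7, 13, 14, 22], [7, 13, 11, 14, 22], [7, 11, 14, 13, 22],
  [7, 11, 13, 22, 14]]

def tauChk (K : Tr) (rs : List ℕ) (c : List ℕ) : Bool :=
  match stepOut [3, 4, 4, 3, 1] 32 K rs with
  | [x, y] => ((eqL x b0L && eqL y c) || (eqL x c && eqL y b0L)) && allB (relOk 32 b0L) rs
  | _ => false

def tausChk (K : Tr) : List (List ℕ) → List (List ℕ) → Bool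
  | rs :: R, c :: C => tauChk K rs c && tausChk K R C
  | [], [] => true
  | _, _ => false

def chk34431 : Bool :=
  match runK [3, 4, 4, 3, 1] 32 cert34431 .nil with
  | some K => tausChk K tau34431 tauC &&
      match runK [3, 4, 4, 3, 1] 32 ext34431 (K.ins (keyL b0L)) with
      | some K' => allLL (fun l => !allPos l || K'.mem (pack l)) (genL [3, 4, 4, 3, 1])
      | none => false
  | none => false

theorem chk34431_ok : chk34431 = true := by decide +kernel

theorem tauChk_sound {K : Tr} (hK : K.All (Good [3, 4, 4, 3, 1] (Kam [3, 4, 4, 3, 1])))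
    {rs c : List ℕ} (h : tauChk K rs c = true) {μ : Vn 5 → ZMod 2}
    (hμ : Kam [3, 4, 4, 3, 1] Finset.univ 67 μ) (h0 : μ (ve b0L) = 0) : μ (ve c) = 0 := by
  unfold tauChk at h
  split at h
  · rename_i x y hxy
    rw [Bool.and_eq_true] at h
    have hs := stepOut_sum (fun _ _ _ h => h) hK (rs := rs) (x := b0L) rfl (allB_spec h.2) hμ
      (y := fun _ => 0) (by rw [sz_ve (l := b0L) rfl]; simp [sumL, b0L, sz])
      (by intro i _; fin_cases i <;> simp [ve, b0L])
    simp only [mul_zero, add_zero] at hs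
    have e : (2 : ℕ) ^ ([3, 4, 4, 3, 1] : List ℕ).length = 32 := by norm_num
    rw [e, hxy] at hs
    simp only [List.map_cons, List.map_nil, List.sum_cons, List.sum_nil, add_zero] at hs
    simp only [Bool.or_eq_true, Bool.and_eq_true] at h
    rcases h.1 with ⟨h1, h2⟩ | ⟨h1, h2⟩
    · rw [eqL_eq _ _ h1, eqL_eq _ _ h2] at hs
      have hs' : μ (ve b0L) + μ (ve c) = 0 := hs
      rwa [h0, zero_add] at hs'
    · rw [eqL_eq _ _ h1, eqL_eq _ _ h2] at hs
      have hs' : μ (ve c) + μ (ve b0L) = 0 := hs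
      rwa [h0, add_zero] at hs'
  · simp at h

theorem Tr.All.mono {p q : ℕ → Prop} (hpq : ∀ k, p k → q k) {t : Tr} (h : t.All p) : t.All q := by
  induction t with
  | nil => trivial
  | node l a r ihl ihr => exact ⟨ihl h.1, hpq _ h.2.1, ihr h.2.2⟩

theorem Kam.compU {Ω : List ℕ} {D μ} (h : Kam Ω Finset.univ D μ) (σ : Equiv.Perm (Fin 5)) :
    Kam Ω Finset.univ D (fun v => μ (v ∘ σ)) := by
  have := h.comp σ
  simpa using this

theorem tau_all {K : Tr} (hK : K.All (Good [3, 4, 4, 3, 1] (Kam [3, 4, 4, 3, 1])))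
    (h : tausChk K tau34431 tauC = true) {μ : Vn 5 → ZMod 2}
    (hμ : Kam [3, 4, 4, 3, 1] Finset.univ 67 μ) (h0 : μ (ve b0L) = 0) (σ : Equiv.Perm (Fin 5)) :
    μ (ve b0L ∘ σ) = 0 := by
  simp only [tau34431, tauC, tausChk, Bool.and_eq_true, and_true] at h
  obtain ⟨h1, h2, h3, h4⟩ := h
  have key : ∀ i : Fin 4, ∀ ν : Vn 5 → ZMod 2, Kam [3, 4, 4, 3, 1] Finset.univ 67 ν →
      ν (ve b0L) = 0 → ν (ve b0L ∘ (Equiv.swap i.castSucc i.succ)) = 0 := by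
    intro i ν hν hν0
    fin_cases i
    · convert tauChk_sound hK h1 hν hν0 using 2
      funext k; fin_cases k <;> rfl
    · convert tauChk_sound hK h2 hν hν0 using 2
      funext k; fin_cases k <;> rfl
    · convert tauChk_sound hK h3 hν hν0 using 2
      funext k; fin_cases k <;> rfl
    · convert tauChk_sound hK h4 hν hν0 using 2
      funext k; fin_cases k <;> rfl
  have hmem : σ ∈ Submonoid.closure
      (Set.range fun i : Fin 4 => Equiv.swap i.castSucc i.succ) := by
    rw [Equiv.Perm.mclosure_swap_castSucc_succ]; trivial
  induction hmem using Submonoid.closure_induction_left with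
  | one => exact h0
  | mul_left x hx y _ ih =>
    obtain ⟨i, rfl⟩ := hx
    exact key i (fun v => μ (v ∘ y)) (hμ.compU y) ih

def C34431 : Cls := fun Z D μ => Z = Finset.univ ∧ D = 67 ∧ Kam [3, 4, 4, 3, 1] Finset.univ 67 μ ∧
  ∀ σ : Equiv.Perm (Fin 5), μ (ve b0L ∘ σ) = 0

theorem case34431 {μ : Vn 5 → ZMod 2} (hμ : Kam [3, 4, 4, 3, 1] Finset.univ 67 μ)
    (h0 : μ (ve b0L) = 0) {v : Vn 5} (hs : sz v = 67) (hp : ∀ i, 0 < v i)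
    (hv : has [3, 4, 4, 3, 1] v) : μ v = 0 := by
  have h := chk34431_ok
  unfold chk34431 at h
  split at h
  · rename_i K hK
    have hK1 := runK_sound (Ω := [3, 4, 4, 3, 1]) (by decide) (fun _ _ _ h => h) (permInv_Kam _)
      cert34431 (K := .nil) trivial hK
    rw [Bool.and_eq_true] at h
    obtain ⟨h1, h2⟩ := h
    have hC : ∀ Z D ν, C34431 Z D ν → Kam [3, 4, 4, 3, 1] Z D ν := by
      rintro Z D ν ⟨rfl, rfl, h, -⟩; exact h
    have hPI : PermInv C34431 := by
      rintro σ Z D ν ⟨rfl, rfl, h, h'⟩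
      refine ⟨by simp, rfl, h.compU σ, fun ρ => ?_⟩
      exact h' (ρ * σ)
    split at h2
    · rename_i K' hK'
      have hK2 := runK_sound (Ω := [3, 4, 4, 3, 1]) (by decide) hC hPI
        ext34431 (K := K.ins (keyL b0L)) ?_ hK'
      · exact final_cert hK2 h2 (Z := Finset.univ) (D := 67) (μ := μ)
          ⟨rfl, rfl, hμ, tau_all hK1 h1 hμ h0⟩ hs (fun i _ => hp i) hv
          (allPos_v hv (by rw [hs]; rfl) hp)
      · apply Tr.All.ins
        · exact hK1.mono fun k hk Z D ν hν => hk Z D ν (hC _ _ _ hν)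
        · rintro Z D ν ⟨rfl, rfl, h, h'⟩ w hw hwp hwh hwk
          have hlt := lt_of_has hwh (by rw [hw]; rfl)
          have hlt' : ∀ i, w i < 64 := fun i => lt_trans (hlt i) (by norm_num)
          have e : (fun i => w i % 2 ^ ([3, 4, 4, 3, 1] : List ℕ).length) = w := by
            funext i; exact Nat.mod_eq_of_lt (hlt i)
          rw [e] at hwk
          have e2 : keyL b0L = keyV (ve b0L) := rfl
          rw [e2] at hwk
          obtain ⟨σ, rfl⟩ := keyV_eq hlt' (by intro i; fin_cases i <;> simp [ve, b0L]) hwk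
          exact h' σ
    · simp at h2
  · simp at h

/-! ### The weight (3,2,1,1,1,1) -/

/-- Unit vector. -/
def E (a : Fin 5) : Vn 5 := fun i => if i = a then 1 else 0

theorem sz_E (a : Fin 5) : sz (E a) = 1 := by simp [sz, E]

theorem Bset_one (f : Vn 5) (g : Vn 5 → ZMod 2) :
    ∑ b ∈ Bset f 1, g b = ∑ c ∈ Finset.univ.filter (fun c => f c % 2 = 1), g (E c) := by
  symm
  apply Finset.sum_bij (fun c _ => E c)
  · intro c hc
    rw [Finset.mem_filter] at hc
    rw [mem_Bset]
    refine ⟨fun i => ?_, sz_E c⟩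
    unfold E
    split
    · rename_i h; rw [h, Nat.one_and_eq_mod_two, hc.2]
    · simp
  · intro a _ b _ h
    have := congrFun h a
    by_contra hne
    simp [E, hne] at this
  · intro b hb
    rw [mem_Bset] at hb
    have hb2 := hb.2
    unfold sz at hb2
    have hex : ∃ c, b c ≠ 0 := by
      by_contra hno
      push Not at hno
      simp [hno] at hb2
    obtain ⟨c, hc⟩ := hex
    have hsplit := Finset.add_sum_erase Finset.univ b (Finset.mem_univ c)
    have hbc : b c = 1 := by omega
    have hrest : ∑ i ∈ Finset.univ.erase c, b i = 0 := by omega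
    refine ⟨c, ?_, ?_⟩
    · have := hb.1 c
      rw [hbc, Nat.one_and_eq_mod_two] at this
      simp [this]
    · funext i
      unfold E
      split
      · rename_i h; rw [h, hbc]
      · rename_i h
        exact ((Finset.sum_eq_zero_iff.1 hrest) i (by simp [h])).symm
  · intro c _; rfl

theorem two_sum {a b : Fin 5} (hab : a ≠ b) {f : Vn 5} (hf : ∀ i, f i % 2 = 1 ↔ i = a ∨ i = b)
    (g : Vn 5 → ZMod 2) : ∑ c ∈ Bset f 1, g c = g (E a) + g (E b) := by
  rw [Bset_one]
  have : Finset.univ.filter (fun c => f c % 2 = 1) = {a, b} := by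
    ext i; simp [hf]
  rw [this, Finset.sum_pair hab]

theorem eq_of_add {a b : ZMod 2} (h : a + b = 0) : a = b := by
  have := congrArg (· + b) h
  simpa [add_assoc, zm2] using this

theorem swapK {Ω : List ℕ} {Z D μ} (h : Kam Ω Z D μ) (a b : Fin 5) (y : Vn 5)
    (hs : 3 + 4 * sz y = D) (hp : ∀ i ∈ Z, i = a ∨ i = b ∨ 0 < y i) :
    μ (fun i => E a i + 2 * (E b i + 2 * y i)) = μ (fun i => E b i + 2 * (E a i + 2 * y i)) := by
  by_cases hab : a = b
  · rw [hab]
  · have hr := h.rel (fun i => E a i + E b i + 4 * y i) 1 one_pos ?_ ?_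
    · rw [two_sum hab (fun i => ?_)] at hr
      · have := eq_of_add hr
        convert this.symm using 2 <;> · funext i; simp only [Pi.add_apply]; ring
      · show (E a i + E b i + 4 * y i) % 2 = 1 ↔ _
        unfold E
        by_cases h1 : i = a
        · subst h1; simp [hab]; omega
        · by_cases h2 : i = b
          · subst h2; simp [h1]; omega
          · simp [h1, h2]; omega
    · rw [← hs]
      have h1 := sz_E a
      have h2 := sz_E b
      unfold sz at h1 h2 ⊢
      rw [Finset.sum_add_distrib, Finset.sum_add_distrib, ← Finset.mul_sum]
      omega
    · intro i hi
      unfold E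
      rcases hp i hi with h | h | h
      · simp [h]
      · simp [h]
      · omega

theorem cubeK {Ω : List ℕ} {Z D μ} (h : Kam Ω Z D μ) (a b : Fin 5) (y : Vn 5)
    (hs : 7 + 8 * sz y = D) (hp : ∀ i ∈ Z, i = a ∨ i = b ∨ 0 < y i) :
    μ (fun i => E a i + 2 * (E a i + 2 * (E b i + 2 * y i))) =
      μ (fun i => E b i + 2 * (E b i + 2 * (E a i + 2 * y i))) := by
  by_cases hab : a = b
  · rw [hab]
  · have hr := h.rel (fun i => 3 * E a i + 3 * E b i + 8 * y i) 1 one_pos ?_ ?_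
    · rw [two_sum hab (fun i => ?_)] at hr
      · have := eq_of_add hr
        convert this.symm using 2 <;> · funext i; simp only [Pi.add_apply]; ring
      · show (3 * E a i + 3 * E b i + 8 * y i) % 2 = 1 ↔ _
        unfold E
        by_cases h1 : i = a
        · subst h1; simp [hab]; omega
        · by_cases h2 : i = b
          · subst h2; simp [h1]; omega
          · simp [h1, h2]; omega
    · rw [← hs]
      have h1 := sz_E a
      have h2 := sz_E b
      unfold sz at h1 h2 ⊢
      rw [Finset.sum_add_distrib, Finset.sum_add_distrib, ← Finset.mul_sum, ← Finset.mul_sum,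
        ← Finset.mul_sum]
      omega
    · intro i hi
      unfold E
      rcases hp i hi with h | h | h
      · simp [h]
      · simp [h]
      · omega

abbrev T4 := Fin 5 × Fin 5 × Fin 5 × Fin 5

def W4 (t : T4) : Vn 5 := fun i => E t.1 i + 2 * (E t.2.1 i + 2 * (E t.2.2.1 i + 2 * E t.2.2.2 i))

def nstep : T4 → T4
  | (a, b, c, d) =>
    if b < a then (b, a, c, d) else if c < b then (a, c, b, d) else if d < c then (a, b, d, c)
    else if b = c ∧ a ≠ b then (a, a, b, d) else if c = d ∧ a ≠ c then (a, a, c, b)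
    else (a, b, c, d)

def nmask (t : T4) : List Bool :=
  (List.finRange 5).map fun i => decide (i = t.1 ∨ i = t.2.1 ∨ i = t.2.2.1 ∨ i = t.2.2.2)

def nform (l : List Bool) : T4 :=
  match (List.finRange 5).filter fun i : Fin 5 => l.getD i.val false with
  | [a] => (a, a, a, a)
  | [a, b] => (a, a, a, b)
  | [a, b, c] => (a, a, b, c)
  | [a, b, c, d] => (a, b, c, d)
  | _ => (0, 0, 0, 0)

def niter : ℕ → T4 → T4
  | 0, t => t
  | k + 1, t => niter k (nstep t)

theorem nform_ok : ∀ a b c d : Fin 5, niter 16 (a, b, c, d) = nform (nmask (a, b, c, d)) := by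
  decide +kernel

def Om6 : List ℕ := [3, 2, 1, 1, 1, 1]

def Cov (x : Vn 5) (t : T4) : Prop :=
  ∀ i, x i = 0 → i = t.1 ∨ i = t.2.1 ∨ i = t.2.2.1 ∨ i = t.2.2.2

theorem Eodds (a : Fin 5) (y : Vn 5) : odds (fun i => E a i + 2 * y i) = 1 ∧
    half (fun i => E a i + 2 * y i) = y := by
  constructor
  · have : odds (fun i => E a i + 2 * y i) = sz (E a) := by
      unfold odds sz
      apply Finset.sum_congr rfl
      intro i _
      show (E a i + 2 * y i) % 2 = E a i
      unfold E; split <;> omega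
    rw [this, sz_E]
  · funext i
    show (E a i + 2 * y i) / 2 = y i
    unfold E; split <;> omega

theorem E_le (a i : Fin 5) : E a i ≤ 1 := by unfold E; split <;> omega

theorem E_pos {a i : Fin 5} (h : i = a) : 0 < E a i := by unfold E; simp [h]

theorem sz_add2 (a : Fin 5) (y : Vn 5) : sz (fun i => E a i + 2 * y i) = 1 + 2 * sz y := by
  have := sz_E a
  unfold sz at this ⊢
  rw [Finset.sum_add_distrib, ← Finset.mul_sum, this]

theorem has_next {Ω : List ℕ} {x : Vn 5} (hx : has Ω x) (hlt : ∀ i, x i < 2 ^ Ω.length)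
    (a : Fin 5) : has (Ω ++ [1]) (fun i => x i + 2 ^ Ω.length * E a i) := by
  rw [has_append, has_shift]
  refine ⟨hx, ?_, trivial⟩
  have : (fun i => (x i + 2 ^ Ω.length * E a i) / 2 ^ Ω.length) = fun i => E a i + 2 * 0 := by
    funext i
    rw [Nat.add_mul_div_left _ _ (by positivity), Nat.div_eq_of_lt (hlt i), zero_add]; rfl
  rw [this]
  exact (Eodds a (fun _ => 0)).1

theorem nswap01 {μ : Vn 5 → ZMod 2} (h : Kam Om6 Finset.univ 67 μ) {x : Vn 5} (hx : has [3, 2] x)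
    (hlt : ∀ i, x i < 4) (hsx : sz x = 7) {a b c d : Fin 5} (hc : Cov x (a, b, c, d)) :
    μ (fun i => x i + 4 * W4 (a, b, c, d) i) = μ (fun i => x i + 4 * W4 (b, a, c, d) i) := by
  have hK := Kam.shift (Ω1 := [3, 2]) (Ω2 := [1, 1, 1, 1]) (D := 15) h hx hlt (by rw [hsx]; rfl)
  have := swapK hK a b (fun i => E c i + 2 * E d i) (by rw [sz_add2, sz_E]) (by
    intro i hi
    rw [Finset.mem_filter] at hi
    rcases hc i hi.2 with h | h | h | h
    · exact Or.inl h
    · exact Or.inr (Or.inl h)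
    · have := E_pos h; right; right; show 0 < E c i + 2 * E d i; simp only at this; omega
    · have := E_pos h; right; right; show 0 < E c i + 2 * E d i; simp only at this; omega)
  exact this

theorem ncube {μ : Vn 5 → ZMod 2} (h : Kam Om6 Finset.univ 67 μ) {x : Vn 5} (hx : has [3, 2] x)
    (hlt : ∀ i, x i < 4) (hsx : sz x = 7) {a b d : Fin 5} (hc : Cov x (a, a, b, d)) :
    μ (fun i => x i + 4 * W4 (a, a, b, d) i) = μ (fun i => x i + 4 * W4 (b, b, a, d) i) := by
  have hK := Kam.shift (Ω1 := [3, 2]) (Ω2 := [1, 1, 1, 1]) (D := 15) h hx hlt (by rw [hsx]; rfl)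
  have := cubeK hK a b (fun i => E d i) (by rw [sz_E]) (by
    intro i hi
    rw [Finset.mem_filter] at hi
    rcases hc i hi.2 with h | h | h | h
    · exact Or.inl h
    · exact Or.inl h
    · exact Or.inr (Or.inl h)
    · exact Or.inr (Or.inr (E_pos h)))
  exact this

theorem nswap12 {μ : Vn 5 → ZMod 2} (h : Kam Om6 Finset.univ 67 μ) {x : Vn 5} (hx : has [3, 2] x)
    (hlt : ∀ i, x i < 4) (hsx : sz x = 7) {a b c d : Fin 5} (hc : Cov x (a, b, c, d)) :
    μ (fun i => x i + 4 * W4 (a, b, c, d) i) = μ (fun i => x i + 4 * W4 (a, c, b, d) i) := by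
  have h1 := has_next hx hlt a
  have hK := Kam.shift (Ω1 := [3, 2, 1]) (Ω2 := [1, 1, 1]) (D := 7) h h1
    (by intro i; have := hlt i; have := E_le a i; show x i + 4 * E a i < 8; omega)
    (by rw [sz_shift, hsx, sz_E]; rfl)
  have := swapK hK b c (fun i => E d i) (by rw [sz_E]) (by
    intro i hi
    rw [Finset.mem_filter] at hi
    have hi2 : x i + 4 * E a i = 0 := hi.2
    rcases hc i (by omega) with h | h | h | h
    · have := E_pos h; simp only at this; omega
    · exact Or.inl h
    · exact Or.inr (Or.inl h)
    · exact Or.inr (Or.inr (E_pos h)))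
  convert this using 2
  · funext i
    show x i + 4 * (E a i + 2 * (E b i + 2 * (E c i + 2 * E d i))) =
      x i + 4 * E a i + 8 * (E b i + 2 * (E c i + 2 * E d i))
    ring
  · funext i
    show x i + 4 * (E a i + 2 * (E c i + 2 * (E b i + 2 * E d i))) =
      x i + 4 * E a i + 8 * (E c i + 2 * (E b i + 2 * E d i))
    ring

theorem nswap23 {μ : Vn 5 → ZMod 2} (h : Kam Om6 Finset.univ 67 μ) {x : Vn 5} (hx : has [3, 2] x)
    (hlt : ∀ i, x i < 4) (hsx : sz x = 7) {a b c d : Fin 5} (hc : Cov x (a, b, c, d)) :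
    μ (fun i => x i + 4 * W4 (a, b, c, d) i) = μ (fun i => x i + 4 * W4 (a, b, d, c) i) := by
  have h1 := has_next hx hlt a
  have hlt1 : ∀ i, x i + 2 ^ ([3, 2] : List ℕ).length * E a i < 8 := by
    intro i; have := hlt i; have := E_le a i; show x i + 4 * E a i < 8; omega
  have h2 := has_next h1 hlt1 b
  have hK := Kam.shift (Ω1 := [3, 2, 1, 1]) (Ω2 := [1, 1]) (D := 3) h h2
    (by intro i; have := hlt1 i; have := E_le b i
        show x i + 2 ^ ([3, 2] : List ℕ).length * E a i + 8 * E b i < 16; omega)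
    (by rw [sz_shift, sz_shift, hsx, sz_E, sz_E]; rfl)
  have := swapK hK c d (fun i => 0) (by simp [sz]) (by
    intro i hi
    rw [Finset.mem_filter] at hi
    have hi2 : x i + 4 * E a i + 8 * E b i = 0 := hi.2
    rcases hc i (by omega) with h | h | h | h
    · have := E_pos h; simp only at this; omega
    · have := E_pos h; simp only at this; omega
    · exact Or.inl h
    · exact Or.inr (Or.inl h))
  convert this using 2
  · funext i
    show x i + 4 * (E a i + 2 * (E b i + 2 * (E c i + 2 * E d i))) =
      x i + 4 * E a i + 8 * E b i + 16 * (E c i + 2 * (E d i + 2 * 0))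
    ring
  · funext i
    show x i + 4 * (E a i + 2 * (E b i + 2 * (E d i + 2 * E c i))) =
      x i + 4 * E a i + 8 * E b i + 16 * (E d i + 2 * (E c i + 2 * 0))
    ring

theorem nstep_spec {μ : Vn 5 → ZMod 2} (h : Kam Om6 Finset.univ 67 μ) {x : Vn 5}
    (hx : has [3, 2] x) (hlt : ∀ i, x i < 4) (hsx : sz x = 7) (t : T4) (hc : Cov x t) :
    Cov x (nstep t) ∧
    μ (fun i => x i + 4 * W4 t i) = μ (fun i => x i + 4 * W4 (nstep t) i) := by
  obtain ⟨a, b, c, d⟩ := t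
  unfold nstep
  have s1 : ∀ {a b c d}, Cov x (a, b, c, d) → Cov x (b, a, c, d) := by
    intro a b c d h i hi; have := h i hi; simp only at this ⊢; tauto
  have s2 : ∀ {a b c d}, Cov x (a, b, c, d) → Cov x (a, c, b, d) := by
    intro a b c d h i hi; have := h i hi; simp only at this ⊢; tauto
  have s3 : ∀ {a b c d}, Cov x (a, b, c, d) → Cov x (a, b, d, c) := by
    intro a b c d h i hi; have := h i hi; simp only at this ⊢; tauto
  have s4 : ∀ {a b d}, Cov x (a, b, b, d) → Cov x (a, a, b, d) := by
    intro a b d h i hi; have := h i hi; simp only at this ⊢; tauto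
  have c4 : ∀ {a b d}, Cov x (a, b, b, d) →
      μ (fun i => x i + 4 * W4 (a, b, b, d) i) = μ (fun i => x i + 4 * W4 (a, a, b, d) i) := by
    intro a b d hc
    rw [nswap01 h hx hlt hsx hc, nswap12 h hx hlt hsx (s1 hc), ncube h hx hlt hsx (s2 (s1 hc))]
  simp only
  split_ifs with g1 g2 g3 g4 g5
  · exact ⟨s1 hc, nswap01 h hx hlt hsx hc⟩
  · exact ⟨s2 hc, nswap12 h hx hlt hsx hc⟩
  · exact ⟨s3 hc, nswap23 h hx hlt hsx hc⟩
  · obtain ⟨rfl, _⟩ := g4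
    exact ⟨s4 hc, c4 hc⟩
  · obtain ⟨rfl, _⟩ := g5
    refine ⟨s4 (s3 (s2 hc)), ?_⟩
    rw [nswap12 h hx hlt hsx hc, nswap23 h hx hlt hsx (s2 hc), c4 (s3 (s2 hc))]
  · exact ⟨hc, rfl⟩

theorem niter_spec {μ : Vn 5 → ZMod 2} (h : Kam Om6 Finset.univ 67 μ) {x : Vn 5}
    (hx : has [3, 2] x) (hlt : ∀ i, x i < 4) (hsx : sz x = 7) : ∀ (k : ℕ) (t : T4), Cov x t →
    μ (fun i => x i + 4 * W4 t i) = μ (fun i => x i + 4 * W4 (niter k t) i) := by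
  intro k
  induction k with
  | zero => intro t _; rfl
  | succ k ih =>
    intro t ht
    have := nstep_spec h hx hlt hsx t ht
    rw [this.2, ih _ this.1, niter]

theorem exists_E {w : Vn 5} (h : odds w = 1) : ∃ a, w = fun i => E a i + 2 * half w i := by
  have hex : ∃ c, w c % 2 ≠ 0 := by
    by_contra hno
    push Not at hno
    simp [odds, hno] at h
  obtain ⟨c, hc⟩ := hex
  have hsplit := Finset.add_sum_erase Finset.univ (fun i => w i % 2) (Finset.mem_univ c)
  unfold odds at h
  have hrest : ∑ i ∈ Finset.univ.erase c, w i % 2 = 0 := by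
    omega
  refine ⟨c, ?_⟩
  funext i
  unfold E half
  split
  · rename_i h; subst h; omega
  · rename_i h
    have := (Finset.sum_eq_zero_iff.1 hrest) i (by simp [h])
    omega

theorem decomp {v : Vn 5} (hv : has Om6 v) (hs : sz v = 67) : ∃ t : T4,
    v = fun i => v i % 4 + 4 * W4 t i := by
  have h1 : has [1, 1, 1, 1] (fun i => v i / 4) :=
    ((has_append [3, 2] [1, 1, 1, 1] v).1 hv).2
  obtain ⟨a, ha⟩ := exists_E h1.1
  obtain ⟨b, hb⟩ := exists_E h1.2.1
  obtain ⟨c, hc⟩ := exists_E h1.2.2.1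
  obtain ⟨d, hd⟩ := exists_E h1.2.2.2.1
  have hlt := lt_of_has hv (by rw [hs]; rfl)
  refine ⟨(a, b, c, d), ?_⟩
  funext i
  have e1 := congrFun ha i
  have e2 := congrFun hb i
  have e3 := congrFun hc i
  have e4 := congrFun hd i
  have hl : v i < 64 := hlt i
  simp only [half] at e1 e2 e3 e4
  show v i = v i % 4 + 4 * (E a i + 2 * (E b i + 2 * (E c i + 2 * E d i)))
  omega

/-- value depends only on `v mod 4` and the support of `v / 4` -/
theorem tail_indep {μ : Vn 5 → ZMod 2} (h : Kam Om6 Finset.univ 67 μ) {v v' : Vn 5}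
    (hv : has Om6 v) (hs : sz v = 67) (hp : ∀ i, 0 < v i)
    (hv' : has Om6 v') (hs' : sz v' = 67)
    (h4 : ∀ i, v i % 4 = v' i % 4) (hsup : ∀ i, 0 < v i / 4 ↔ 0 < v' i / 4) : μ v = μ v' := by
  obtain ⟨t, ht⟩ := decomp hv hs
  obtain ⟨t', ht'⟩ := decomp hv' hs'
  have hW : ∀ (t : T4) (i : Fin 5), 0 < W4 t i ↔
      (i = t.1 ∨ i = t.2.1 ∨ i = t.2.2.1 ∨ i = t.2.2.2) := by
    intro t i
    have e : ∀ a, 0 < E a i ↔ i = a := by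
      intro a; unfold E; split
      · rename_i h; simp [h]
      · rename_i h; simp [h]
    rw [← e, ← e, ← e, ← e]
    show 0 < E t.1 i + 2 * (E t.2.1 i + 2 * (E t.2.2.1 i + 2 * E t.2.2.2 i)) ↔ _
    omega
  have d1 : ∀ i, v i / 4 = W4 t i := by
    intro i; have := congrFun ht i; omega
  have d2 : ∀ i, v' i / 4 = W4 t' i := by
    intro i; have := congrFun ht' i; omega
  have hx : has [3, 2] (fun i => v i % 4) := by
    have := ((has_append [3, 2] [1, 1, 1, 1] v).1 hv).1
    rw [← split_mod v 2] at this
    exact (has_shift [3, 2] (fun i => v i % 4) (fun i => v i / 4)).1 this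
  have hsx : sz (fun i => v i % 4) = 7 := by
    have e := sz_has [3, 2] _ hx
    rw [e]
    have : (fun i => (v i % 4) / 2 ^ ([3, 2] : List ℕ).length) = fun _ => 0 := by
      funext i; show (v i % 4) / 4 = 0; omega
    rw [this]; simp [sz, valW]
  have hlt : ∀ i, v i % 4 < 4 := fun i => Nat.mod_lt _ (by norm_num)
  have hc : Cov (fun i => v i % 4) t := by
    intro i hi
    rw [← hW, ← d1]
    have := hp i
    have hi' : v i % 4 = 0 := hi
    omega
  have hm : nmask t = nmask t' := by
    unfold nmask
    apply List.map_congr_left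
    intro i _
    rw [decide_eq_decide, ← hW, ← hW, ← d1, ← d2, hsup]
  have hc' : Cov (fun i => v i % 4) t' := by
    intro i hi
    rw [← hW, ← d2, ← hsup, d1, hW]
    exact hc i hi
  rw [ht, ht']
  have e : (fun i => v' i % 4 + 4 * W4 t' i) = fun i => v i % 4 + 4 * W4 t' i := by
    funext i; rw [h4]
  rw [e, niter_spec h hx hlt hsx 16 t hc, niter_spec h hx hlt hsx 16 t' hc',
    nform_ok t.1 t.2.1 t.2.2.1 t.2.2.2, nform_ok t'.1 t'.2.1 t'.2.2.1 t'.2.2.2]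
  have : nform (nmask t) = nform (nmask t') := by rw [hm]
  obtain ⟨a, b, c, d⟩ := t
  obtain ⟨a', b', c', d'⟩ := t'
  rw [this]

/-! ### Unit propagation for the weight (3,2,1,1,1,1) -/

def bm : List ℕ → ℕ
  | [] => 0
  | a :: l => a + 2 * bm l

def big (a : ℕ) : ℕ := bif Nat.ble 4 a then 1 else 0

def keyT (l : List ℕ) : ℕ :=
  bm (l.map fun a => a % 2) + 32 * bm (l.map fun a => a / 2 % 2) + 1024 * bm (l.map big)

def key3 (v : Vn 5) : ℕ := keyT (List.ofFn v)

theorem big_le (a : ℕ) : big a ≤ 1 := by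
  unfold big; cases Nat.ble 4 a <;> simp

theorem big_iff (a : ℕ) : big a = 1 ↔ 0 < a / 4 := by
  unfold big
  cases h : Nat.ble 4 a
  · have : ¬ 4 ≤ a := by intro h'; rw [← Nat.ble_eq, h] at h'; simp at h'
    simp; omega
  · rw [Nat.ble_eq] at h
    simp; omega

theorem ofFn5 (v : Vn 5) : List.ofFn v = [v 0, v 1, v 2, v 3, v 4] := by
  simp [List.ofFn_succ]

theorem ofFn_ve {t : List ℕ} (h : t.length = 5) : List.ofFn (ve t) = t := by
  obtain ⟨a, b, c, d, e, rfl⟩ := len5 h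
  rw [ofFn5]; rfl

theorem bm_inj5 {a b c d e a' b' c' d' e' : ℕ} (ha : a ≤ 1) (hb : b ≤ 1) (hc : c ≤ 1) (hd : d ≤ 1)
    (ha' : a' ≤ 1) (hb' : b' ≤ 1) (hc' : c' ≤ 1) (hd' : d' ≤ 1)
    (h : bm [a, b, c, d, e] = bm [a', b', c', d', e']) :
    a = a' ∧ b = b' ∧ c = c' ∧ d = d' ∧ e = e' := by
  simp only [bm] at h
  omega

theorem bm_lt5 {a b c d e : ℕ} (ha : a ≤ 1) (hb : b ≤ 1) (hc : c ≤ 1) (hd : d ≤ 1)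
    (he : e ≤ 1) : bm [a, b, c, d, e] < 32 := by
  simp only [bm]
  omega

theorem m2 (a : ℕ) : a % 2 ≤ 1 := by omega

theorem key3_inj {v v' : Vn 5} (h : key3 v = key3 v') :
    (∀ i, v i % 4 = v' i % 4) ∧ ∀ i, 0 < v i / 4 ↔ 0 < v' i / 4 := by
  unfold key3 keyT at h
  rw [ofFn5, ofFn5] at h
  simp only [List.map_cons, List.map_nil] at h
  have a1 := bm_lt5 (m2 (v 0)) (m2 (v 1)) (m2 (v 2)) (m2 (v 3)) (m2 (v 4))
  have a2 := bm_lt5 (m2 (v 0 / 2)) (m2 (v 1 / 2)) (m2 (v 2 / 2)) (m2 (v 3 / 2)) (m2 (v 4 / 2))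
  have b1 := bm_lt5 (m2 (v' 0)) (m2 (v' 1)) (m2 (v' 2)) (m2 (v' 3)) (m2 (v' 4))
  have b2 := bm_lt5 (m2 (v' 0 / 2)) (m2 (v' 1 / 2)) (m2 (v' 2 / 2)) (m2 (v' 3 / 2)) (m2 (v' 4 / 2))
  have c1 := bm_inj5 (m2 _) (m2 _) (m2 _) (m2 _) (m2 _) (m2 _) (m2 _) (m2 _)
    (by omega : bm [v 0 % 2, v 1 % 2, v 2 % 2, v 3 % 2, v 4 % 2] =
      bm [v' 0 % 2, v' 1 % 2, v' 2 % 2, v' 3 % 2, v' 4 % 2])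
  have c2 := bm_inj5 (m2 _) (m2 _) (m2 _) (m2 _) (m2 _) (m2 _) (m2 _) (m2 _)
    (by omega : bm [v 0 / 2 % 2, v 1 / 2 % 2, v 2 / 2 % 2, v 3 / 2 % 2, v 4 / 2 % 2] =
      bm [v' 0 / 2 % 2, v' 1 / 2 % 2, v' 2 / 2 % 2, v' 3 / 2 % 2, v' 4 / 2 % 2])
  have c3 := bm_inj5 (big_le _) (big_le _) (big_le _) (big_le _) (big_le _) (big_le _) (big_le _)
    (big_le _) (by omega : bm [big (v 0), big (v 1), big (v 2), big (v 3), big (v 4)] =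
      bm [big (v' 0), big (v' 1), big (v' 2), big (v' 3), big (v' 4)])
  constructor
  · intro i
    fin_cases i <;> simp only [Fin.isValue, Fin.zero_eta, Fin.mk_one, Fin.reduceFinMk] <;> omega
  · intro i
    rw [← big_iff, ← big_iff]
    fin_cases i <;> simp only [Fin.isValue, Fin.zero_eta, Fin.mk_one, Fin.reduceFinMk] <;> omega

/-- vectors under consideration -/
def Val6 (v : Vn 5) : Prop := sz v = 67 ∧ (∀ i, 0 < v i) ∧ has Om6 v

open Classical in
def gv (μ : Vn 5 → ZMod 2) (k : ℕ) : ZMod 2 :=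
  if h : ∃ v, Val6 v ∧ key3 v = k then μ h.choose else 0

theorem gv_spec {μ : Vn 5 → ZMod 2} (h : Kam Om6 Finset.univ 67 μ) {v : Vn 5} (hv : Val6 v) :
    gv μ (key3 v) = μ v := by
  have hex : ∃ w, Val6 w ∧ key3 w = key3 v := ⟨v, hv, rfl⟩
  unfold gv
  rw [dif_pos hex]
  obtain ⟨h1, h2⟩ := hex.choose_spec
  obtain ⟨k1, k2⟩ := key3_inj h2
  exact tail_indep h h1.2.2 h1.1 h1.2.1 hv.2.2 hv.1 k1 k2

def posL : List ℕ → Bool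
  | [] => true
  | a :: l => Nat.ble 1 a && posL l

theorem posL_spec {l : List ℕ} (hl : l.length = 5) (h : posL l = true) : ∀ i, 0 < ve l i := by
  obtain ⟨a, b, c, d, e, rfl⟩ := len5 hl
  simp only [posL, Bool.and_eq_true, Nat.ble_eq] at h
  intro i; fin_cases i <;> simp [ve] <;> omega

def all2 (p : List ℕ → Bool) : List (List ℕ) → Bool
  | [] => true
  | a :: l => p a && all2 p l

theorem all2_spec {p : List ℕ → Bool} {l : List (List ℕ)} (h : all2 p l = true) :
    ∀ a ∈ l, p a = true := by
  induction l with
  | nil => simp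
  | cons b l ih =>
    simp only [all2, Bool.and_eq_true] at h
    intro a ha
    rcases List.mem_cons.1 ha with rfl | ha
    · exact h.1
    · exact ih h.2 a ha

def okT (r : ℕ) : Bool :=
  posL (relF r) && Nat.ble 1 (relJ r) && Nat.beq (sumL (relF r) + relJ r) 67 &&
    all2 (fun t => Nat.ble (cmpW Om6 t) 1) (terms (relF r) (relJ r))

def keysT (K : Tr) (r : ℕ) : List (List ℕ) :=
  (((terms (relF r) (relJ r)).filter (fun t => Nat.beq (cmpW Om6 t) 1)).filter
    (fun t => !K.mem (keyT t))).map fun t => [keyT t]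

def outT (K : Tr) (rs : List ℕ) : List (List ℕ) := rs.foldr (fun r L => togs (keysT K r) L) []

def runT : List (List ℕ) → Tr → Option Tr
  | [], K => some K
  | rs :: L, K => match allB okT rs, outT K rs with
    | true, [[k]] => runT L (K.ins k)
    | _, _ => none

theorem sum_filter_zero {α : Type} (g : α → ZMod 2) (p : α → Bool) (l : List α)
    (h : ∀ a ∈ l, p a = false → g a = 0) : ((l.filter p).map g).sum = (l.map g).sum := by
  induction l with
  | nil => rfl
  | cons a l ih =>
    have := ih (fun b hb => h b (by simp [hb]))
    rw [List.filter_cons]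
    cases hp : p a
    · simp [this, h a (by simp) hp]
    · simp [this]

theorem keysT_sum {μ : Vn 5 → ZMod 2} (h : Kam Om6 Finset.univ 67 μ) {K : Tr}
    (hK : K.All fun k => gv μ k = 0) {r : ℕ} (hr : okT r = true) :
    ((keysT K r).map fun l => gv μ (l.headD 0)).sum = 0 := by
  unfold okT at hr
  simp only [Bool.and_eq_true, Nat.ble_eq] at hr
  obtain ⟨⟨⟨r1, r2⟩, r3⟩, r4⟩ := hr
  have r3 := Nat.eq_of_beq_eq_true r3
  have r4 := all2_spec r4
  have hl := relF_len r
  have hrel := h.rel (ve (relF r)) (relJ r) r2 (by rw [sz_ve hl]; exact r3)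
    (fun i _ => posL_spec hl r1 i)
  have hsum := terms_sum hl (relJ r) μ
  rw [hrel] at hsum
  have hspec : ∀ t ∈ terms (relF r) (relJ r), t.length = 5 ∧ sz (ve t) = 67 ∧ ∀ i, 0 < ve t i := by
    intro t ht
    obtain ⟨h1, b, hb, e⟩ := terms_spec hl ht
    refine ⟨h1, ?_, ?_⟩
    · rw [e]
      have := (mem_Bset.1 hb).2
      unfold sz at this ⊢
      simp only [Pi.add_apply, Finset.sum_add_distrib, this]
      have := sz_ve hl
      unfold sz at this
      omega
    · intro i
      rw [e]
      have := posL_spec hl r1 i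
      simp only [Pi.add_apply]; omega
  unfold keysT
  rw [List.map_map]
  have e0 : ((fun l : List ℕ => gv μ (l.headD 0)) ∘ fun t => [keyT t]) = fun t => gv μ (keyT t) := by
    funext t; rfl
  rw [e0, sum_filter_zero (fun t => gv μ (keyT t)), ← hsum,
    ← sum_filter_zero (fun t => μ (ve t)) (fun t => Nat.beq (cmpW Om6 t) 1)]
  · congr 1
    apply List.map_congr_left
    intro t ht
    rw [List.mem_filter] at ht
    obtain ⟨h1, h2, h3⟩ := hspec t ht.1
    rw [← gv_spec h ⟨h2, h3, ((cmpW_spec Om6 t h1).2).1 (Nat.eq_of_beq_eq_true ht.2)⟩, key3,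
      ofFn_ve h1]
  · intro t ht hp
    obtain ⟨h1, h2, h3⟩ := hspec t ht
    apply h.low _ h2 (fun i _ => h3 i)
    apply ((cmpW_spec Om6 t h1).1).1
    have := r4 t ht
    rw [Nat.ble_eq] at this
    have hne : cmpW Om6 t ≠ 1 := by
      intro h'; rw [h'] at hp; simp at hp
    omega
  · intro t _ hp
    rw [Bool.not_eq_false'] at hp
    exact hK.mem hp

theorem outT_sum {μ : Vn 5 → ZMod 2} (h : Kam Om6 Finset.univ 67 μ) {K : Tr}
    (hK : K.All fun k => gv μ k = 0) : ∀ {rs : List ℕ}, allB okT rs = true →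
    ((outT K rs).map fun l => gv μ (l.headD 0)).sum = 0 := by
  intro rs
  induction rs with
  | nil => intro _; rfl
  | cons r rs ih =>
    intro hr
    simp only [allB, Bool.and_eq_true] at hr
    have := ih hr.2
    unfold outT at this ⊢
    rw [List.foldr_cons, togs_sum, this, keysT_sum h hK hr.1, add_zero]

theorem runT_sound {μ : Vn 5 → ZMod 2} (h : Kam Om6 Finset.univ 67 μ) : ∀ (L : List (List ℕ))
    {K K' : Tr}, K.All (fun k => gv μ k = 0) → runT L K = some K' →
    K'.All fun k => gv μ k = 0 := by
  intro L
  induction L with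
  | nil =>
    intro K K' hK hr
    simp only [runT, Option.some.injEq] at hr
    rw [← hr]; exact hK
  | cons rs L ih =>
    intro K K' hK hr
    unfold runT at hr
    split at hr
    · rename_i k h1 h2
      have := outT_sum h hK h1
      rw [h2] at this
      exact ih (hK.ins (by simpa using this)) hr
    · simp at hr

def seedT : List ℕ → Tr → Tr
  | [], K => K
  | r :: L, K => seedT L (K.ins (keyT (unp 5 r)))

def seedOk (r : ℕ) : Bool :=
  posL (unp 5 r) && Nat.beq (sumL (unp 5 r)) 67 && Nat.beq (cmpW Om6 (unp 5 r)) 1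

theorem seedOk_spec {r : ℕ} (h : seedOk r = true) : Val6 (ve (unp 5 r)) := by
  unfold seedOk at h
  simp only [Bool.and_eq_true] at h
  have hl := unp_len 5 r
  exact ⟨by rw [sz_ve hl]; exact Nat.eq_of_beq_eq_true h.1.2, posL_spec hl h.1.1,
    ((cmpW_spec Om6 _ hl).2).1 (Nat.eq_of_beq_eq_true h.2)⟩

theorem seedT_sound {μ : Vn 5 → ZMod 2} (h : Kam Om6 Finset.univ 67 μ) : ∀ (L : List ℕ) {K : Tr},
    allB seedOk L = true → (∀ r ∈ L, μ (ve (unp 5 r)) = 0) → K.All (fun k => gv μ k = 0) →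
    (seedT L K).All fun k => gv μ k = 0 := by
  intro L
  induction L with
  | nil => intro K _ _ hK; exact hK
  | cons r L ih =>
    intro K h1 h2 hK
    simp only [allB, Bool.and_eq_true] at h1
    apply ih h1.2 (fun r hr => h2 r (by simp [hr]))
    apply hK.ins
    have := gv_spec h (seedOk_spec h1.1)
    rw [key3, ofFn_ve (unp_len 5 r)] at this
    rw [this]
    exact h2 r (by simp)

def pos3 : List ℕ → List ℕ → List ℕ → Bool
  | a :: l, b :: l', c :: l'' => Nat.ble 1 (a + b + c) && pos3 l l' l''
  | _, _, _ => true

def complT (K : Tr) : Bool :=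
  all2 (fun c1 => all2 (fun c2 => all2 (fun c3 => !pos3 c1 c2 c3 ||
    K.mem (bm c1 + 32 * bm c2 + 1024 * bm c3))
      (colsL 5 1 ++ (colsL 5 2 ++ (colsL 5 3 ++ colsL 5 4)))) (colsL 5 2)) (colsL 5 3)

theorem complT_spec {K : Tr} (h : complT K = true) {c1 c2 c3 : List ℕ} (h1 : c1 ∈ colsL 5 3)
    (h2 : c2 ∈ colsL 5 2) (h3 : c3 ∈ colsL 5 1 ++ (colsL 5 2 ++ (colsL 5 3 ++ colsL 5 4))) :
    (!pos3 c1 c2 c3 || K.mem (bm c1 + 32 * bm c2 + 1024 * bm c3)) = true :=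
  all2_spec (all2_spec (all2_spec h _ h1) _ h2) _ h3

/-- representatives for the weight (3,2,1,1,1,1), packed in base 64 -/
def seedL : List ℕ := [
  537147139, 33830941, 33952909, 33952783, 33951901, 33960973, 570757261, 553988614, 554242819,
  554242189, 58790659, 554185741, 554242567, 558379525, 58790533, 587796997, 553984141, 50729998,
  587534854, 554029186, 553918621, 50730124, 574656835, 554238787, 58794565, 58785997, 58729549,
  554238535, 587792965, 557875651, 558399685, 553976014, 570696781, 537207619, 554185804,
  554242252, 557895874, 554025154, 554250820, 34214989, 553919692, 33956941, 33952972, 541626691,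
  537206863, 537407581, 574632013, 537514051, 537473101, 34213981, 541642819, 570757198,
  587792461, 58789966, 554291266, 554180701, 558374989, 570695773, 570806338, 33951838, 17180419,
  25284739, 17445901, 17437711, 17315869, 17437837, 25759885, 25239757, 17441869, 17437900,
  17311837, 25699405, 17438530, 25759822, 17436766, 17180482, 17049757, 17551426, 17309821,
  25505932, 25506310, 541372486, 541380739, 34477069, 42218509, 537727054, 17698972, 574894597,
  541364359, 541340293, 42213469, 42795085, 574931011, 59048077, 554500237, 558112909, 59052802,
  25436317, 26017933, 25494403, 34477132, 42270925, 42214477, 574914883, 42799621, 574935106,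
  25546882, 42275650, 59572300, 42275524, 588054604, 26018626, 25694428, 42734668, 541331662,
  574886092, 537662542, 544477378, 42210508, 541594435, 42211075, 574624579, 544477315,
  541331599, 537400525, 58725454, 554177677, 58724509, 591401101, 591663874, 17307742, 25170079,
  25433986, 570691741, 578031682, 1023676546, 587579521, 587474689, 594550849, 591926017,
  587531137, 587539201, 50734849, 554295361, 557904001, 561000577, 554242945, 59314945,
  554238913, 42013633, 537514177, 541642945, 554182465, 571282177, 554549377, 34477825,
  541905025, 33949633, 25809025, 25962241]

def certT : List (List ℕ) := [
  [2181316099], [2181437059], [2181314713], [2181436555], [2181314587], [2181533827],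
  [2181435547], [2181312697], [2181445123], [2181444619], [2181443737], [2181444745],
  [2718273667], [2718240907], [2718183577], [2718249097], [2718241411], [1627730437],
  [1627722499], [2701734403], [2701758595], [2701734025], [2206306435], [2206282243],
  [2198476291], [1627665421], [2701669891], [2701668505], [2198353945], [1627722247],
  [2701725835], [2701669387], [2198475787], [2705863171], [2705862793], [2206741513],
  [2206274179], [2206217353], [2198475913], [2735280643], [2735280265], [2735223817],
  [1627721869], [2701500547], [2701467787], [2701406362], [2701471882], [1124471821],
  [2198212762], [2198091802], [2198221834], [2198218243], [2198217739], [2198216857],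
  [1661276677], [2735018122], [2734961674], [2735022595], [2735022217], [2735026312],
  [2735014027], [3104059522], [2701504642], [2198311042], [2735050882], [3104055427],
  [2701402267], [2198085817], [2734956697], [2198214274], [2198213770], [2198091928],
  [2198221960], [2735018626], [1627722373], [2701468291], [2198217865], [2701403779],
  [2735014531], [2198209675], [1631621443], [1627718467], [2701730371], [1132532293],
  [2206278211], [2198479945], [1124467789], [2206302403], [2206277833], [2198470873],
  [2206213699], [2206212313], [2198349913], [1627718215], [2701721803], [2701665355],
  [2198471755], [1661272645], [2735276611], [2735276233], [2735219785], [2705334979],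
  [2701722307], [2206270147], [2705883331], [2705858761], [2206793929], [1627717837],
  [2198208730], [2735014090], [2718269635], [2718236875], [1627661389], [2718180931],
  [2718180427], [2718179545], [2701402330], [2198087770], [2734957642], [1610945347],
  [2684723395], [2718245443], [2718503491], [2684690635], [1627726405], [1644499525],
  [1627984453], [1610945095], [2701467850], [2198217802], [2198475850], [2735022280],
  [1661276740], [1627665484], [2701669450], [2198354008], [2735223880], [2718184522],
  [1631597125], [1610888269], [2722116163], [2684892235], [1627721932], [2701725898],
  [2701668568], [2198474968], [2735280328], [2718240970], [2718183640], [1631621317],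
  [1610944717], [2722140355], [2722115785], [2684948683], [2707435714], [2701758658],
  [2206306498], [2738917570], [3104055490], [2701500610], [2198307010], [2735046850],
  [1627722562], [2718273730], [2718185026], [1627730500], [2701734466], [2701734088],
  [2198484040], [2718249538], [2718249160], [2684694730], [1610953285], [2684957251],
  [2684956873], [2181699139], [2181698635], [2181697753], [2181576793], [2181706825],
  [2701403842], [2701403338], [2198087896], [2734957768], [2701468354], [1627718341],
  [2718237379], [2718180553], [2684691139], [2684626123], [1107694669], [2181441091],
  [2181440587], [2181439705], [2181440713], [2181435610], [2181314650], [2181444682],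
  [2181312067], [2181533890], [2181437122], [2181436618], [2181314776], [2181444808],
  [2718241474], [1610945221], [1627722436], [2684949187], [2684892361], [2181698761],
  [2701726402], [2701669576], [2198475976], [2689110211], [2689086019], [2190021187],
  [1610944591], [1610887261], [2684891227], [1631596621], [2722115659], [2718445657],
  [1631621191], [1610993731], [3087544387], [2718535747], [1631637571], [1610952781],
  [2684989507], [2684956747], [2718511177], [1631629381], [2181795907], [2181697627],
  [2181574777], [2181705817], [2691182659], [2689118275], [2190053443], [2722664515],
  [2689085515], [1644499021], [2718183514], [2718249034], [2718277699], [2718244939],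
  [1627664476], [1627729996], [1627766851], [1627717711], [2701668442], [2701762627],
  [1627721806], [1661272141], [2735308867], [2735276107], [2735284297], [2735022154],
  [1665175621], [1661276236], [2738892874], [2735288392], [1132531789], [2206216282],
  [2206281802], [2198474842], [2206310467], [2206277707], [2198478937], [1124470876],
  [1124466781], [3104321602], [2701766722], [2198573122], [2735312962], [3104317507],
  [2701664347], [2198347897], [2735218777], [2707955779], [2705858635], [2206736473],
  [2739413065], [2705891395], [1632145477], [2705862730], [2206797898], [2707959874],
  [2739417160], [2206806088], [1627660381], [3120832579], [2718179419], [2198085754],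
  [2734956634], [1627770946], [3120836674], [2718281794], [2198315074], [2735054914],
  [3137609794], [1107693661], [2181312634], [2181443674], [2181537859], [2181439579],
  [2181541954], [2181308539], [1090918147], [1099026499], [2165018755], [1090925581],
  [2164930051], [2164928665], [1098985549], [1090917391], [2164920475], [2164929547],
  [1098977359], [1090795549], [2164801027], [2164799515], [2164797625], [1098920029],
  [2164921987], [2164921483], [2164799641], [2164929673], [1098978115], [1098977863],
  [1098921037], [1098986053], [2173276291], [2173243531], [2173186201], [2173251721],
  [2173244035], [1098977485], [2172756163], [2172723403], [2172661978], [2172727498],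
  [1091179597], [2164926019], [2164925515], [2164924633], [2164920538], [2164799578],
  [2164929610], [1090914115], [1090913359], [1090912477], [1090916572], [1090795612],
  [1090925644], [2164663939], [2164662490], [2164537498], [1090917580], [2164921546],
  [2164799704], [2164929736], [2164663498], [1098977989], [1090913485], [2172723907],
  [2164917451], [2164796995], [2164795483], [2164793593], [2164795609], [2173183555],
  [2173183051], [2173182169], [2173183177], [2173248067], [1099502149], [2173243594],
  [2173187146], [2173251784], [2173187272], [2165018818], [2164922050], [2164801090],
  [2164930114], [2173276354], [1099501645], [2173186138], [2173251658], [2173280323],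
  [2173247563], [1091178589], [2164797562], [2164928602], [2165022787], [2164924507],
  [1090793596], [1090924636], [1091027011], [1090912351], [2164535482], [2164760707],
  [1090916446], [1090918210], [2164760770], [2164664002], [2164539010], [2164668034],
  [2164764802], [1090791517], [2164534915], [2164533403], [2164531450], [2164533466],
  [2164531387], [2164534978], [1091031106], [2165026882], [2173284418], [2179477570],
  [1090789501], [2164793467], [2173182043], [2179473475], [1099247692], [1099248133],
  [2172989578], [1615114309], [2189766730], [2189766793], [1099239502], [1116016717],
  [1099239565], [1615122499], [2688856195], [2189791363], [2189795395], [1099240195],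
  [1099284547], [2181961219], [2181959833], [2181968905], [1099183117], [2189702659],
  [2189701273], [2181838873], [2172924058], [1615081549], [1099182172], [1611468877],
  [2685153370], [2685218890], [2181959770], [2685247555], [2181963865], [1091440732],
  [2165182618], [2165059768], [2165190808], [2165186650], [1091441677], [1091436637],
  [2165188099], [1631859205], [2722378243], [2722377865], [2718708745], [1631883523],
  [1615106119], [2688823435], [2685210763], [2189758603], [2685214795], [2189762635],
  [1099239943], [1099235407], [2165187595], [1615082053], [2688823939], [2685154441],
  [2189702281], [1615106371], [2195988547], [2189697115], [2181832825], [2190311491],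
  [2190278731], [2190221401], [2190286921], [1631895619], [2724470851], [2722406467],
  [2718793795], [2722922563], [2705629315], [2722373707], [1648660549], [1631887429],
  [1631883397], [1631879239], [2722377802], [2718765130], [2705600650], [2718773320],
  [1631891524], [1132789837], [2206564483], [2206531723], [2206539913], [2206539850],
  [1132794373], [1132793932], [2206479370], [2206544008], [1628241997], [2702016643],
  [2701983883], [2701992073], [2198732953], [2701992010], [2198732890], [1628246533],
  [1628246092], [2701931530], [2198737930], [2701996168], [1631854669], [2707693699],
  [2705596555], [2701926553], [2206474393], [2701926490], [2206474330], [2206568578],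
  [2206479874], [2206544386], [2198738434], [1099178077], [2179211395], [2172919963],
  [2165055673], [2165055610], [1099759693], [2173534339], [2173501579], [2173444249],
  [2173509769], [2173444186], [2173509706], [1099236163], [2172921475], [2172985987],
  [2165180035], [2173502083], [2189763139], [2172920971], [1099240069], [1116017221],
  [1099244101], [1099235911], [2172925066], [2165183626], [2189702218], [2165191816],
  [1099248196], [1091441740], [2181960778], [2181838936], [2181968968], [2165187658],
  [1611469381], [1091437645], [2685215299], [2181956683], [1099235533], [2189787331],
  [2189754571], [2189762761], [2181955801], [2172985546], [2165178586], [1615106245],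
  [1099239628], [2688823498], [2685210826], [2189766856], [1099179085], [2189698627],
  [2189698123], [2189697241], [2181834841], [2172920026], [2165057626], [1631879491],
  [2722398403], [2722374211], [2718761539], [2705597059], [2701984387], [2206532227],
  [1631879365], [1631855173], [1628242501], [1132790341], [2705596618], [2701983946],
  [2701927498], [2206531786], [2206475338], [2198733898], [1099764229], [2190283267],
  [2190282889], [2190226441], [2173505674], [2173449226], [1615630405], [1099763788],
  [2173513864], [2173449352], [2689347658], [2190291016], [2722902088], [1631899714],
  [2724474946], [2722410562], [2718797890], [2722926658], [2702024770], [2206572610],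
  [2195992642], [3104579650], [1099288642], [2179215490], [2173022338], [2165280898],
  [2173538434], [2165284930], [2173542466], [2172925570], [2179735618], [1099240258],
  [2189791426], [2189702722], [2189767234], [2181961282], [2173018306], [2165188162],
  [2179211458], [2207088706], [2207055946], [2206998616], [2207064136], [1632403525],
  [1632407620], [2706145411], [2706120841], [2207056009], [2706149506], [2706124936],
  [2207060104], [1099240132], [2189759170], [2189702344], [2181960904], [2172986050],
  [2165187784], [2172921538], [2165179594], [1099236037], [2189755075], [2189698249],
  [2181956809], [2735571010], [2735538250], [2735480920], [2735546440], [2739699778],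
  [1665433669], [1665437764], [2739175555], [2739150985], [2735538313], [2739179650],
  [2739155080], [2735542408], [2173534402], [2173502146], [2173445698], [2173510210],
  [2173501642], [1099764292], [1099760197], [2190283330], [2190282952], [2190226504],
  [2190279235], [2190278857], [2190222409], [1099174108], [1099699276], [2190217432],
  [1615073485], [2689339594], [2189693146], [1615598149], [1631850700], [2722369738],
  [2722894024], [1611404365], [2685145306], [2181830746], [2718700618], [1091311708],
  [1628181580], [3087798466], [2691436738], [2195984578], [2724466882], [1099175116],
  [2189694658], [2189694154], [2181830872], [2190218440], [2722370242], [1615073989],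
  [1615074115], [2691174595], [2689077955], [2685146755], [2689340035], [1099175683],
  [2189694595], [2181832195], [2190218755], [1115952205], [1091311645], [1099699213],
  [2189956675], [2189955289], [2189956297], [2165053594], [1098913603], [1098911965],
  [1098912973], [1099175053], [1099174990], [1631589187], [2724204739], [2722108099],
  [2722632259], [1631588557], [1631589061], [1648628293], [2705854666], [2722370179],
  [2718700681], [1632113221], [1631851078], [1631851267], [2722894339], [1628181517],
  [1632375301], [1618219075], [3087798403], [2691436675], [2195984515], [2724466819],
  [1611403357], [1615597645], [1615073359], [2685145243], [2689339531], [2189693083],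
  [2722369675], [2685146251], [1099174927], [1631851015], [1615073863], [2173179019],
  [2689077451], [2189956171], [2722107595], [2189432011], [1631588935], [1610880205],
  [2684884675], [2684884171], [2181568729], [2718438601], [1610880835], [3087536323],
  [1610880079], [1610879197], [1132467277], [2206208218], [2206209226], [2206733386],
  [2206209667], [2206209163], [2206733449], [1132729420], [2206733512], [1132729357],
  [2198608024], [1631851204], [2206995466], [2701927624], [2206475464], [2206995592],
  [1632375364], [2706120904], [2206999624], [1627919437], [2701661827], [2701661323],
  [2198345881], [2701660378], [2701661386], [2198345818], [1627657987], [1627657231],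
  [1124341789], [1627656412], [1627657420], [1124341852], [2718176899], [2718175450],
  [2198083738], [1132466269], [2212499587], [2206208155], [2198343865], [2206732441],
  [1634734147], [1631588431], [1631850637], [2724728899], [2701922458], [2706116746],
  [2206470298], [1648627789], [1632112717], [1628180572], [1632374860], [1132728412],
  [1665142861], [2740981891], [2738884747], [2735214745], [2739409033], [2739408970],
  [2738885251], [1661211661], [1665405445], [1665405004], [1665143365], [2734953610],
  [2735477770], [2739671176], [2738884810], [2735215690], [2735477896], [2739409096],
  [2735215816], [1665405508], [2739151048], [2735481928], [2741244034], [2739147394],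
  [2735478274], [2739671554], [2212761730], [1091049565], [2164789498], [2164791514],
  [2164792963], [2164791451], [1090785532], [1090787548], [1090789123], [1090787359],
  [2181304570], [2181308035], [1090787422], [1098911839], [2164789435], [2173178011],
  [2189955163], [1099174045], [2179469443], [1115951197], [1099436125], [2196246595],
  [2165051578], [2173440154], [2181828730], [2190217306], [1099175746], [2165055106],
  [2173441666], [2179469506], [2173179586], [2179731586], [2164793026], [1627656349],
  [3120828547], [2718175387], [2198081722], [2734952602], [2080641091], [1610879071],
  [2181304507], [1124339836], [1661210716], [3121090627], [2181566587], [1090785469],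
  [2198343802], [1644433501], [1107562621], [1091047549], [1634996290], [3121352770],
  [2724991042], [2213023810], [2741506114], [2196508738], [3137867842], [1106513986],
  [2097418306], [3137605762], [2734954114], [2198085250], [1661321281], [1661212417],
  [3137609857], [1668288577], [3137871937], [3137867905], [2097422401], [2097680449],
  [2097418369], [1665405697], [2741506177], [1661272897], [2734958209], [1661276929],
  [2735054977], [2735022721], [1124472577], [2198315137], [2198218369], [1124581441],
  [1124468545], [2198089345], [1124343553], [1627775041], [2198577217], [2735317057],
  [1132580929], [1665192001], [2198573185], [1628033089], [1627771009], [1631645761],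
  [2701766785], [2206314625], [2738925697], [2718543937], [1627730689], [1611001921],
  [1634742337], [3104321665], [2212507777], [2740990081], [3121098817], [1627666177],
  [2080649281], [1627722625], [2701670017], [2701734529], [2198476417], [2735280769],
  [2718185089], [2718249601], [1631597377], [1631629633], [1132532545], [1665175873],
  [1610889025], [1610953537], [2198480449], [2718447169], [1627726657], [1132794625],
  [2206830721], [2206798465], [2206742017], [2206806529], [2739441793], [1631859457],
  [1631891713], [1665437953], [1627718593], [2701730497], [2198472385], [2735276737],
  [2718245569], [1631621569], [1610945473], [2722116289], [2684957377], [1098978241],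
  [2189440705], [2189505217], [2181699265], [1098921793], [1098986305], [1610993857],
  [3087544513], [2684989633], [2181796033], [2718535873], [2718277825], [1099026625],
  [1631637697], [1627766977], [2206310593], [2738921665], [1615122625], [2691182785],
  [2689118401], [2190053569], [2722664641], [1615082305], [2689086145], [1615114561],
  [2722378369], [1615106497], [1627662145], [3104317633], [2701665985], [2198351425],
  [2735220289], [3120832705], [2718181057], [1628246785], [2718765697], [2718709249],
  [2718773761], [2198742529], [2735546881], [1611469633], [2735482369], [2685247681],
  [2685215425], [1628182273], [2198613505], [1132730113], [2213023873], [1139806273],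
  [1628291137], [3104579713], [2702024833], [2198831233], [2735571073], [1634996353],
  [1631899777], [1132838977], [1665450049], [3121352833], [2724475009], [2722410625],
  [2718797953], [2213027905], [2206834753], [2081165377], [1618227265], [1615130689],
  [1611518017], [1635258433], [1635000385], [1632161857], [1631903809], [1091442433],
  [2182058113], [2181961345], [2181840385], [2181969409], [1116017473], [1099183873],
  [1099248385], [2189795521], [2189763265], [2181965377], [2173187713], [1099284673],
  [1099236289], [1091438401], [1099502401], [1099240321], [1615646785], [2691444865],
  [2689380481], [2190315649], [2722926721], [2722930753], [2689348225], [1099764481],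
  [1632407809], [1632419905], [2724995137], [1615630657], [2173510273], [2207064577],
  [2708217985], [2739699841], [1618743361], [2689376449], [2190287425], [1632375553],
  [2190279361], [1090914241], [2181312193], [2181441217], [2164926145], [1107695425],
  [2181537985], [1091180353], [1090922305], [2165022913], [2181316225], [2181445249],
  [2164801153], [2164930177], [2181542017], [1099288705], [2179477633], [2173284481],
  [2165284993], [2173542529], [1106260033], [1099034689], [2165026945], [1091551297],
  [1099808833], [2196254785], [2181804097], [1091031169], [2182062145], [2196512833],
  [1099550785], [1107808321], [1091293249], [1099699969], [2179735681], [2173445761],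
  [2196508801], [1106518081], [2165059201], [1123291201], [1106514049], [1091313409],
  [1611405121, 1115952961, 2181836353, 2181832321],
  [1627920193, 1665143617, 2735216257, 2735216194],
  [1631855425, 1665433921, 2739413569, 2739151489, 2739151426],
  [1631883586, 1631859268, 2722378306, 2705863234, 2705601154],
  [1615074241, 1611405121, 1648628545, 2722632385, 2685150913, 2718701185], [1631589313],
  [2718439105], [2701661890], [2705855170], [2206209730], [2738885314], [1610880961],
  [1627920193], [1627658050], [3104313538], [1631851330], [1132468033], [1665143617],
  [2181308098], [1627658113], [3120828610], [1634734273], [2707693762], [2705597122],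
  [2701928002], [2706121282], [2206475842], [2739151426], [2206733953], [1090789186],
  [2080641217], [2705629378], [2701992514], [2206540354],
  [1098913729, 1091051329, 2181570241, 2164797121],
  [1631895745, 1631887681, 2722406593, 2705891521], [1631883649], [2701992577], [2206540417],
  [2705601154], [2701988482], [2206536322], [1628242753], [2701928065], [2735538817],
  [1132790593], [2207056513], [1628246596], [1132794436], [2718793921], [2718761665],
  [2718705217], [2718769729], [1631855425], [1631851393], [1665433921], [2206826689],
  [2206794433], [2206802497], [1632403777], [2718765634], [2718765256], [2718708808],
  [2206798402], [2206798024], [2206741576], [2724470977], [2722374337], [1611405121],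
  [2181836353], [1632113473], [2722894465], [2722898497], [1618219201], [1615074241],
  [2181832321], [1099179841], [2196246721], [2189956801], [1099175809], [2179473601],
  [2173183681], [2181570241], [2164797121], [1107566401], [1090793281]]

def chkT : Bool :=
  allB seedOk seedL && match runT certT (seedT seedL .nil) with
    | some K => complT K
    | none => false

theorem chkT_ok : chkT = true := by decide +kernel

theorem sumL_bit (f : ℕ → ℕ) (v : Vn 5) : sumL ((List.ofFn v).map f) = ∑ i, f (v i) := by
  rw [ofFn5, Fin.sum_univ_five]
  simp only [List.map_cons, List.map_nil, sumL]
  omega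

theorem not_full : ∀ a b c d : Fin 5, ∃ i, ¬ (i = a ∨ i = b ∨ i = c ∨ i = d) := by
  decide +kernel

theorem chainT {μ : Vn 5 → ZMod 2} (h : Kam Om6 Finset.univ 67 μ) (S : List ℕ)
    (C : List (List ℕ)) (h1 : allB seedOk S = true) (h0 : ∀ r ∈ S, μ (ve (unp 5 r)) = 0) {K : Tr}
    (hK : runT C (seedT S .nil) = some K) : K.All fun k => gv μ k = 0 :=
  runT_sound h C (seedT_sound h S (K := .nil) h1 h0 trivial) hK

theorem case321111 {μ : Vn 5 → ZMod 2} (hμ : Kam Om6 Finset.univ 67 μ)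
    (h0 : ∀ r ∈ seedL, μ (ve (unp 5 r)) = 0) {v : Vn 5} (hs : sz v = 67) (hp : ∀ i, 0 < v i)
    (hv : has Om6 v) : μ v = 0 := by
  have h := chkT_ok
  unfold chkT at h
  rw [Bool.and_eq_true] at h
  obtain ⟨h1, h2⟩ := h
  split at h2
  · rename_i K hK
    have hK1 := chainT hμ seedL certT h1 h0 hK
    rw [← gv_spec hμ ⟨hs, hp, hv⟩]
    have e1 : sumL ((List.ofFn v).map fun a => a % 2) = 3 := by rw [sumL_bit]; exact hv.1
    have e2 : sumL ((List.ofFn v).map fun a => a / 2 % 2) = 2 := by rw [sumL_bit]; exact hv.2.1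
    have e3 := sumL_bit big v
    have m1 := mem_colsL ((List.ofFn v).map fun a => a % 2) (by
      intro a ha; rw [List.mem_map] at ha; obtain ⟨b, _, rfl⟩ := ha; omega)
    have m2 := mem_colsL ((List.ofFn v).map fun a => a / 2 % 2) (by
      intro a ha; rw [List.mem_map] at ha; obtain ⟨b, _, rfl⟩ := ha; omega)
    have m3 := mem_colsL ((List.ofFn v).map big) (by
      intro a ha; rw [List.mem_map] at ha; obtain ⟨b, _, rfl⟩ := ha
      have := big_le b; omega)
    rw [List.length_map, List.length_ofFn] at m1 m2 m3
    rw [e1] at m1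
    rw [e2] at m2
    have hlo : 1 ≤ ∑ i, big (v i) := by
      by_contra hno
      have hz : ∑ i, big (v i) = 0 := by omega
      have : ∀ i, v i ≤ 3 := by
        intro i
        have a := (Finset.sum_eq_zero_iff.1 hz) i (Finset.mem_univ i)
        have b := big_iff (v i)
        omega
      have : ∑ i, v i ≤ ∑ i : Fin 5, 3 := Finset.sum_le_sum fun i _ => this i
      unfold sz at hs
      simp at this
      omega
    have hhi : ∑ i, big (v i) ≤ 4 := by
      obtain ⟨⟨a, b, c, d⟩, ht⟩ := decomp hv hs
      obtain ⟨i, hi⟩ := not_full a b c d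
      have hW : W4 (a, b, c, d) i = 0 := by
        simp only [not_or] at hi
        simp [W4, E, hi]
      have hb : big (v i) = 0 := by
        have e := congrFun ht i
        have b := big_iff (v i)
        have c := big_le (v i)
        rw [hW] at e
        omega
      rw [← Finset.add_sum_erase _ _ (Finset.mem_univ i), hb]
      have : ∑ k ∈ Finset.univ.erase i, big (v k) ≤ ∑ k ∈ Finset.univ.erase i, 1 :=
        Finset.sum_le_sum fun k _ => big_le _
      simp at this
      omega
    have m3' : (List.ofFn v).map big ∈ colsL 5 1 ++ (colsL 5 2 ++ (colsL 5 3 ++ colsL 5 4)) := by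
      rw [e3] at m3
      simp only [List.mem_append]
      have : ∑ i, big (v i) = 1 ∨ ∑ i, big (v i) = 2 ∨ ∑ i, big (v i) = 3 ∨
        ∑ i, big (v i) = 4 := by omega
      rcases this with h | h | h | h <;> rw [h] at m3
      · exact Or.inl m3
      · exact Or.inr (Or.inl m3)
      · exact Or.inr (Or.inr (Or.inl m3))
      · exact Or.inr (Or.inr (Or.inr m3))
    have hm := complT_spec h2 m1 m2 m3'
    have hpos : pos3 ((List.ofFn v).map fun a => a % 2) ((List.ofFn v).map fun a => a / 2 % 2)
        ((List.ofFn v).map big) = true := by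
      have key : ∀ i, 1 ≤ v i % 2 + v i / 2 % 2 + big (v i) := by
        intro i
        have := hp i
        have b := big_iff (v i)
        omega
      rw [ofFn5]
      simp only [List.map_cons, List.map_nil, pos3, Bool.and_eq_true, Nat.ble_eq]
      exact ⟨key 0, key 1, key 2, key 3, key 4, trivial⟩
    rw [hpos] at hm
    exact hK1.mem hm
  · simp at h2

/-! ### All weights of degree 67 -/

def wtl : ℕ → Vn 5 → List ℕ
  | 0, _ => []
  | k + 1, v => odds v :: wtl k (half v)

def cd : ℕ → Vn 5 → ℕ
  | 0, _ => 0
  | k + 1, v => odds v * 6 ^ k + cd k (half v)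

theorem odds_le (v : Vn 5) : odds v ≤ 5 := by
  unfold odds; rw [Fin.sum_univ_five]; omega

theorem cd_lt (k : ℕ) : ∀ v, cd k v < 6 ^ k := by
  induction k with
  | zero => intro v; simp [cd]
  | succ k ih =>
    intro v
    have h1 := ih (half v)
    have h2 := odds_le v
    have h3 : odds v * 6 ^ k ≤ 5 * 6 ^ k := Nat.mul_le_mul_right _ h2
    rw [cd, pow_succ]; omega

theorem has_wtl (k : ℕ) : ∀ v, has (wtl k v) v := by
  induction k with
  | zero => intro v; trivial
  | succ k ih => intro v; exact ⟨rfl, ih _⟩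

theorem lower_wtl (k : ℕ) : ∀ u v, lower (wtl k v) u → cd k u < cd k v := by
  induction k with
  | zero => intro u v h; exact h.elim
  | succ k ih =>
    intro u v h
    simp only [wtl, lower] at h
    simp only [cd]
    rcases h with h | ⟨h, h'⟩
    · have h1 := cd_lt k (half u)
      have h2 : (odds u + 1) * 6 ^ k ≤ odds v * 6 ^ k := Nat.mul_le_mul_right _ h
      rw [add_mul] at h2
      omega
    · rw [h]
      have := ih _ _ h'
      omega

theorem len_wtl (k : ℕ) : ∀ v, (wtl k v).length = k := by
  induction k with
  | zero => intro v; rfl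
  | succ k ih => intro v; simp [wtl, ih]

theorem le_wtl (k : ℕ) : ∀ v, ∀ w ∈ wtl k v, w ≤ 5 := by
  induction k with
  | zero => intro v; simp [wtl]
  | succ k ih =>
    intro v w hw
    rcases List.mem_cons.1 hw with rfl | h
    · exact odds_le v
    · exact ih _ _ h

def wts : ℕ → ℕ → List (List ℕ)
  | 0, n => bif Nat.beq n 0 then [[]] else []
  | k + 1, n => ((List.range 6).filter fun w => Nat.ble w n && Nat.beq ((n - w) % 2) 0).flatMap
      fun w => (wts k ((n - w) / 2)).map fun l => w :: l

theorem mem_wts : ∀ l : List ℕ, (∀ w ∈ l, w ≤ 5) → l ∈ wts l.length (valW l) := by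
  intro l
  induction l with
  | nil => intro _; simp [wts, valW]
  | cons a l ih =>
    intro h
    have h1 := ih fun w hw => h w (by simp [hw])
    have h2 := h a (by simp)
    simp only [List.length_cons, wts, valW, List.mem_flatMap, List.mem_map, List.mem_filter,
      List.mem_range]
    refine ⟨a, ⟨by omega, ?_⟩, l, ?_, rfl⟩
    · rw [Bool.and_eq_true, Nat.ble_eq]
      refine ⟨by omega, ?_⟩
      have : (a + 2 * valW l - a) % 2 = 0 := by omega
      rw [this]; rfl
    · have : (a + 2 * valW l - a) / 2 = valW l := by omega
      rw [this]; exact h1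

def zeroList : List (List ℕ) :=
  [[0, 1], [0, 2], [0, 3], [0, 4], [0, 5], [1, 2], [1, 5], [2, 5], [4, 5], [3, 5], [1, 1, 4],
   [1, 3, 3], [1, 3, 2], [2, 3, 4], [4, 2, 4, 1], [2, 1, 1, 3], [2, 3, 2, 2], [1, 3, 1, 1]]

theorem zeroList_spec : ∀ Ω ∈ zeroList, ZeroW Ω := by
  intro Ω h
  simp only [zeroList, List.mem_cons, List.not_mem_nil, or_false] at h
  rcases h with rfl | rfl | rfl | rfl | rfl | rfl | rfl | rfl | rfl | rfl | rfl | rfl | rfl | rfl |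
    rfl | rfl | rfl | rfl
  · exact zero_Z 1 (by norm_num)
  · exact zero_Z 2 (by norm_num)
  · exact zero_Z 3 (by norm_num)
  · exact zero_Z 4 (by norm_num)
  · exact zero_Z 5 (by norm_num)
  · exact zero12
  · exact zero15
  · exact zero25
  · exact zero45
  · exact zero35
  · exact zero114
  · exact zero133
  · exact zero132
  · exact zero234
  · exact zero4241
  · exact zero2113
  · exact zero2322
  · exact zero1311

def pre : List ℕ → List ℕ → Bool
  | [], _ => true
  | _ :: _, [] => false
  | a :: l, b :: l' => Nat.beq a b && pre l l'

theorem pre_spec : ∀ l l', pre l l' = true → ∃ r, l' = l ++ r := by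
  intro l
  induction l with
  | nil => intro l' _; exact ⟨l', rfl⟩
  | cons a l ih =>
    intro l' h
    cases l' with
    | nil => simp [pre] at h
    | cons b l' =>
      simp only [pre, Bool.and_eq_true] at h
      obtain ⟨r, rfl⟩ := ih _ h.2
      exact ⟨r, by rw [Nat.eq_of_beq_eq_true h.1]; rfl⟩

def inf (l : List ℕ) : List ℕ → Bool
  | [] => false
  | b :: l' => pre l (b :: l') || inf l l'

theorem inf_spec (l : List ℕ) : ∀ l', inf l l' = true → ∃ s r, l' = s ++ (l ++ r) := by
  intro l'
  induction l' with
  | nil => intro h; simp [inf] at h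
  | cons b l' ih =>
    intro h
    simp only [inf, Bool.or_eq_true] at h
    rcases h with h | h
    · obtain ⟨r, h⟩ := pre_spec _ _ h; exact ⟨[], r, h⟩
    · obtain ⟨s, r, h⟩ := ih h; exact ⟨b :: s, r, by rw [h]; rfl⟩

def special : List (List ℕ) :=
  [[3, 2, 1, 1, 1, 1, 0], [3, 4, 2, 2, 2, 0, 0], [3, 4, 4, 3, 1, 0, 0]]

def wOk (Ω : List ℕ) : Bool :=
  Nat.ble 5 (Ω.headD 0) || (zeroList.any fun z => inf z Ω) || special.any fun s => eqL s Ω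

theorem wts_ok : all2 wOk (wts 7 67) = true := by decide +kernel

theorem has_of_append {Ω Ω' : List ℕ} {v : Vn 5} (h : has (Ω ++ Ω') v) : has Ω v :=
  ((has_append Ω Ω' v).1 h).1

theorem main_zero {μ : Vn 5 → ZMod 2}
    (hrel : ∀ f j, 0 < j → sz f + j = 67 → (∀ i, 0 < f i) → ∑ b ∈ Bset f j, μ (f + b) = 0)
    (h0 : μ (ve b0L) = 0) (hseed : ∀ r ∈ seedL, μ (ve (unp 5 r)) = 0) :
    ∀ v, sz v = 67 → (∀ i, 0 < v i) → odds v < 5 → μ v = 0 := by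
  have key : ∀ n v, cd 7 v = n → sz v = 67 → (∀ i, 0 < v i) → odds v < 5 → μ v = 0 := by
    intro n
    induction n using Nat.strong_induction_on with
    | _ n ih =>
      intro v hn hs hp ho
      have hK : Kam (wtl 7 v) Finset.univ 67 μ := by
        refine ⟨fun f j hj hf hpf => hrel f j hj hf fun i => hpf i (Finset.mem_univ i), ?_⟩
        intro u hus hup hl
        refine ih (cd 7 u) (by rw [← hn]; exact lower_wtl 7 u v hl) u rfl hus
          (fun i => hup i (Finset.mem_univ i)) ?_
        simp only [wtl, lower] at hl
        omega
      have hh := has_wtl 7 v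
      have hval : valW (wtl 7 v) = 67 := by
        have h1 := sz_has _ _ hh
        rw [len_wtl] at h1
        have h2 : sz (fun i => v i / 2 ^ 7) = 0 := by
          unfold sz
          apply Finset.sum_eq_zero
          intro i _
          have : v i ≤ ∑ i, v i := Finset.single_le_sum (fun _ _ => Nat.zero_le _)
            (Finset.mem_univ i)
          unfold sz at hs
          apply Nat.div_eq_of_lt
          omega
        rw [h2] at h1
        omega
      have hm := mem_wts (wtl 7 v) (le_wtl 7 v)
      rw [len_wtl, hval] at hm
      have hok := all2_spec wts_ok _ hm
      have hhd : (wtl 7 v).headD 0 = odds v := rfl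
      generalize wtl 7 v = Ω at hK hh hval hok hhd
      unfold wOk at hok
      simp only [Bool.or_eq_true, Nat.ble_eq, List.any_eq_true] at hok
      rcases hok with (h | ⟨z, hz, h⟩) | ⟨s, hs', h⟩
      · omega
      · obtain ⟨s, r, rfl⟩ := inf_spec _ _ h
        exact ZeroW.infix (zeroList_spec z hz) hK hs (fun i _ => hp i) hh
      · rw [← eqL_eq _ _ h] at hK hh
        simp only [special, List.mem_cons, List.not_mem_nil, or_false] at hs'
        rcases hs' with rfl | rfl | rfl
        · exact case321111 (Kam.weaken (Ω' := [0]) hK) hseed hs hp (has_of_append (Ω' := [0]) hh)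
        · exact zero_of_cert_pos (Ω := [3, 4, 2, 2, 2, 0]) (by decide) (by decide) ok34222
            (Kam.weaken (Ω' := [0]) hK) hs hp (has_of_append (Ω' := [0]) hh)
        · exact case34431 (Kam.weaken (Ω' := [0, 0]) hK) h0 hs hp
            (has_of_append (Ω' := [0, 0]) hh)
  intro v
  exact key _ v rfl

/-! ### From polynomials to exponent vectors -/

/-- the monomial with exponent vector `v` -/
def mv {n : ℕ} (v : Vn n) : P n := monomial (Finsupp.equivFunOnFinite.symm v) 1

theorem mv_prod {n : ℕ} (v : Vn n) : mv v = ∏ i, (X i : P n) ^ v i := by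
  unfold mv
  rw [monomial_eq, Finsupp.prod_fintype _ _ (by simp)]
  simp

theorem monomial_mv {n : ℕ} (a : Fin n →₀ ℕ) : (monomial a 1 : P n) = mv a := by
  unfold mv; rw [Finsupp.equivFunOnFinite_symm_coe]

theorem choose_bit (n : ℕ) : ∀ k, ((n.choose k : ℕ) : ZMod 2) = if k &&& n = k then 1 else 0 := by
  induction n using Nat.strong_induction_on with
  | _ n ih =>
    intro k
    rcases Nat.eq_zero_or_pos n with rfl | hn
    · cases k <;> simp
    · have hp : Fact (Nat.Prime 2) := ⟨Nat.prime_two⟩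
      have h1 := (ZMod.natCast_eq_natCast_iff _ _ _).2
        (Choose.choose_modEq_choose_mod_mul_choose_div_nat (n := n) (k := k) (p := 2))
      rw [h1, Nat.cast_mul, ih (n / 2) (by omega)]
      have h2 : (((n % 2).choose (k % 2) : ℕ) : ZMod 2) = if k % 2 ≤ n % 2 then 1 else 0 := by
        rcases Nat.mod_two_eq_zero_or_one n with h | h <;>
          rcases Nat.mod_two_eq_zero_or_one k with h' | h' <;> simp [h, h']
      rw [h2]
      by_cases h3 : k &&& n = k
      · rw [if_pos h3, if_pos (bsub_mod h3), if_pos (bsub_half h3), one_mul]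
      · rw [if_neg h3]
        by_cases h4 : k % 2 ≤ n % 2
        · rw [if_neg (fun h5 => h3 (bsub_of_parts h4 h5)), mul_zero]
        · rw [if_neg h4, zero_mul]

theorem SqT_mv {n : ℕ} (f : Vn n) : SqT n (mv f) =
    ∑ b ∈ Fintype.piFinset fun i => Finset.range (f i + 1),
      if ∀ i, b i &&& f i = b i then mv (f + b) else 0 := by
  have h1 : ∀ i, (X i + X i ^ 2 : P n) ^ f i =
      ∑ b ∈ Finset.range (f i + 1), if b &&& f i = b then X i ^ (f i + b) else 0 := by
    intro i
    rw [add_comm, add_pow]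
    apply Finset.sum_congr rfl
    intro b hb
    rw [Finset.mem_range] at hb
    have e : ((f i).choose b : P n) = C (((f i).choose b : ℕ) : ZMod 2) := by simp
    rw [e, choose_bit]
    split
    · rw [map_one, mul_one, ← pow_mul, ← pow_add]; congr 1; omega
    · rw [map_zero, mul_zero]
  rw [mv_prod, map_prod]
  simp only [SqT, map_pow, aeval_X, h1]
  rw [Finset.prod_univ_sum]
  apply Finset.sum_congr rfl
  intro b _
  split
  · rename_i h
    rw [mv_prod]
    exact Finset.prod_congr rfl fun i _ => by rw [if_pos (h i)]; rfl
  · rename_i h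
    push Not at h
    obtain ⟨i, hi⟩ := h
    exact Finset.prod_eq_zero (Finset.mem_univ i) (by rw [if_neg hi])

theorem mv_hom {n : ℕ} (v : Vn n) : mv v ∈ homogeneousSubmodule (Fin n) (ZMod 2) (sz v) := by
  rw [mem_homogeneousSubmodule]
  apply isHomogeneous_monomial
  rw [Finsupp.degree_eq_sum]; rfl

theorem sz_add {n : ℕ} (v w : Vn n) : sz (v + w) = sz v + sz w := by
  unfold sz; simp [Finset.sum_add_distrib]

theorem hc_SqT_mv {n d : ℕ} (f : Vn n) (j : ℕ) (h : sz f + j = d) :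
    homogeneousComponent d (SqT n (mv f)) = ∑ b ∈ Bset f j, mv (f + b) := by
  rw [SqT_mv, map_sum]
  unfold Bset
  rw [Finset.sum_filter]
  apply Finset.sum_congr rfl
  intro b _
  by_cases h1 : ∀ i, b i &&& f i = b i
  · rw [if_pos h1, homogeneousComponent_of_mem (mv_hom _), sz_add]
    by_cases h2 : sz b = j
    · rw [if_pos (by omega : d = sz f + sz b), if_pos (And.intro h1 h2)]
    · rw [if_neg (by omega : ¬ d = sz f + sz b), if_neg (fun h => h2 h.2)]
  · rw [if_neg h1, if_neg (fun h => h1 h.1), map_zero]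

theorem isHit_sum {n d : ℕ} (f : Vn n) (j : ℕ) (hj : 0 < j) (h : sz f + j = d) :
    IsHit n d (∑ b ∈ Bset f j, mv (f + b)) := by
  refine ⟨fun i => if i = j then mv f else 0, ?_, ?_⟩
  · intro i
    dsimp only
    split
    · rename_i hi
      have := mv_hom f
      rwa [show d - i = sz f by omega]
    · exact Submodule.zero_mem _
  · rw [Finset.sum_eq_single j]
    · dsimp only
      rw [if_pos rfl, hc_SqT_mv f j h]
    · intro i _ hi; dsimp only; rw [if_neg hi]; simp
    · intro hno; exact absurd (Finset.mem_Icc.2 ⟨hj, by omega⟩) hno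

/-- A functional killing the relations kills all hit polynomials. -/
theorem hit_zero {n d : ℕ} {V : Type*} [AddCommGroup V] [Module (ZMod 2) V]
    (L : P n →ₗ[ZMod 2] V)
    (hL : ∀ (f : Vn n) (j : ℕ), 0 < j → sz f + j = d → ∑ b ∈ Bset f j, L (mv (f + b)) = 0)
    {u : P n} (hu : IsHit n d u) : L u = 0 := by
  obtain ⟨f, hf, rfl⟩ := hu
  rw [map_sum]
  apply Finset.sum_eq_zero
  intro i hi
  rw [Finset.mem_Icc] at hi
  conv_lhs => rw [(f i).as_sum]
  simp only [map_sum]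
  apply Finset.sum_eq_zero
  intro a ha
  have hc : coeff a (f i) = 1 := by
    have h0 := mem_support_iff.1 ha
    generalize coeff a (f i) = c at h0
    fin_cases c
    · exact absurd rfl h0
    · rfl
  have hd : sz (a : Vn n) = d - i := by
    have := ((mem_homogeneousSubmodule _ _).1 (hf i)) (mem_support_iff.1 ha)
    have e := DFunLike.congr_fun (Finsupp.degree_eq_weight_one (R := ℕ) (σ := Fin n)) a
    rw [Finsupp.degree_eq_sum] at e
    exact e.trans this
  rw [hc, monomial_mv, hc_SqT_mv a i (by omega), map_sum]
  exact hL a i hi.1 (by omega)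

theorem hit_rel {n d : ℕ} {V : Type*} [AddCommGroup V] [Module (ZMod 2) V]
    (L : P n →ₗ[ZMod 2] V) (hL : ∀ u, IsHit n d u → L u = 0)
    (f : Vn n) (j : ℕ) (hj : 0 < j) (h : sz f + j = d) : ∑ b ∈ Bset f j, L (mv (f + b)) = 0 := by
  rw [← map_sum]
  exact hL _ (isHit_sum f j hj h)

/-- polynomial = sum of its monomials -/
theorem as_mv {n : ℕ} (p : P n) : p = ∑ a ∈ p.support, mv (a : Vn n) := by
  conv_lhs => rw [p.as_sum]
  apply Finset.sum_congr rfl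
  intro a ha
  have hc : coeff a p = 1 := by
    have h0 := mem_support_iff.1 ha
    generalize coeff a p = c at h0
    fin_cases c
    · exact absurd rfl h0
    · rfl
  rw [hc, monomial_mv]

/-! ### The upper bound -/

theorem S5_mv (a : Fin 5 →₀ ℕ) : S5 (mv (a : Vn 5)) =
    if ∀ i, Odd (a i) then mv (fun i => a i / 2) else 0 := by
  rw [← monomial_mv]
  have : (monomial a 1 : P 5) = basisMonomials (Fin 5) (ZMod 2) a := by
    rw [coe_basisMonomials]
  rw [this, S5, Module.Basis.constr_basis]
  rfl

def Mfun (L : P 5 →ₗ[ZMod 2] ZMod 2) : P 5 →ₗ[ZMod 2] ZMod 2 :=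
  (basisMonomials (Fin 5) (ZMod 2)).constr (ZMod 2) fun a => L (mv fun i => 1 + 2 * a i)

theorem Mfun_mv (L : P 5 →ₗ[ZMod 2] ZMod 2) (v : Vn 5) :
    Mfun L (mv v) = L (mv fun i => 1 + 2 * v i) := by
  have : mv v = basisMonomials (Fin 5) (ZMod 2) (Finsupp.equivFunOnFinite.symm v) := by
    rw [coe_basisMonomials]; rfl
  rw [this, Mfun, Module.Basis.constr_basis]
  rfl

theorem plus_pos {n : ℕ} {f : P n} (hf : f ∈ PplusSub n) {a : Fin n →₀ ℕ} (ha : a ∈ f.support)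
    (i : Fin n) : 0 < a i := by
  have h : ∀ g ∈ PplusSub n, ∀ a : Fin n →₀ ℕ, a i = 0 → coeff a g = 0 := by
    intro g hg
    induction hg using Submodule.span_induction with
    | mem x hx =>
      obtain ⟨b, hb, rfl⟩ := hx
      intro a ha
      rw [mono, coeff_monomial, if_neg]
      rintro rfl
      have := hb i
      omega
    | zero => intro a _; simp
    | add x y _ _ hx hy => intro a ha; rw [coeff_add, hx a ha, hy a ha, add_zero]
    | smul c x _ hx => intro a ha; rw [coeff_smul, hx a ha, smul_zero]
  by_contra hno
  exact mem_support_iff.1 ha (h f hf a (by omega))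

theorem odds_lt_of {v : Vn 5} {i : Fin 5} (h : ¬ Odd (v i)) : odds v < 5 := by
  rw [Nat.not_odd_iff] at h
  unfold odds
  rw [Fin.sum_univ_five]
  fin_cases i <;> simp at h <;> omega

theorem upper {L : P 5 →ₗ[ZMod 2] ZMod 2} (hL : ∀ u, IsHit 5 67 u → L u = 0)
    (h0 : L (mv (ve b0L)) = 0) (hseed : ∀ r ∈ seedL, L (mv (ve (unp 5 r))) = 0)
    {f : P 5} (hf : f ∈ homSub 5 67) (hp : f ∈ PplusSub 5) (hS : IsHit 5 31 (S5 f)) : L f = 0 := by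
  have hmain := main_zero (μ := fun v => L (mv v))
    (fun f j hj hs _ => hit_rel L hL f j hj hs) h0 hseed
  have hK : Kam ([5] ++ []) Finset.univ 67 fun v => L (mv v) := by
    refine ⟨fun f j hj hs _ => hit_rel L hL f j hj hs, ?_⟩
    intro v hs hp hl
    apply hmain v hs (fun i => hp i (Finset.mem_univ i))
    simpa [lower] using hl
  have hK2 := Kam.shift (Ω1 := [5]) (Ω2 := []) (D := 31) (x := fun _ => 1) hK
    ⟨by simp [odds], trivial⟩ (by intro i; simp) (by simp [sz])
  have hM : Mfun L (S5 f) = 0 := by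
    apply hit_zero (Mfun L) _ hS
    intro g j hj hs
    have := hK2.rel g j hj hs (by intro i hi; simp at hi)
    simp only [Mfun_mv]
    exact this
  have e : ∀ a ∈ f.support, L (mv (a : Vn 5)) = Mfun L (S5 (mv (a : Vn 5))) := by
    intro a ha
    rw [S5_mv]
    split
    · rename_i h
      rw [Mfun_mv]
      congr 2
      funext i
      obtain ⟨k, hk⟩ := h i
      omega
    · rename_i h
      push Not at h
      obtain ⟨i, hi⟩ := h
      rw [map_zero]
      apply hmain _ _ (plus_pos hp ha) (odds_lt_of (i := i) (by simpa using hi))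
      have := ((mem_homogeneousSubmodule _ _).1 hf) (mem_support_iff.1 ha)
      have e := DFunLike.congr_fun (Finsupp.degree_eq_weight_one (R := ℕ) (σ := Fin 5)) a
      rw [Finsupp.degree_eq_sum] at e
      exact e.trans this
  rw [as_mv f] at hM ⊢
  rw [map_sum] at hM ⊢
  rw [map_sum] at hM
  rw [← hM]
  exact Finset.sum_congr rfl e

/-! ### A functional detecting the extra class -/

/-- the terms `t` of the monomials `x ^ t` such that `x ^ s` occurs in the total square -/
def optT : List (List ℕ) := [
  [0], [1], [1, 2], [3], [2, 3, 4],
  [3, 5], [3, 5, 6], [7], [4, 6, 7, 8], [5, 7, 9],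
  [5, 6, 7, 9, 10], [7, 11], [6, 7, 10, 11, 12], [7, 11, 13], [7, 11, 13, 14],
  [15], [8, 12, 14, 15, 16], [9, 13, 15, 17], [9, 10, 13, 14, 15, 17, 18], [11, 15, 19],
  [10, 11, 12, 14, 15, 18, 19, 20], [11, 13, 15, 19, 21], [11, 13, 14, 15, 19, 21, 22], [15, 23], [12, 14, 15, 20, 22, 23, 24],
  [13, 15, 21, 23, 25], [13, 14, 15, 21, 22, 23, 25, 26], [15, 23, 27], [14, 15, 22, 23, 26, 27, 28], [15, 23, 27, 29],
  [15, 23, 27, 29, 30], [31], [16, 24, 28, 30, 31, 32], [17, 25, 29, 31, 33], [17, 18, 25, 26, 29, 30, 31, 33, 34],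
  [19, 27, 31, 35], [18, 19, 20, 26, 27, 28, 30, 31, 34, 35, 36], [19, 21, 27, 29, 31, 35, 37], [19, 21, 22, 27, 29, 30, 31, 35, 37, 38], [23, 31, 39]]

def nthL : List (List ℕ) → ℕ → List ℕ
  | [], _ => []
  | a :: _, 0 => a
  | _ :: l, k + 1 => nthL l k

def okO (x g : ℕ) : Bool := Nat.ble g x && Nat.beq ((x - g) &&& g) (x - g)

theorem optT_ok : ∀ x < 40, nthL optT x = (List.range (x + 1)).filter fun g => okO x g := by
  decide +kernel

theorem opt_sum {x : ℕ} (hx : x < 40) (g : ℕ) (c : ZMod 2) :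
    ((nthL optT x).map fun t => if t = g then c else 0).sum = if okO x g then c else 0 := by
  rw [optT_ok x hx]
  have hn : ((List.range (x + 1)).filter fun g => okO x g).Nodup := List.nodup_range.filter _
  rw [← List.sum_toFinset _ hn, Finset.sum_ite_eq']
  congr 1
  simp only [List.mem_toFinset, List.mem_filter, List.mem_range, eq_iff_iff]
  constructor
  · exact fun h => h.2
  · intro h
    refine ⟨?_, h⟩
    unfold okO at h
    rw [Bool.and_eq_true] at h
    have := Nat.le_of_ble_eq_true h.1
    omega

theorem opt_lt {x : ℕ} (hx : x < 40) {t : ℕ} (ht : t ∈ nthL optT x) : t < 64 := by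
  rw [optT_ok x hx] at ht
  have := List.mem_range.1 (List.mem_of_mem_filter ht)
  omega

def exL : List ℕ → List ℕ
  | [] => [0]
  | x :: l => (exL l).flatMap fun r => (nthL optT x).map fun t => t + 64 * r

def okL : List ℕ → List ℕ → Bool
  | x :: l, g :: m => okO x g && okL l m
  | _, _ => true

theorem exL_sum : ∀ (l g : List ℕ), l.length = g.length → (∀ x ∈ l, x < 40) →
    ((exL l).map fun r => if unp l.length r = g then (1 : ZMod 2) else 0).sum =
      if okL l g then 1 else 0 := by
  intro l
  induction l with
  | nil =>
    intro g hg _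
    have : g = [] := List.length_eq_zero_iff.1 (by simpa using hg.symm)
    subst this
    simp [exL, unp, okL]
  | cons x l ih =>
    intro g hg hx
    cases g with
    | nil => simp at hg
    | cons a g =>
      have hx0 : x < 40 := hx x (by simp)
      have h := ih g (by simpa using hg) (fun y hy => hx y (by simp [hy]))
      have e : ∀ r, (((nthL optT x).map fun t => t + 64 * r).map fun r =>
          if unp (x :: l).length r = a :: g then (1 : ZMod 2) else 0).sum =
          (if okO x a then 1 else 0) * if unp l.length r = g then 1 else 0 := by
        intro r
        rw [List.map_map, ite_mul, zero_mul, one_mul, ← opt_sum hx0]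
        congr 1
        apply List.map_congr_left
        intro t ht
        have ht := opt_lt hx0 ht
        have e1 : (t + 64 * r) % 64 = t := by omega
        have e2 : (t + 64 * r) / 64 = r := by omega
        simp only [Function.comp_apply, List.length_cons, unp, e1, e2, List.cons.injEq]
        by_cases h1 : t = a <;> simp [h1]
      rw [exL, List.map_flatMap, List.flatMap_def, List.sum_flatten, List.map_map]
      have e' : ((exL l).map (List.sum ∘ fun r => ((nthL optT x).map fun t => t + 64 * r).map fun r =>
          if unp (x :: l).length r = a :: g then (1 : ZMod 2) else 0)) =
          (exL l).map fun r => (if okO x a then (1 : ZMod 2) else 0) *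
            if unp l.length r = g then 1 else 0 :=
        List.map_congr_left fun r _ => e r
      rw [e', List.sum_map_mul_left, h, okL]
      by_cases h1 : okO x a <;> simp [h1]

/-- merging with cancellation -/
def xm : ℕ → List ℕ → List ℕ → List ℕ
  | 0, a, b => a ++ b
  | _ + 1, [], b => b
  | _ + 1, a, [] => a
  | n + 1, x :: a, y :: b => bif Nat.beq x y then xm n a b else
      bif Nat.ble x y then x :: xm n a (y :: b) else y :: xm n (x :: a) b

theorem xm_sum (F : ℕ → ZMod 2) (n : ℕ) : ∀ a b : List ℕ,
    ((xm n a b).map F).sum = (a.map F).sum + (b.map F).sum := by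
  induction n with
  | zero => intro a b; simp [xm]
  | succ n ih =>
    intro a b
    cases a with
    | nil => simp [xm]
    | cons x a =>
      cases b with
      | nil => simp [xm]
      | cons y b =>
        rw [xm]
        cases h : Nat.beq x y with
        | true =>
          have := Nat.eq_of_beq_eq_true h
          subst this
          simp only [cond_true, ih, List.map_cons, List.sum_cons]
          linear_combination - zm2 (F x)
        | false =>
          cases Nat.ble x y <;>
            simp only [cond_true, cond_false, ih, List.map_cons, List.sum_cons] <;> ring

def xpair (n : ℕ) : List (List ℕ) → List (List ℕ)
  | a :: b :: l => xm n a b :: xpair n l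
  | l => l

theorem xpair_sum (F : ℕ → ZMod 2) (n : ℕ) (l : List (List ℕ)) :
    ((xpair n l).map fun a => (a.map F).sum).sum = (l.map fun a => (a.map F).sum).sum := by
  induction l using xpair.induct with
  | case1 a b l ih => simp [xpair, xm_sum, ih, add_assoc]
  | case2 l h => rw [xpair]; exact h

def xall (n : ℕ) : ℕ → List (List ℕ) → List (List ℕ)
  | 0, l => l
  | k + 1, l => xall n k (xpair n l)

theorem xall_sum (F : ℕ → ZMod 2) (n k : ℕ) : ∀ l : List (List ℕ),
    ((xall n k l).map fun a => (a.map F).sum).sum = (l.map fun a => (a.map F).sum).sum := by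
  induction k with
  | zero => intro l; rfl
  | succ k ih => intro l; rw [xall, ih, xpair_sum]

def thL : List ℕ := [
  51180763, 51180889, 51181141, 51181267, 51213019, 51213145, 51213271, 51213775, 51213901,
  51214027, 51229147, 51229525, 51230029, 51230407, 51237337, 51237589, 51237841, 51238093,
  51238345, 51238597, 51238723, 51704797, 51705679, 51762127, 84734941, 84735193, 84735319,
  84735445, 84735571, 84735823, 84767449, 84767575, 84768205, 84768331, 84783577, 84783955,
  84784081, 84784459, 84784585, 84784837, 84784963, 84791767, 84792019, 84792523, 84792775,
  85259227, 85259983, 85308367, 118257115, 118257241, 118273243, 118273621, 118281433, 118281685,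
  118289623, 118289749, 118289875, 118305499, 118306381, 118313689, 118314445, 118321627,
  118321879, 118322005, 118322635, 118329817, 118330321, 118330825, 118331077, 118331203,
  118337755, 118337881, 118338133, 118338259, 118338637, 118338763, 118345945, 118346071,
  118346323, 118346575, 118346827, 118347079, 118781401, 118781527, 118797529, 118797907,
  118805719, 118805971, 118813657, 118814287, 118829785, 118830667, 118837975, 118838731,
  118845913, 118847047, 118854103, 118854607, 118855111, 119304679, 119304931, 119305813,
  119305939, 119306443, 119306695, 119321059, 119321941, 119322319, 119322823, 119330131,
  119330383, 119338573, 119354071, 119354701, 119354827, 119355079, 119362261, 119362765,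
  119362891, 119363143, 119370199, 119370955, 119378389, 119378893, 119387083, 119403211,
  119419339, 119419591, 119435719, 119829973, 119830099, 119846101, 119846479, 119854291,
  119854543, 119862733, 119862859, 119878357, 119879239, 119886547, 119887303, 119894485,
  119894989, 119902675, 119903179, 120353251, 120353755, 120354007, 120354133, 120354259,
  120354763, 120355015, 120369883, 120370387, 120370639, 120370765, 120371143, 120378262,
  120378325, 120378703, 120378766, 120378829, 120378955, 120382294, 120382357, 120382798,
  120382861, 120386263, 120386389, 120387271, 120402391, 120403399, 120410581, 120411022,
  120411463, 120415054, 120415117, 120419149, 120419527, 120427213, 120435403, 120451783,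
  120467911, 120878293, 120878419, 120894358, 120894421, 120894799, 120894862, 120902485,
  120902611, 120902863, 120902989, 120906454, 120906643, 120906958, 120907147, 120910549,
  120910675, 120926677, 120927118, 120927559, 120934867, 120935245, 120935623, 120939214,
  120939403, 120943435, 120951499, 121156438, 121156501, 121156942, 121157005, 121164502,
  121164691, 121165006, 121165195, 121168597, 121168723, 121169101, 121169227, 121189198,
  121189261, 121197262, 121197451, 121201357, 121201483, 121402957, 121403083, 121419085,
  121419463, 121427275, 121427527, 121459405, 121475533, 121927117, 121927243, 121943245,
  121943623, 121951435, 121951687, 121975501, 121983691, 121991629, 121999819, 122451277,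
  122451655, 122475406, 122475469, 122475847, 122479438, 122479501, 122483533, 122499787,
  122507725, 122515915, 122975437, 122975563, 122991502, 122991565, 122991943, 122999629,
  122999755, 123000007, 123003598, 123003787, 123007693, 123007819, 123023821, 123032011,
  123253582, 123253645, 123261646, 123261835, 123265741, 123265867, 123499723, 123499975,
  123515851, 123516103, 123531979, 123548107, 124564171, 125612491, 125612743, 126644683,
  126644935, 126661063, 127693255, 151843801, 151844053, 151844179, 151844431, 151876309,
  151876435, 151876561, 151877065, 151877191, 151877317, 151877443, 151892437, 151892815,
  151892941, 151893319, 151900627, 151900879, 151901131, 151901383, 152368087, 152368591,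
  152400847, 185365723, 185365849, 185381851, 185382229, 185390041, 185390293, 185397979,
  185398483, 185398861, 185414107, 185414989, 185422549, 185422801, 185423305, 185423557,
  185423683, 185430235, 185430361, 185430487, 185430613, 185431117, 185431243, 185438677,
  185439181, 185446867, 185447245, 185447371, 185454805, 185454931, 185455183, 185455435,
  185455687, 185890009, 185890135, 185906137, 185906515, 185914327, 185914579, 185922265,
  185922517, 185922895, 185923021, 185938393, 185939275, 185946835, 185947087, 185947591,
  185955277, 185955655, 185962963, 185963467, 186413539, 186413791, 186414043, 186414295,
  186414421, 186414547, 186415303, 186429919, 186430171, 186430675, 186430927, 186431053,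
  186438550, 186438613, 186438991, 186439054, 186439117, 186439243, 186442582, 186442645,
  186443086, 186443149, 186446677, 186462931, 186463435, 186470869, 186471310, 186471751,
  186475342, 186475405, 186479059, 186479437, 186479563, 186487501, 186495691, 186495943,
  186512071, 186528199, 186938581, 186938707, 186954709, 186955087, 186962899, 186963151,
  186970837, 186971467, 186986965, 186987847, 186995407, 186995659, 187011535, 187012039,
  187462111, 187462363, 187463245, 187463623, 187478491, 187478743, 187478869, 187479499,
  187486933, 187487059, 187487437, 187487815, 187495123, 187511251, 187511629, 187512007,
  187519819, 187527883, 187528135, 187535821, 187544011, 187544263, 187986838, 187987342,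
  187987405, 187987531, 188003029, 188003155, 188003659, 188003911, 188011219, 188011975,
  188015062, 188015503, 188015566, 188016007, 188019535, 188019598, 188020039, 188035915,
  188043727, 188043979, 188044231, 188047822, 188048263, 188051917, 188052295, 188060359,
  188248918, 188248981, 188249422, 188249485, 188273110, 188273551, 188273614, 188274055,
  188277205, 188277583, 188277709, 188278087, 188281678, 188281741, 188305870, 188306311,
  188309965, 188310343, 188511565, 188511943, 188535694, 188535757, 188536135, 188539726,
  188539789, 188543821, 188568013, 189035725, 189035851, 189051853, 189052231, 189060043,
  189060295, 189067981, 189084109, 189092551, 189108679, 189560011, 189560263, 189576013,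
  189576139, 189576391, 189584077, 189584203, 189608647, 189624775, 190083982, 190100173,
  190100299, 190108363, 190112206, 190112647, 190116679, 190140871, 190346062, 190346125,
  190370254, 190370695, 190374349, 190374727, 190624459, 190640839, 190656967, 191656651,
  191672779, 191673031, 192721351, 193753543, 218952409, 218952661, 218953039, 218953291,
  218968537, 218968789, 218969041, 218969293, 218969545, 218969797, 218969923, 218984665,
  218984791, 218985043, 218985421, 218985547, 218985799, 219001045, 219001171, 219001423,
  219001549, 219001927, 219009487, 219009739, 219009991, 219476695, 219476947, 219477199,
  219477451, 219492823, 219493075, 219493327, 219493579, 219493831, 219509203, 219509959,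
  219984790, 219985294, 219992917, 219993421, 219996886, 219997075, 219997390, 219997579,
  220001107, 220001611, 220017550, 220025299, 220025551, 220025677, 220025803, 220026055,
  220029646, 220029835, 220033867, 220041679, 220041931, 220042183, 220525267, 220525771,
  220541395, 220541647, 220541899, 220542151, 220557775, 220558279, 221016982, 221017486,
  221033173, 221033299, 221033677, 221033803, 221041363, 221041867, 221045206, 221045647,
  221045710, 221046151, 221049679, 221049742, 221050183, 221065933, 221066059, 221073871,
  221074375, 221077966, 221078407, 221082439, 221090251, 221090503, 221541205, 221541709,
  221557459, 221557963, 221565397, 221565775, 221565901, 221566279, 221573839, 221573965,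
  221574343, 221589967, 221590471, 221598157, 221598535, 221606347, 221803222, 221803411,
  221803726, 221803915, 221819350, 221819791, 221819854, 221820295, 221831635, 221831887,
  221832139, 221832391, 221835982, 221836171, 221852110, 221852551, 221864395, 221864647,
  222081934, 222090061, 222094030, 222094219, 222098251, 222122443, 222122695, 222138823,
  222622411, 222638539, 222638791, 222654919, 223114126, 223130317, 223130443, 223138507,
  223142350, 223142791, 223146823, 223171015, 223638349, 223654603, 223662541, 223662919,
  223670983, 223687111, 223900366, 223900555, 223916494, 223916935, 223928779, 223929031,
  236761942, 236762005, 236762446, 236762509, 236770006, 236770195, 236770510, 236770699,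
  236774101, 236774227, 236774605, 236774731, 236794702, 236794765, 236802766, 236802955,
  236806861, 236806987, 237794134, 237794197, 237794638, 237794701, 237818326, 237818767,
  237818830, 237819271, 237822421, 237822799, 237822925, 237823303, 237826894, 237826957,
  237851086, 237851527, 237855181, 237855559, 238318294, 238318483, 238318798, 238318987,
  238334422, 238334863, 238334926, 238335367, 238346707, 238346959, 238347211, 238347463,
  238351054, 238351243, 238367182, 238367623, 238379467, 238379719, 238580437, 238580563,
  238580941, 238581067, 238596565, 238596943, 238597069, 238597447, 238604755, 238605007,
  238605259, 238605511, 238613197, 238613323, 238629325, 238629703, 238637515, 238637767,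
  238859086, 238859149, 238867150, 238867339, 238871245, 238871371, 239891278, 239891341,
  239915470, 239915911, 239919565, 239919943, 240415438, 240415627, 240431566, 240432007,
  240443851, 240444103, 240677581, 240677707, 240693709, 240694087, 240701899, 240702151,
  252458203, 252458329, 252458581, 252458707, 252466141, 252466393, 252466519, 252466645,
  252466771, 252467023, 252474583, 252474709, 252474835, 252482521, 252482773, 252482899,
  252483151, 252490459, 252490585, 252490963, 252498901, 252499279, 252499405, 252499531,
  252506461, 252506713, 252506965, 252507217, 252507343, 252507469, 252507721, 252507973,
  252515281, 252515533, 252515659, 252515785, 252515911, 252516037, 252516163, 252523345,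
  252523471, 252523723, 252523849, 252523975, 252524101, 252524227, 252531409, 252531661,
  252531913, 252532039, 252532165, 252532291, 252539095, 252539473, 252540103, 252540229,
  252547537, 252548041, 252548293, 252548419, 252555601, 252555853, 252555979, 252556483,
  252563665, 252564043, 252564295, 252564421, 252982237, 252983119, 252990427, 252991183,
  252998617, 252999247, 253006807, 253007311, 253014745, 253014871, 253014997, 253015375,
  253015501, 253015627, 253023187, 253023439, 253030621, 253030747, 253030873, 253030999,
  253031125, 253031251, 253031377, 253031503, 253031629, 253031755, 253031881, 253032007,
  253032133, 253032259, 253039567, 253047631, 253047757, 253055695, 253055947, 253063759,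
  253063885, 253064011, 253064137, 253071823, 253072327, 253079887, 253080517, 253087951,
  253088707, 253523533, 253523659, 253538779, 253539157, 253547851, 253548103, 253571917,
  253579981, 253596109, 253604299, 254047693, 254047819, 254063317, 254063443, 254063947,
  254064199, 254072011, 254072263, 254096203, 254104267, 254112205, 254120395, 254570971,
  254571349, 254595982, 254596045, 254596423, 254600014, 254600077, 254620363, 254628301,
  254636743, 254652871, 255095509, 255095635, 255112078, 255112141, 255112519, 255120205,
  255120331, 255120583, 255124174, 255124363, 255144397, 255152587, 255374158, 255374221,
  255382222, 255382411, 255386317, 255386443, 255636301, 256160461, 256160587, 256668493,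
  256684747, 257192653, 257192779, 257716939, 286061521, 286061773, 286061899, 286062025,
  286062151, 286062277, 286062403, 286094029, 286094155, 286110157, 286110535, 286118347,
  286118599, 286585807, 319582939, 319583065, 319599067, 319599445, 319607761, 319608013,
  319608265, 319608517, 319608643, 319615195, 319615321, 319615447, 319615573, 319615699,
  319615951, 319616077, 319632205, 319640269, 319648459, 319656397, 319664587, 319672525,
  319672651, 319672903, 320107225, 320107351, 320123353, 320123731, 320132047, 320132299,
  320132551, 320140111, 320140237, 320156491, 320164555, 320172871, 320180683, 320632141,
  320632519, 320647639, 320647891, 320648395, 320648647, 320656270, 320656333, 320656711,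
  320660302, 320660365, 320664397, 320680651, 320688589, 320697031, 321155797, 321155923,
  321171925, 321172303, 321180619, 321180871, 321188683, 321205063, 321213127, 321229255,
  321679831, 321680083, 321696589, 321696715, 321696967, 321704653, 321704779, 321712843,
  321729223, 322204117, 322204495, 322204558, 322204621, 322204999, 322228939, 322232782,
  322233223, 322236877, 322261447, 322466638, 322466701, 322490830, 322491271, 322494925,
  322495303, 323252941, 323253067, 323269069, 323269447, 323793355, 323793607, 324301261,
  324301639, 324825547, 324825799, 353153497, 353153749, 353154001, 353154253, 353154505,
  353154757, 353154883, 353169625, 353169751, 353169877, 353170003, 353170255, 353170507,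
  353202637, 353203015, 353218765, 353218891, 353219143, 353227207, 353677783, 353678035,
  353678287, 353678539, 353678791, 353694415, 353694667, 353726923, 353727175, 354185941,
  354186067, 354186445, 354186571, 354202069, 354202447, 354202510, 354202573, 354202951,
  354210637, 354214606, 354214795, 354218701, 354234829, 354235207, 354243019, 354243271,
  354259399, 354726355, 354726607, 354726859, 354727111, 354742987, 354775495, 355234261,
  355234639, 355234702, 355234765, 355235143, 355259083, 355262926, 355263367, 355267021,
  355291591, 355758547, 355758799, 355758925, 355759051, 355759303, 355775179, 355783117,
  355783495, 355791307, 355807687, 356020942, 356021131, 356037070, 356037511, 356049355,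
  356049607, 356283085, 356283211, 356299213, 356299591, 356823499, 356823751, 357331405,
  357331783, 357855691, 357855943, 370979662, 370979725, 370987726, 370987915, 370991821,
  370991947, 372011854, 372011917, 372036046, 372036487, 372040141, 372040519, 372536014,
  372536203, 372552142, 372552583, 372564427, 372564679, 372798157, 372798283, 372814285,
  372814663, 372822475, 372822727, 386675419, 386675545, 386675671, 386676175, 386676301,
  386676427, 386683609, 386683735, 386684365, 386684491, 386691547, 386691799, 386692429,
  386692555, 386699989, 386700115, 386700241, 386700745, 386700871, 386700997, 386701123,
  386708179, 386708305, 386708809, 386708935, 386709061, 386709187, 386716369, 386716495,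
  386716621, 386716873, 386717125, 386717251, 386724181, 386724307, 386724811, 386724937,
  386725315, 386732749, 386732875, 386740939, 386749255, 386756815, 386756941, 386757067,
  386757193, 386757319, 386757445, 386757571, 386765257, 386765509, 386765635, 386773321,
  386773699, 386781385, 386781511, 387215833, 387216211, 387216715, 387216967, 387224527,
  387232717, 387233095, 387240907, 387241159, 387248719, 387248845, 387249097, 387265351,
  387273415, 387289543, 387740875, 387741127, 387756499, 387756751, 387756877, 387773131,
  387789511, 388264405, 388264783, 388264909, 388265287, 388297165, 388297543, 388788691,
  388788943, 388789069, 388789195, 388789447, 388805323, 389329357, 389329735, 390361549,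
  390361927, 390902215, 391934407, 420245977, 420246229, 420246481, 420246733, 420246985,
  420247237, 420247363, 420278485, 420278611, 420278863, 420279115, 420279367, 420311245,
  420311371, 420311623, 420770263, 420770515, 420770767, 420771019, 420771271, 420803023,
  420803275, 420803527, 420835783, 421294549, 421294927, 421295053, 421295431, 421311181,
  421311307, 421327309, 421327687, 421818835, 421819087, 421819339, 421819591, 421851595,
  421851847, 422343373, 422343499, 422359501, 422359879, 422883787, 422884039, 423391693,
  423392071, 423915979, 423916231, 453784027, 453784405, 453784909, 453785287, 453792217,
  453792595, 453792721, 453793099, 453793225, 453793477, 453793603, 453800407, 453800785,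
  453801289, 453801415, 453801541, 453801667, 453808597, 453808975, 453809101, 453809479,
  453816787, 453817165, 453817291, 453824977, 453825355, 453825481, 453825733, 453825859,
  453832915, 453833545, 453833671, 453833797, 453841357, 453841735, 453849547, 453857737,
  453857989, 453858115, 453865675, 453865927, 453866053, 453882055, 453882181, 453882307,
  453890245, 454317007, 454357327, 454357957, 454848979, 454849231, 454849483, 454849735,
  454881991, 454898119, 456946123, 456946375, 456962503, 457994695, 487338457, 487338709,
  487338961, 487339213, 487339465, 487339717, 487339843, 487346647, 487346899, 487347403,
  487347655, 487354837, 487355089, 487355341, 487355593, 487355845, 487355971, 487363027,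
  487363279, 487363531, 487363783, 487371217, 487371469, 487371721, 487371973, 487372099,
  487379407, 487379659, 487379911, 487387471, 487387597, 487387849, 487388227, 487395787,
  487396039, 487403977, 487404229, 487404355, 487412167, 487420357, 487420483, 487436611,
  487444675, 487863247, 487911631, 487912387, 521974219, 521974471, 523022791, 589066699,
  589066951, 589083079, 590115271, 656175559]

def thOk (r : ℕ) : Bool :=
  allLt 40 (unp 5 r) && Nat.beq (sumL (unp 5 r)) 67 && !(Nat.beq (cmpW Om6 (unp 5 r)) 1)

def eqS (l : List ℕ) : List (List ℕ) → Bool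
  | [a] => eqL a l
  | _ => false

theorem th_ok : allB thOk thL = true := by decide +kernel

theorem th_sq : eqS thL (xall 30000 11 (thL.map fun r => exL (unp 5 r))) = true := by
  decide +kernel

theorem th_sum (F : ℕ → ZMod 2) :
    (thL.map fun r => ((exL (unp 5 r)).map F).sum).sum = (thL.map F).sum := by
  have h := th_sq
  have h2 := xall_sum F 30000 11 (thL.map fun r => exL (unp 5 r))
  generalize xall 30000 11 (thL.map fun r => exL (unp 5 r)) = z at h h2
  unfold eqS at h
  split at h
  · have := eqL_eq _ _ h
    subst this
    rw [List.map_map] at h2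
    have e : (fun r => ((exL (unp 5 r)).map F).sum) =
        (fun a => (List.map F a).sum) ∘ fun r => exL (unp 5 r) := rfl
    rw [e, ← h2]
    simp
  · cases h

theorem okL_iff {s : List ℕ} (hs : s.length = 5) (v : Vn 5) : okL s (List.ofFn v) = true ↔
    ∀ i, v i ≤ ve s i ∧ (ve s i - v i) &&& v i = ve s i - v i := by
  obtain ⟨a, b, c, d, e, rfl⟩ := len5 hs
  simp [okL, okO, ve, Fin.forall_fin_succ, Nat.beq_eq, Nat.ble_eq]

theorem th_count {s : List ℕ} (hs : s.length = 5) (v : Vn 5) {j : ℕ} (hj : sz v + j = sz (ve s)) :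
    (∑ b ∈ Bset v j, if ve s = v + b then (1 : ZMod 2) else 0) =
      if okL s (List.ofFn v) then 1 else 0 := by
  have h : ∀ b, ve s = v + b → b = fun i => ve s i - v i := by
    intro b hb
    funext i
    have := congrFun hb i
    simp only [Pi.add_apply] at this
    omega
  by_cases ho : okL s (List.ofFn v) = true
  · rw [if_pos ho]
    rw [okL_iff hs] at ho
    have e : ve s = v + fun i => ve s i - v i := by
      funext i
      simp only [Pi.add_apply]
      have := (ho i).1
      omega
    rw [Finset.sum_eq_single (fun i => ve s i - v i), if_pos e]
    · intro b _ hb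
      rw [if_neg]
      exact fun h' => hb (h b h')
    · intro hno
      refine absurd (mem_Bset.2 ⟨fun i => (ho i).2, ?_⟩) hno
      have e2 := congrArg sz e
      rw [sz_add] at e2
      omega
  · rw [if_neg ho]
    apply Finset.sum_eq_zero
    intro b hb
    rw [if_neg]
    intro h'
    apply ho
    rw [okL_iff hs]
    intro i
    have hb := (mem_Bset.1 hb).1 i
    have := congrFun h' i
    simp only [Pi.add_apply] at this
    rw [this]
    simpa using hb

/-- the functional -/
def thF : P 5 →ₗ[ZMod 2] ZMod 2 :=
  (thL.map fun r => lcoeff (ZMod 2) (Finsupp.equivFunOnFinite.symm (ve (unp 5 r)))).sum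

theorem thF_mv (v : Vn 5) :
    thF (mv v) = (thL.map fun r => if ve (unp 5 r) = v then (1 : ZMod 2) else 0).sum := by
  unfold thF
  have : ∀ l : List (P 5 →ₗ[ZMod 2] ZMod 2), l.sum (mv v) = (l.map fun g => g (mv v)).sum := by
    intro l
    induction l with
    | nil => simp
    | cons a l ih => simp [ih]
  rw [this, List.map_map]
  congr 1
  apply List.map_congr_left
  intro r _
  simp only [Function.comp_apply, lcoeff_apply, mv, coeff_monomial]
  congr 1
  simp only [EmbeddingLike.apply_eq_iff_eq, eq_iff_iff]
  exact eq_comm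

theorem thOk_spec {r : ℕ} (h : r ∈ thL) : (∀ x ∈ unp 5 r, x < 40) ∧ sz (ve (unp 5 r)) = 67 ∧
    ¬ has Om6 (ve (unp 5 r)) := by
  have h := allB_spec th_ok r h
  have hl := unp_len 5 r
  unfold thOk at h
  simp only [Bool.and_eq_true] at h
  refine ⟨?_, ?_, ?_⟩
  · have h3 := allLt_spec hl h.1.1
    intro x hx
    obtain ⟨i, hi, rfl⟩ := List.getElem_of_mem hx
    have := h3 ⟨i, by omega⟩
    unfold ve at this
    rwa [List.getD_eq_getElem _ _ hi] at this
  · rw [sz_ve hl]; exact Nat.eq_of_beq_eq_true h.1.2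
  · intro h4
    have := ((cmpW_spec Om6 _ hl).2).2 h4
    rw [this] at h
    simp at h

theorem list_sum_comm {α β : Type*} (l : List α) (S : Finset β) (F : α → β → ZMod 2) :
    ∑ b ∈ S, (l.map fun a => F a b).sum = (l.map fun a => ∑ b ∈ S, F a b).sum := by
  induction l with
  | nil => simp
  | cons a l ih => simp [Finset.sum_add_distrib, ih]

theorem unp_ofFn (r : ℕ) (v : Vn 5) : unp 5 r = List.ofFn v ↔ ve (unp 5 r) = v := by
  constructor
  · intro h; rw [h, ve_ofFn]
  · rintro rfl; rw [ofFn_ve (unp_len 5 r)]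

theorem thF_hit {u : P 5} (hu : IsHit 5 67 u) : thF u = 0 := by
  apply hit_zero thF _ hu
  intro f j hj hs
  simp only [thF_mv]
  rw [list_sum_comm]
  have e1 : (thL.map fun r => ∑ b ∈ Bset f j, if ve (unp 5 r) = f + b then (1 : ZMod 2) else 0) =
      thL.map fun r => ((exL (unp 5 r)).map fun t => if ve (unp 5 t) = f then (1 : ZMod 2) else 0).sum := by
    apply List.map_congr_left
    intro r hr
    obtain ⟨h1, h2, -⟩ := thOk_spec hr
    rw [th_count (unp_len 5 r) f (by omega), ← exL_sum _ _ (by simp [unp_len]) h1, unp_len]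
    simp only [unp_ofFn]
  rw [e1, th_sum]
  apply List.sum_eq_zero
  intro x hx
  obtain ⟨r, hr, rfl⟩ := List.mem_map.1 hx
  obtain ⟨-, h2, -⟩ := thOk_spec hr
  rw [if_neg]
  rintro rfl
  omega

theorem thF_seed {v : Vn 5} (hv : has Om6 v) : thF (mv v) = 0 := by
  rw [thF_mv]
  apply List.sum_eq_zero
  intro x hx
  obtain ⟨r, hr, rfl⟩ := List.mem_map.1 hx
  obtain ⟨-, -, h2⟩ := thOk_spec hr
  rw [if_neg]
  rintro rfl
  exact h2 hv

def cntN (k : ℕ) : Bool → List ℕ → Bool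
  | c, [] => c
  | c, a :: l => bif Nat.beq a k then cntN k (!c) l else cntN k c l

theorem cntN_sum (F : ℕ → Prop) [DecidablePred F] (k : ℕ) : ∀ (l : List ℕ) (c : Bool),
    (∀ a ∈ l, F a ↔ a = k) → (if c then (1 : ZMod 2) else 0) +
    (l.map fun a => if F a then (1 : ZMod 2) else 0).sum = if cntN k c l then 1 else 0 := by
  intro l
  induction l with
  | nil => intro c _; cases c <;> simp [cntN]
  | cons a l ih =>
    intro c h
    have h1 := h a (by simp)
    have h3 := fun b hb => h b (List.mem_cons_of_mem a hb)
    rw [cntN]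
    by_cases h2 : a = k
    · subst h2
      rw [Nat.beq_refl, cond_true, ← ih (!c) h3]
      simp only [List.map_cons, List.sum_cons, h1, if_true]
      cases c
      · simp
      · simp only [if_true, Bool.not_true, Bool.false_eq_true, if_false]
        linear_combination zm2 1
    · have : Nat.beq a k = false := by
        rw [← Bool.not_eq_true, Nat.beq_eq]; exact h2
      rw [this, cond_false, ← ih c h3]
      simp [h1, h2]

theorem th_b0 : (cntN (pack b0L) false thL && allB (fun a => Nat.beq (pack (unp 5 a)) a) thL) = true := by
  decide +kernel

theorem thF_b0 : thF (mv (ve b0L)) = 1 := by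
  have h := th_b0
  rw [Bool.and_eq_true] at h
  have h4 := cntN_sum (fun r => ve (unp 5 r) = ve b0L) (pack b0L) thL false ?_
  · rw [if_pos h.1] at h4
    rw [thF_mv]
    simpa only [Bool.false_eq_true, if_false, zero_add] using h4
  intro a ha
  have h1 := Nat.eq_of_beq_eq_true (allB_spec h.2 a ha)
  constructor
  · intro h2
    rw [← h1]
    congr 1
    have := congrArg List.ofFn h2
    rwa [ofFn_ve (unp_len 5 a), ofFn_ve (t := b0L) rfl] at this
  · rintro rfl
    rfl

/-! ### Functionals from linear substitutions `P 5 → P 3` -/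

/-- `ψ (SqT f) = SqT (ψ f)` for linear substitutions -/
theorem lin_SqT {n m : ℕ} (c : Fin n → Fin m → ZMod 2) (p : P n) :
    aeval (fun i => ∑ j, C (c i j) * (X j : P m)) (SqT n p) =
      SqT m (aeval (fun i => ∑ j, C (c i j) * (X j : P m)) p) := by
  unfold SqT
  rw [← AlgHom.comp_apply, ← AlgHom.comp_apply]
  congr 1
  ext1 i
  simp only [AlgHom.comp_apply, aeval_X, map_add, map_pow, map_sum, map_mul]
  have : (∑ j, C (c i j) * (X j : P m)) ^ 2 = ∑ j, C (c i j) * (X j : P m) ^ 2 := by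
    rw [sum_pow_char]
    apply Finset.sum_congr rfl
    intro j _
    rw [mul_pow, ← C_pow]
    congr 2
    generalize c i j = d
    revert d
    decide
  rw [this, ← Finset.sum_add_distrib]
  apply Finset.sum_congr rfl
  intro j _
  rw [← algebraMap_eq, AlgHom.commutes]
  ring

theorem lin_hom {n m : ℕ} (c : Fin n → Fin m → ZMod 2) {d : ℕ} {p : P n}
    (hp : p ∈ homogeneousSubmodule (Fin n) (ZMod 2) d) :
    aeval (fun i => ∑ j, C (c i j) * (X j : P m)) p ∈ homogeneousSubmodule (Fin m) (ZMod 2) d := by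
  rw [mem_homogeneousSubmodule] at hp ⊢
  have := hp.aeval (fun i => ∑ j, C (c i j) * (X j : P m)) (n := 1) (by
    intro i
    apply IsHomogeneous.sum
    intro j _
    exact isHomogeneous_C_mul_X _ _)
  simpa using this

theorem lin_hc {n m : ℕ} (c : Fin n → Fin m → ZMod 2) (d : ℕ) (p : P n) :
    aeval (fun i => ∑ j, C (c i j) * (X j : P m)) (homogeneousComponent d p) =
      homogeneousComponent d (aeval (fun i => ∑ j, C (c i j) * (X j : P m)) p) := by
  rw [as_mv p]
  simp only [map_sum]
  apply Finset.sum_congr rfl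
  intro a _
  rw [homogeneousComponent_of_mem (mv_hom _), homogeneousComponent_of_mem (lin_hom c (mv_hom _))]
  split <;> simp

theorem lin_hit {n m : ℕ} (c : Fin n → Fin m → ZMod 2) {d : ℕ} {u : P n} (hu : IsHit n d u) :
    IsHit m d (aeval (fun i => ∑ j, C (c i j) * (X j : P m)) u) := by
  obtain ⟨f, hf, rfl⟩ := hu
  refine ⟨fun i => aeval (fun i => ∑ j, C (c i j) * (X j : P m)) (f i),
    fun i => lin_hom c (hf i), ?_⟩
  simp only [map_sum]
  exact Finset.sum_congr rfl fun i _ => by rw [lin_hc, lin_SqT]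

def e3 (x y z : ℕ) : Fin 3 →₀ ℕ := Finsupp.equivFunOnFinite.symm ![x, y, z]

theorem spike_aux : ∀ c ∈ [63, 3, 1], ∀ f < 64, ∀ b < 64, f + b = c → b &&& f = b → b = 0 := by
  decide +kernel

theorem spike_zero {u : P 3} (hu : IsHit 3 67 u) : coeff (e3 63 3 1) u = 0 := by
  apply hit_zero (lcoeff (ZMod 2) (e3 63 3 1)) _ hu
  intro f j hj _
  apply Finset.sum_eq_zero
  intro b hb
  obtain ⟨h1, h2⟩ := mem_Bset.1 hb
  rw [lcoeff_apply, mv, coeff_monomial, if_neg]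
  intro h
  have h := Finsupp.equivFunOnFinite.symm.injective h
  have h0 := congrFun h 0
  have h1' := congrFun h 1
  have h2' := congrFun h 2
  simp only [Pi.add_apply] at h0 h1' h2'
  have e0 : f 0 + b 0 = 63 := h0
  have e1 : f 1 + b 1 = 3 := h1'
  have e2 : f 2 + b 2 = 1 := h2'
  have a0 := spike_aux 63 (by simp) (f 0) (by omega) (b 0) (by omega) e0 (h1 0)
  have a1 := spike_aux 3 (by simp) (f 1) (by omega) (b 1) (by omega) e1 (h1 1)
  have a2 := spike_aux 1 (by simp) (f 2) (by omega) (b 2) (by omega) e2 (h1 2)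
  unfold sz at h2
  rw [Fin.sum_univ_three, a0, a1, a2] at h2
  omega

/-! ### Bit-parallel evaluation -/

def bt (N g : ℕ) : ZMod 2 := if N.testBit g then 1 else 0

theorem bt_xor (a b g : ℕ) : bt (a ^^^ b) g = bt a g + bt b g := by
  unfold bt
  rw [Nat.testBit_xor]
  cases a.testBit g <;> cases b.testBit g <;> simp [zm2]

theorem bt_and (a b g : ℕ) : bt (a &&& b) g = bt a g * bt b g := by
  unfold bt
  rw [Nat.testBit_and]
  cases a.testBit g <;> cases b.testBit g <;> simp

theorem bt_zero (g : ℕ) : bt 0 g = 0 := by simp [bt]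

def fullM : ℕ := 115792089237316195423570985008687907853269984665640564039457584007913129639935

theorem bt_full {g : ℕ} (hg : g < 256) : bt fullM g = 1 := by
  have : fullM = 2 ^ 256 - 1 := by norm_num [fullM]
  unfold bt
  rw [this, Nat.testBit_two_pow_sub_one]
  simp [hg]

def oddR (K : ℕ → ℕ → ℕ → ℕ) : List (ℕ × ℕ × ℕ) → List ℕ → ℕ → ℕ → ℕ → ℕ
  | m :: ms, a :: l, x, y, z =>
    bif Nat.beq (a % 2) 1 then
      (bif Nat.beq x 0 then 0 else m.1 &&& oddR K ms l (x - 1) y z) ^^^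
      ((bif Nat.beq y 0 then 0 else m.2.1 &&& oddR K ms l x (y - 1) z) ^^^
       (bif Nat.beq z 0 then 0 else m.2.2 &&& oddR K ms l x y (z - 1)))
    else oddR K ms l x y z
  | _, _, x, y, z => K x y z

def lev (ms : List (ℕ × ℕ × ℕ)) : ℕ → List ℕ → ℕ → ℕ → ℕ → ℕ
  | 0, _, x, y, z => bif Nat.beq (x + y + z) 0 then fullM else 0
  | k + 1, l, x, y, z => oddR (fun x y z =>
      bif Nat.beq (x % 2 + y % 2 + z % 2) 0 then lev ms k (halfL l) (x / 2) (y / 2) (z / 2) else 0)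
      ms l x y z

/-- the linear form -/
def ell (g : ℕ) (m : ℕ × ℕ × ℕ) : P 3 := C (bt m.1 g) * X 0 + C (bt m.2.1 g) * X 1 + C (bt m.2.2 g) * X 2

def oddP (g : ℕ) : List (ℕ × ℕ × ℕ) → List ℕ → P 3
  | m :: ms, a :: l => ell g m ^ (a % 2) * oddP g ms l
  | _, _ => 1

def prodP (g : ℕ) : List (ℕ × ℕ × ℕ) → List ℕ → P 3
  | m :: ms, a :: l => ell g m ^ a * prodP g ms l
  | _, _ => 1

theorem prodP_half (g : ℕ) : ∀ (ms : List (ℕ × ℕ × ℕ)) (l : List ℕ),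
    prodP g ms l = oddP g ms l * prodP g ms (halfL l) ^ 2 := by
  intro ms
  induction ms with
  | nil => intro l; simp [prodP, oddP]
  | cons m ms ih =>
    intro l
    cases l with
    | nil => simp [prodP, oddP, halfL]
    | cons a l =>
      have e : ell g m ^ a = ell g m ^ (a % 2) * (ell g m ^ (a / 2)) ^ 2 := by
        rw [← pow_mul, ← pow_add]; congr 1; omega
      have := ih l
      simp only [halfL] at this
      simp only [prodP, oddP, halfL, List.map_cons]
      rw [this, e]
      ring

theorem prodP_zero (g : ℕ) : ∀ (ms : List (ℕ × ℕ × ℕ)) (l : List ℕ), (∀ a ∈ l, a < 1) →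
    prodP g ms l = 1 := by
  intro ms
  induction ms with
  | nil => intro l _; simp [prodP]
  | cons m ms ih =>
    intro l h
    cases l with
    | nil => simp [prodP]
    | cons a l =>
      have : a = 0 := by have := h a (by simp); omega
      rw [prodP, ih l (fun b hb => h b (by simp [hb])), this]
      simp

theorem coeff_sq (q : P 3) (x y z : ℕ) : coeff (e3 x y z) (q ^ 2) =
    if x % 2 + y % 2 + z % 2 = 0 then coeff (e3 (x / 2) (y / 2) (z / 2)) q else 0 := by
  rw [← expand_zmod]
  split
  · rename_i h
    have : e3 x y z = 2 • e3 (x / 2) (y / 2) (z / 2) := by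
      ext i
      fin_cases i
      · change x = 2 * (x / 2); omega
      · change y = 2 * (y / 2); omega
      · change z = 2 * (z / 2); omega
    rw [this, coeff_expand_smul _ (by norm_num)]
  · rename_i h
    by_cases hx : x % 2 = 0
    · by_cases hy : y % 2 = 0
      · refine coeff_expand_of_not_dvd (p := 2) (i := 2) _ ?_
        change ¬ 2 ∣ z
        omega
      · refine coeff_expand_of_not_dvd (p := 2) (i := 1) _ ?_
        change ¬ 2 ∣ y
        omega
    · refine coeff_expand_of_not_dvd (p := 2) (i := 0) _ ?_
      change ¬ 2 ∣ x
      omega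

theorem coeff_ell (g : ℕ) (m : ℕ × ℕ × ℕ) (q : P 3) (x y z : ℕ) : coeff (e3 x y z) (ell g m * q) =
    bt m.1 g * (if x = 0 then 0 else coeff (e3 (x - 1) y z) q) +
    bt m.2.1 g * (if y = 0 then 0 else coeff (e3 x (y - 1) z) q) +
    bt m.2.2 g * (if z = 0 then 0 else coeff (e3 x y (z - 1)) q) := by
  have h0 : coeff (e3 x y z) (X 0 * q) = if x = 0 then 0 else coeff (e3 (x - 1) y z) q := by
    rw [coeff_X_mul']
    have e : e3 x y z - Finsupp.single 0 1 = e3 (x - 1) y z := by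
      ext i; fin_cases i <;> simp [e3]
    rw [e]
    by_cases hx : x = 0 <;> simp [e3, hx]
  have h1 : coeff (e3 x y z) (X 1 * q) = if y = 0 then 0 else coeff (e3 x (y - 1) z) q := by
    rw [coeff_X_mul']
    have e : e3 x y z - Finsupp.single 1 1 = e3 x (y - 1) z := by
      ext i; fin_cases i <;> simp [e3]
    rw [e]
    by_cases hx : y = 0 <;> simp [e3, hx]
  have h2 : coeff (e3 x y z) (X 2 * q) = if z = 0 then 0 else coeff (e3 x y (z - 1)) q := by
    rw [coeff_X_mul']
    have e : e3 x y z - Finsupp.single 2 1 = e3 x y (z - 1) := by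
      ext i; fin_cases i <;> simp [e3]
    rw [e]
    by_cases hx : z = 0 <;> simp [e3, hx]
  unfold ell
  rw [add_mul, add_mul, coeff_add, coeff_add, mul_assoc, mul_assoc, mul_assoc, coeff_C_mul,
    coeff_C_mul, coeff_C_mul, h0, h1, h2]

theorem bt_cond (n a g : ℕ) : bt (bif Nat.beq n 0 then 0 else a) g = if n = 0 then 0 else bt a g := by
  cases n with
  | zero => simp [bt_zero]
  | succ n => rfl

theorem bt_cond' (n a g : ℕ) : bt (bif Nat.beq n 0 then a else 0) g = if n = 0 then bt a g else 0 := by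
  cases n with
  | zero => simp
  | succ n => exact bt_zero g

theorem oddR_spec (g : ℕ) (K : ℕ → ℕ → ℕ → ℕ) (Q : P 3)
    (hK : ∀ x y z, bt (K x y z) g = coeff (e3 x y z) Q) :
    ∀ (ms : List (ℕ × ℕ × ℕ)) (l : List ℕ) (x y z : ℕ),
      bt (oddR K ms l x y z) g = coeff (e3 x y z) (oddP g ms l * Q) := by
  intro ms
  induction ms with
  | nil => intro l x y z; simp [oddR, oddP, hK]
  | cons m ms ih =>
    intro l x y z
    cases l with
    | nil => simp [oddR, oddP, hK]
    | cons a l =>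
      rw [oddR, oddP]
      rcases Nat.mod_two_eq_zero_or_one a with h | h
      · rw [h, pow_zero, one_mul, ← ih l x y z]
        rfl
      · rw [h, pow_one, mul_assoc, coeff_ell, Nat.beq_refl, cond_true, bt_xor, bt_xor, bt_cond,
          bt_cond, bt_cond, bt_and, bt_and, bt_and, ih, ih, ih]
        simp only [mul_ite, mul_zero]
        ring

theorem lev_spec {g : ℕ} (hg : g < 256) (ms : List (ℕ × ℕ × ℕ)) : ∀ (k : ℕ) (l : List ℕ)
    (x y z : ℕ), (∀ a ∈ l, a < 2 ^ k) → bt (lev ms k l x y z) g = coeff (e3 x y z) (prodP g ms l) := by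
  intro k
  induction k with
  | zero =>
    intro l x y z h
    rw [prodP_zero g ms l (by simpa using h), lev, bt_cond', bt_full hg, coeff_one]
    congr 1
    rw [eq_iff_iff]
    constructor
    · intro h
      ext i
      fin_cases i
      · change 0 = x; omega
      · change 0 = y; omega
      · change 0 = z; omega
    · intro h
      have h0 : 0 = x := DFunLike.congr_fun h 0
      have h1 : 0 = y := DFunLike.congr_fun h 1
      have h2 : 0 = z := DFunLike.congr_fun h 2
      omega
  | succ k ih =>
    intro l x y z h
    rw [lev, prodP_half]
    apply oddR_spec
    intro x y z
    rw [bt_cond', coeff_sq, ih]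
    intro a ha
    obtain ⟨b, hb, rfl⟩ := List.mem_map.1 ha
    have := h b hb
    rw [pow_succ] at this
    omega

/-! ### parity -/

def par : ℕ → ℕ → Bool
  | 0, N => N.testBit 0
  | _ + 1, 0 => false
  | k + 1, N + 1 => par k ((N + 1) ^^^ ((N + 1) >>> 2 ^ k))

theorem par_spec (k : ℕ) : ∀ N, ∑ g ∈ Finset.range (2 ^ k), bt N g = if par k N then 1 else 0 := by
  induction k with
  | zero => intro N; rw [pow_zero, Finset.sum_range_one]; rfl
  | succ k ih =>
    intro N
    cases N with
    | zero => simp [par, bt_zero]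
    | succ N =>
      rw [par, ← ih, pow_succ, mul_two, Finset.sum_range_add, ← Finset.sum_add_distrib]
      apply Finset.sum_congr rfl
      intro g _
      rw [bt_xor]
      congr 1
      unfold bt
      rw [Nat.testBit_shiftRight]

/-- the coefficients of 160 linear substitutions, one per bit -/
def mskL : List (ℕ × ℕ × ℕ) := [
  (1428986691702614682321160456852977812493864378314,
   997563719960401221947916828688152627924735816086,
   545917566593033972130892482345543809970779148415),
  (1461320093965890362664417394351986302018040853941,
   1042157411487180275643428062474758377524837702698,
   577605801617545105847670323809999955562254867429),
  (1461306461571999472309447589290031082432959520463,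
   431675496771589326111957745356206454629264520119,
   916433499429994155025845215812190412537613283304),
  (1362618640341734945240810273134274900157777574803,
   1195307092211283689616643469046951066099592676844,
   863732002221584262272001052903007303676841696514),
  (319612880867827515062740336703137980466376432243,
   387848232681783775454703551581608066857725308855,
   1079207427174018734516211856405331606100523781435)]

def dualL : List ℕ := [
  426437572535069681891868063362112302450037911681, 426437572535064489595009528534483771953708691585,
  888504838481681050093441565304371466327442045441, 91745267107884451295539229053000812438700952064,
  836644217793974476106416022565931673404424864141, 825133191429692526047395654525980829888574128386,
  859836753329576299154373944921130830424818330568, 733789339096505820233165985195263668024208523522,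
  1003470231969124825015708962769625389910969427633, 23059079428483470542637424373549576177373462535,
  820447941198867473271417907602574780699408120564, 1113917560231262129721357999024626753993207533745,
  1145366299279509573872278810366115786754216954368, 1113733622638187992816991985199711809705161609649,
  998385931559474096379144453922316491901537107537, 205635176984771692801627508823332951315949319345,
  224427194511897878785032524686350646143692937616, 6067568206718617660351861212160198181201903740,
  22835963125841406184345918568091855572466689073, 23193233795018765096017257747826536572262572037,
  11510677872789233798837671041214704219384187554, 1743607051264184734893918637798597317379149,
  777943743115763267682765772558544952311308954136, 195938453571564429534790090426486053831535793733,
  58806081068883123830776545056111080303599069850, 47190836454221004955083794400839577450324164744,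
  11705852270516156462512565781896772494287719042, 15008601610627143354113807274603317302730557952,
  112383053597468515088992513460707731445940866, 12157918408577031103040866242288463237638785536,
  47190486643947808962712096069534584909911294088, 401850336319613064948156002471643714306457605,
  11510677872789233759223589793314905862628706946, 797160636338080321178685110567199937941425355268,
  178405961588244985132288107365555326288920576, 3256017689510355078997311203866088433157029895,
  3256367499783549803737749781498635362946400261, 401850336319613064948155984024899640596905989,
  194284966020034116655275146717582101425265053698, 787859550805708278554012697849819380649534006282,
  11510677872794426056082124611702049924130540162, 11512071669379718818697300427254266821191143050,
  11510677872794426061033884787290315097436588678, 18463451646411667115039730346749389666055690753,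
  1361129467683831225696826037116000537088, 6300353207179653407106207490693101330225296255,
  6121947245591408421973921744511913338665825151, 104231510488044254105768175381375775012362454905,
  110508863329311210713449731486901856446617255494, 309485012127469552915218440,
  108900422039404370310203297368972278583669841956, 190437607677810170261113933387827585681271944063,
  182710005459424386516772330807412134120412714530, 184137253109667527188048379490222167667521912832,
  1298074215106091129372178280087552, 7727602303475948000626993863458008041124095261,
  7549196341887703015185204216836621997652141341, 18014398509481984,
  3256259034611949110816051111130349564253446144, 2305843009213693960,
  1101878780509637822942329977569651545184945670789, 1285016423881778011337607209461677636572966866572,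
  738313646465079121766213626480331644575711260484, 1141798154186284788099004337868460901363574112256,
  1329228312697570652327640304101359872, 959641924635669733110153411809948898195397534729,
  1285194826438502013813796547447094610945621913476, 681935501797112754663989068940095528960,
  228891106640439952191388180985429056827562214413, 89208436028895211272221261749033608222343296,
  47517754913397019215455208677068985286751503553, 47517754232541517066103456310242962580709655745,
  184137255832679350036820738444738606960728866884, 184315659071255772173180665239015442626912452672,
  309485157395297658401193992, 35184372088836,
  9007199254740992, 147573952589676412928,
  309485009821345068724781056, 184315659753108525225149638658462781667515048268,
  188979390675597318122460915844745710612605062920, 110330457367722965728317445740720668457339485764,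
  7721764760842987182639052846083818396455351564, 182710355439838521312998888036327473491939963936,
  1113676916556393095220000832134015886425895997793, 182710005459424386516694788369027396600751723616,
  33554432, 1376280255646114634196876167832083015365428838689,
  103185722264157353869054549341236836831270092800, 285489436654695064012051296437274998738102849600,
  178405961588244985132285746487431941586944000, 184137253109667527188048379490077771013059248192,
  7551982573908051658705376313559825521160054621, 190248007149542632023591603436974312052598506533,
  184539016461047359550722115055602356862899467296, 11194609307292405577727958446912540504056112,
  6110753997329383811884803352098347715298328613, 681935824731083786931002810588700082432,
  184137255832596592735035438568915056614839427136, 183219180471938464415019764876088224648945288201,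
  1427247692711152177916821092225952802297348160, 2788275085316857412874854152372294481095168,
  16725560269664656159936462333021252560683008, 182803393190904291069795972412340053535634257496,
  13246645626068113281061809571793903423762472960, 1361129467683754307790976595606078750720,
  184137255832513521055901282239778461644538249284, 184539105147798781081972227557508438127317893185,
  184137253109667527188048379490077771004469313536, 2788273722338620086592701711264296581728768,
  182710005459424386516694788369027396600751723552, 184137255832513191466745222900131785517517766720,
  681935500529442811617889750695117070336, 5192296858534827628535031814684672,
  1375961243665569787492575441186193424, 680569936637706953828369640817892548624,
  5192296858534827628534894375731200, 12676507362323841081424853614592,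
  680569926138735501894492855249944969216, 178405961588244985132927988022857438674821120,
  1370766370653236995266425654740000768, 1370766370653803679208341215684132864,
  178405961588257661639496954330845560693145600, 12676507211208149658393230524416,
  680569926138735499533309612715610734592, 10141360904373481902367014150160,
  680569926178349590244398123686574424064, 41548516229182994510146337647910928,
  41548516074289372683079369594265616, 337195059660709020806919145652256,
  37778931862957161709568, 36028797018963968,
  8192, 8796629893120,
  151115727451828646838272, 8796093022208,
  3256259034611949110816051111130349581433315328, 32,
  170005193383307227693056, 327053856067809005200778601717808,
  349810460130088153866431217691399275167749, 26091872307820720802471312743960318316843892756,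
  6065824557142406709999922625434392739884318769, 3256259034611949110816051111130349529893707776,
  2854495725694289297584398373001241891117727744, 2535301200456458802993410605056,
  26404104093318676340737865715704799978434084868, 6065824557142406709999922588540904592464953393,
  713973997095464273115301182120954884053270528, 186922686907253794629349667666657284,
  6824028456103329332483009710948971920412901377, 6824378266376524057223449469749601419428626433,
  12676506172287487398274259763200, 349810273194724740440385996683456122454020,
  401763308917662190076357570579049029958639616, 324518553658463622523103254683652,
  401413498644467465335917221482609120697655296, 4,
  1048576, 324518553658426726783156020584448]

def imgL : List ℕ := [
  205897534712799111549352362850369220466270863360, 40480032909646431405077407054003420321616896,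
  274033130507744478839202749642810089763189560320, 182711592531056172782465750211833065711203259392,
  274033130507744478839280196453777670291169743874, 23710917862590246215036728397344140668441600,
  274031731224116404075201127124470084862593732610, 170141203745405490346352304837311332352,
  25712792051819073850977130527833622878730981376, 11059841802622080078960241648327970527232,
  391088195779854898325093451722780719108308734080, 39037363274617194800895542364355781395550208,
  22311805040312962734638593220454997938933760, 39026304097611132184120445797928651775873024,
  365375414787877586531299820418224478917408854144, 11059841640342918836684688756807133298688,
  182688586678923187536590092247040019841540950016, 1518541368373499169086371724112439921210298496,
  1427944590994083918851977510094216005771333632, 94199044789681115716480269650876221581653180418,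
  182705355793965051424921598162631748484801234944, 92861696973407990982016451071278077004197400704,
  186278301930439460920090839463885842959952773120, 206259617351963783336385797912914927944703541248,
  22997675387456603952689659160108438283878528, 182690666515986016522761941504265242405521850496,
  39766790429320451432164759814345975744430208, 182710008303961595358695791783383874585956974592,
  871293000602477462014159244440785941168128, 23572609413747128332722026197667005383223410688,
  182691189157800155467813443949641239534241841152, 696898290151647414383655010683914628892672,
  34159081244350600397898497500744546965782528, 209448708399091151421473272845043718653577527296,
  91377347177263621054426284564430692268713709568, 91344549406927225324587907220071591001041410050,
  23572606691488172682920772898850807854191872002, 714408199869886339926630987081493161355249664,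
  91366153248521389862732193393343490921722810368, 91344043067429698686924175005782412678356009088,
  182699551942569092367422237975931124468758347776, 113610930542371272834154996069139889898128384,
  274120765637545993852372345132254445159835504768, 186278127711849123380668353270381635599375269888,
  182690492435635390547417647509520633758597775360, 91550363066159676115175223823965857329325867522,
  206325455210900125408079521286326498932361216, 277625128507631870957861080812967597734197460994,
  91366338362128832593979488256415060571977679362, 91344043067429698686943519004316007742509681282,
  186281265115273432507516421523200653540393484290, 182710702309849661411403805738610345177287496192,
  871293000602478080984178959188524005327360, 365398412441997395202693857292236011786469414912,
  114915762301841787918241192996409806370535116802, 39244254953542866960935765208984461240173056,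
  39244084812278273756021476915247416715772416, 34159081244350601094239769905156468041058304,
  208401269668915652124204359921202572674417562112, 182799910777707335097819741620935188737668715136,
  551276079422100922126520411644951529761278394368, 25712786436682110286415416714337159298731608192,
  730773135956890770087956160343527927205280617472, 365397726624829634272324847077804663705064969216,
  730789861517451203366956111826572981840420344832, 365375420435113253196577499597208790752076764288,
  365375409333390526110403854860471566635020327040, 228385590315428894723113074481116630038280667264,
  45694401306512779806212597563962044611792208896, 456719958803455939237926912168242515032659726336,
  45711170421886950652638301632842233914322846720, 45711170251735301466335287709006183608627494912,
  525963103288210147823748280070805609067500015616, 411069641694349922632856129522299482693995368450,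
  502413494240207956043725443242218138447315505162, 548778219102757598445766628088487924012184502272,
  593841899720265450867469516672395244020508393728, 525963103288211447166232484176041371154052845578,
  45711170421886951921449470651576616714678339080, 776512644711123753771722784772359379080659861634,
  730750818665451479384290705636039674476592365568, 182687704666362864775537975341990715923347014144,
  22858288328824307106987699985960108377965068290, 102762024432954668293889109601623936150869639168,
  39075304758427466189881111797044862477996032, 274053857914884255270161187833790003193562796098,
  92861000075203675764608473101306595722527772802, 39069860240556731174465697803325885467136000,
  22303467457465990765300304528972969129541634, 182726948751175122767812848195546648696182079488,
  123356447378769860459110576801176436630128640, 11507886871228652339072483275057541032601225216,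
  209117944146687266990958779548074389843407276032, 548152496659606275060547867118564449194526906368,
  195533641858845577864798744683938413640010438656, 182705344904928660878169284221389685574265210880,
  2944395264493517332123789786513597423509573760, 593841888831218636429850944371825424839481493760,
  559570995420565541984493414736906418609226520576, 48616329598047947034282637119395961656410767360,
  91433757826922144287392679956564928297183477888, 182779700684827270479441493007673372376144283648,
  123356447378769860362396510943494247230210048, 209114806743262957864110711295831832659121668096,
  11418161210737413304013682043616353266987696128, 208401182556629071326231350866342946988913332736,
  48616321431271162551183046852824061224247361666, 208490390981939766479597972033897141660857405568,
  365465314682909757058588696270520580440852564608, 182776913091677616410748259003797348905224507520,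
  1427944596310427361316408660465686268046477888, 548776743635828723441683511838721930468824190976,
  365565662593114645388047260198808053907957225474, 101055696198712939276089307546366146550694272,
  212553977676091785542387181718985498377060354, 182866110627953868168531103762612682904504897538,
  274053858595448989111419154258839872990747824128, 25903034224454865340388570010163303726140358658,
  182776913091677616727660911422039066614129758592, 186278171267992101937298283401322185442168209424,
  205562941779318944922341207215992251951133823248, 186283920672882072132505548987697771283696648208,
  22869482257566550976426337941823617032601534482, 33497396199697183697935978098466656729759746,
  274031568745267563048714323613750920061504192512, 365409606370781165086168880682461686315308027904,
  11161432441067933573483904274496799379558400, 365380989974218757879098252686778808500142217344,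
  5575186299794935101368710031730543706511360, 2855235839842370862118876387214818538246131728,
  502413538478577189809100560370191207175664177152, 33456562647994268247664147018609936880961664,
  48616364987746769140511657253748071985926135952, 274037307090980770612478123710341040616287244290,
  208412332929228349315547439979224585852610941440, 94199089026388825581078608732027871293509484562,
  189824205998021191755160590777146626587746113537, 1846138182109564939552313761447408345626464288,
  753412723235976666255914737702321568547356672, 2871220944975452098906468218060162309050859536,
  189824204636891724071406660775416462232361373697, 1829369067067690910016006020020467728740519936,
  367295380632345304670502891070661019430595596288, 5731489052596223391616470848757137722623132161,
  22858285607229985925500651741156909028716054528, 22875011166128896569362805885942386561716389904,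
  26091882942122631786731179734164193339231965184, 368229910173974752641802807192191168404359479424,
  211233355931851624345331502113417835802058031104, 183401508181826348158971280672795204266691133569,
  282999605380875973843236018190240952328592033794, 185545337801461688660540740348032800555626661890,
  5748256806507321321975698192375954301987602433, 108872423260563236100687091120255975398171475969,
  204498542877513403783157925799276106828516169728, 108872428705101881093739046757683674147125723137,
  216941650652435532101652009809310205793844334594, 212036971871162044769585298712574167722869392388,
  391065867802284731974550664912078977871633455232, 59961351879693013963111366305804620979301798145]

def rowChk (S i : ℕ) : ℕ → List ℕ → Bool
  | _, [] => true
  | j, m :: l => (bif par 8 (S &&& m) then Nat.beq i j else !(Nat.beq i j)) && rowChk S i (j + 1) l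

def dualChk (ms : List ℕ) : ℕ → List ℕ → Bool
  | _, [] => true
  | i, S :: l => rowChk S i 0 ms && dualChk ms (i + 1) l

theorem rowChk_spec (S i : ℕ) : ∀ (l : List ℕ) (j : ℕ), rowChk S i j l = true →
    ∀ k < l.length, par 8 (S &&& l.getD k 0) = Nat.beq i (j + k) := by
  intro l
  induction l with
  | nil => intro j _ k hk; simp at hk
  | cons m l ih =>
    intro j h k hk
    rw [rowChk, Bool.and_eq_true] at h
    cases k with
    | zero =>
      have h1 := h.1
      rw [List.getD_cons_zero, Nat.add_zero]
      generalize par 8 (S &&& m) = p at h1 ⊢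
      generalize Nat.beq i j = q at h1 ⊢
      cases p <;> cases q <;> simp at h1 ⊢
    | succ k =>
      have := ih (j + 1) h.2 k (by simpa using hk)
      rw [List.getD_cons_succ, this]
      congr 1
      omega

theorem dualChk_spec (ms : List ℕ) : ∀ (l : List ℕ) (i : ℕ), dualChk ms i l = true →
    ∀ k < l.length, rowChk (l.getD k 0) (i + k) 0 ms = true := by
  intro l
  induction l with
  | nil => intro i _ k hk; simp at hk
  | cons S l ih =>
    intro i h k hk
    rw [dualChk, Bool.and_eq_true] at h
    cases k with
    | zero => exact h.1
    | succ k =>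
      have := ih (i + 1) h.2 k (by simpa using hk)
      rw [List.getD_cons_succ]
      rwa [show i + (k + 1) = i + 1 + k by omega]

theorem dual_ok : dualChk imgL 0 dualL = true := by decide +kernel

theorem img_ok : eqL (seedL.map fun r => lev mskL 6 (unp 5 r) 63 3 1) imgL = true := by
  decide +kernel

theorem len_ok : (Nat.beq seedL.length 160 && Nat.beq dualL.length 160) = true := by decide +kernel

theorem beq_and {a b c d : ℕ} (h : (Nat.beq a c && Nat.beq b d) = true) : a = c ∧ b = d := by
  rw [Bool.and_eq_true] at h
  exact ⟨Nat.eq_of_beq_eq_true h.1, Nat.eq_of_beq_eq_true h.2⟩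

theorem len2 : seedL.length = 160 ∧ dualL.length = 160 := by
  have h := len_ok
  generalize seedL.length = a at h ⊢
  generalize dualL.length = b at h ⊢
  exact beq_and h

theorem seed_len : seedL.length = 160 := len2.1

theorem dual_len : dualL.length = 160 := len2.2

theorem unp_lt (k : ℕ) : ∀ r, ∀ a ∈ unp k r, a < 64 := by
  induction k with
  | zero => intro r a h; simp [unp] at h
  | succ k ih =>
    intro r a h
    rw [unp, List.mem_cons] at h
    rcases h with rfl | h
    · omega
    · exact ih _ a h

def cg (g : ℕ) (i : Fin 5) (j : Fin 3) : ZMod 2 :=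
  bt (![(mskL.getD i (0, 0, 0)).1, (mskL.getD i (0, 0, 0)).2.1, (mskL.getD i (0, 0, 0)).2.2] j) g

def phiF (g : ℕ) : P 5 →ₗ[ZMod 2] ZMod 2 :=
  (lcoeff (ZMod 2) (e3 63 3 1)).comp
    (aeval (fun i => ∑ j, C (cg g i j) * (X j : P 3))).toLinearMap

theorem phiF_hit (g : ℕ) {u : P 5} (hu : IsHit 5 67 u) : phiF g u = 0 :=
  spike_zero (lin_hit (cg g) hu)

theorem cg_ell (g : ℕ) (i : Fin 5) :
    ∑ j, C (cg g i j) * (X j : P 3) = ell g (mskL.getD i (0, 0, 0)) := by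
  rw [Fin.sum_univ_three]
  rfl

theorem prodP5 (g : ℕ) (M : List (ℕ × ℕ × ℕ)) (hM : M.length = 5) {l : List ℕ} (hl : l.length = 5) :
    ∏ i : Fin 5, ell g (M.getD i (0, 0, 0)) ^ ve l i = prodP g M l := by
  match M, hM with
  | [m0, m1, m2, m3, m4], _ =>
    obtain ⟨a, b, c, d, e, rfl⟩ := len5 hl
    rw [Fin.prod_univ_five]
    simp [prodP, ve, mul_assoc]

theorem phiF_mv {g : ℕ} (hg : g < 256) (r : ℕ) :
    phiF g (mv (ve (unp 5 r))) = bt (lev mskL 6 (unp 5 r) 63 3 1) g := by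
  rw [lev_spec hg mskL 6 _ _ _ _ (unp_lt 5 r), ← prodP5 g mskL rfl (unp_len 5 r)]
  unfold phiF
  rw [LinearMap.comp_apply, AlgHom.toLinearMap_apply, lcoeff_apply, mv_prod, map_prod]
  congr 1
  apply Finset.prod_congr rfl
  intro i _
  rw [map_pow, aeval_X, cg_ell]

def PsiF (S : ℕ) : P 5 →ₗ[ZMod 2] ZMod 2 := ∑ g ∈ Finset.range (2 ^ 8), bt S g • phiF g

theorem PsiF_hit (S : ℕ) {u : P 5} (hu : IsHit 5 67 u) : PsiF S u = 0 := by
  unfold PsiF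
  rw [LinearMap.sum_apply]
  apply Finset.sum_eq_zero
  intro g _
  rw [LinearMap.smul_apply, phiF_hit g hu, smul_zero]

theorem PsiF_mv (S r : ℕ) : PsiF S (mv (ve (unp 5 r))) =
    if par 8 (S &&& lev mskL 6 (unp 5 r) 63 3 1) then 1 else 0 := by
  unfold PsiF
  rw [← par_spec, LinearMap.sum_apply]
  apply Finset.sum_congr rfl
  intro g hg
  rw [LinearMap.smul_apply, phiF_mv (by simpa using Finset.mem_range.1 hg), bt_and, smul_eq_mul]

theorem getD_map0 (f : ℕ → ℕ) : ∀ (l : List ℕ) (k : ℕ), k < l.length →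
    (l.map f).getD k 0 = f (l.getD k 0) := by
  intro l
  induction l with
  | nil => intro k hk; simp at hk
  | cons a l ih =>
    intro k hk
    cases k with
    | zero => rfl
    | succ k => exact ih k (by simpa using hk)

theorem Psi_dual {i k : ℕ} (hi : i < 160) (hk : k < 160) :
    PsiF (dualL.getD i 0) (mv (ve (unp 5 (seedL.getD k 0)))) = if i = k then 1 else 0 := by
  have h1 := dualChk_spec imgL dualL 0 dual_ok i (by rw [dual_len]; exact hi)
  have he := eqL_eq _ _ img_ok
  have hlen : imgL.length = 160 := by rw [← he, List.length_map, seed_len]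
  have h2 := rowChk_spec _ _ _ _ h1 k (by rw [hlen]; exact hk)
  rw [PsiF_mv]
  rw [← he, getD_map0 _ _ _ (by rw [seed_len]; exact hk)] at h2
  rw [h2, Nat.zero_add, Nat.zero_add]
  by_cases h : i = k
  · subst h; simp
  · have : Nat.beq i k = false := by
      rw [← Bool.not_eq_true, Nat.beq_eq]; exact h
    rw [this, if_neg h]
    rfl

/-! ### The dimension -/

def gen : Option (Fin 160) → Vn 5
  | none => ve b0L
  | some k => ve (unp 5 (seedL.getD k 0))

theorem seeds_val {r : ℕ} (hr : r ∈ seedL) : Val6 (ve (unp 5 r)) := by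
  have h := chkT_ok
  unfold chkT at h
  rw [Bool.and_eq_true] at h
  exact seedOk_spec (allB_spec h.1 r hr)

theorem seed_mem (k : Fin 160) : seedL.getD k 0 ∈ seedL := by
  have hk : (k : ℕ) < seedL.length := by rw [seed_len]; exact k.2
  rw [List.getD_eq_getElem _ _ hk]
  exact List.getElem_mem hk

theorem odds_all {v : Vn 5} (h : ∀ i, Odd (v i)) : odds v = 5 := by
  unfold odds
  rw [Fin.sum_univ_five]
  have h0 := Nat.odd_iff.1 (h 0)
  have h1 := Nat.odd_iff.1 (h 1)
  have h2 := Nat.odd_iff.1 (h 2)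
  have h3 := Nat.odd_iff.1 (h 3)
  have h4 := Nat.odd_iff.1 (h 4)
  omega

theorem gen_ok (o : Option (Fin 160)) :
    sz (gen o) = 67 ∧ (∀ i, 0 < gen o i) ∧ ¬ ∀ i, Odd (gen o i) := by
  cases o with
  | none =>
    refine ⟨?_, ?_, ?_⟩
    · rw [gen, sz_ve (l := b0L) rfl]; rfl
    · intro i; fin_cases i <;> simp [gen, ve, b0L]
    · intro h
      have := h 3
      simp only [gen, ve, b0L] at this
      exact absurd this (by decide)
  | some k =>
    obtain ⟨h1, h2, h3⟩ := seeds_val (seed_mem k)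
    refine ⟨h1, h2, fun h => ?_⟩
    have h4 := odds_all h
    have h5 : odds (gen (some k)) = 3 := h3.1
    omega

theorem isHit_zero (n d : ℕ) : IsHit n d 0 :=
  ⟨fun _ => 0, fun _ => Submodule.zero_mem _, by simp⟩

theorem isHit_hom {n d : ℕ} {u : P n} (hu : IsHit n d u) :
    u ∈ homogeneousSubmodule (Fin n) (ZMod 2) d := by
  obtain ⟨f, _, rfl⟩ := hu
  exact Submodule.sum_mem _ fun i _ =>
    (mem_homogeneousSubmodule _ _).2 (homogeneousComponent_isHomogeneous _ _)

def genH (o : Option (Fin 160)) : homSub 5 67 :=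
  ⟨mv (gen o), by have := mv_hom (gen o); rwa [(gen_ok o).1] at this⟩

def genQ (o : Option (Fin 160)) : QP 5 67 :=
  ((hitSub 5 67).comap (homSub 5 67).subtype).mkQ (genH o)

theorem genH_mem (o : Option (Fin 160)) :
    (genH o : P 5) ∈ PplusSub 5 ∧ IsHit 5 31 (S5 (genH o : P 5)) := by
  obtain ⟨-, h2, h3⟩ := gen_ok o
  constructor
  · exact Submodule.subset_span ⟨Finsupp.equivFunOnFinite.symm (gen o), h2, rfl⟩
  · have : S5 (genH o : P 5) = 0 := by
      have := S5_mv (Finsupp.equivFunOnFinite.symm (gen o))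
      exact this.trans (if_neg h3)
    rw [this]
    exact isHit_zero _ _

/-- a functional killing hit polynomials descends to the cohit space -/
def descend (L : P 5 →ₗ[ZMod 2] ZMod 2) (hL : ∀ u, IsHit 5 67 u → L u = 0) :
    QP 5 67 →ₗ[ZMod 2] ZMod 2 :=
  ((hitSub 5 67).comap (homSub 5 67).subtype).liftQ (L.comp (homSub 5 67).subtype) (by
    intro x hx
    have h : hitSub 5 67 ≤ LinearMap.ker L := Submodule.span_le.2 fun u hu => hL u hu
    exact h hx)

theorem descend_genQ (L : P 5 →ₗ[ZMod 2] ZMod 2) (hL : ∀ u, IsHit 5 67 u → L u = 0)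
    (o : Option (Fin 160)) : descend L hL (genQ o) = L (mv (gen o)) := rfl

def dualF : Option (Fin 160) → P 5 →ₗ[ZMod 2] ZMod 2
  | none => thF
  | some i => PsiF (dualL.getD i 0) - PsiF (dualL.getD i 0) (mv (ve b0L)) • thF

theorem dualF_hit (o : Option (Fin 160)) (u : P 5) (hu : IsHit 5 67 u) : dualF o u = 0 := by
  cases o with
  | none => exact thF_hit hu
  | some i =>
    rw [dualF, LinearMap.sub_apply, LinearMap.smul_apply, thF_hit hu, PsiF_hit _ hu]
    simp

theorem dualF_gen (o o' : Option (Fin 160)) : dualF o (mv (gen o')) = if o = o' then 1 else 0 := by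
  have hs : ∀ k : Fin 160, thF (mv (gen (some k))) = 0 :=
    fun k => by rw [gen, thF_seed (seeds_val (seed_mem k)).2.2]
  cases o with
  | none =>
    cases o' with
    | none => rw [if_pos rfl, dualF, gen, thF_b0]
    | some k => rw [if_neg (by simp), dualF, hs k]
  | some i =>
    rw [dualF, LinearMap.sub_apply, LinearMap.smul_apply]
    cases o' with
    | none =>
      rw [if_neg (by simp), gen, thF_b0, smul_eq_mul, mul_one, sub_self]
    | some k =>
      rw [hs, smul_zero, sub_zero, gen, Psi_dual i.2 k.2]
      simp only [Option.some.injEq, Fin.ext_iff]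

theorem genQ_li : LinearIndependent (ZMod 2) genQ := by
  apply LinearIndependent.of_pairwise_dual_eq_zero_one genQ
    (fun o => descend (dualF o) (dualF_hit o))
  · intro o o' h
    rw [descend_genQ, dualF_gen, if_neg h]
  · intro o
    rw [descend_genQ, dualF_gen, if_pos rfl]

theorem genQ_span (f : homSub 5 67) (hp : (f : P 5) ∈ PplusSub 5) (hS : IsHit 5 31 (S5 (f : P 5))) :
    ((hitSub 5 67).comap (homSub 5 67).subtype).mkQ f ∈
      Submodule.span (ZMod 2) (Set.range genQ) := by
  by_contra hno
  obtain ⟨F, hF, hker⟩ := Submodule.exists_le_ker_of_notMem hno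
  apply hF
  let H : P 5 →ₗ[ZMod 2] homSub 5 67 := (homogeneousComponent 67).codRestrict _ fun p =>
    (mem_homogeneousSubmodule _ _).2 (homogeneousComponent_isHomogeneous 67 p)
  have hH : ∀ p : homSub 5 67, H p = p := by
    intro p
    apply Subtype.ext
    change homogeneousComponent 67 (p : P 5) = p
    rw [homogeneousComponent_of_mem p.2, if_pos rfl]
  let L : P 5 →ₗ[ZMod 2] ZMod 2 :=
    F.comp ((((hitSub 5 67).comap (homSub 5 67).subtype).mkQ).comp H)
  have hL : ∀ u, IsHit 5 67 u → L u = 0 := by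
    intro u hu
    have e : H u = ⟨u, isHit_hom hu⟩ := hH ⟨u, isHit_hom hu⟩
    change F (((hitSub 5 67).comap (homSub 5 67).subtype).mkQ (H u)) = 0
    rw [e]
    have : ((hitSub 5 67).comap (homSub 5 67).subtype).mkQ ⟨u, isHit_hom hu⟩ = 0 := by
      rw [Submodule.mkQ_apply, Submodule.Quotient.mk_eq_zero]
      exact Submodule.subset_span hu
    rw [this, map_zero]
  have hg : ∀ o, L (mv (gen o)) = 0 := by
    intro o
    have e : H (mv (gen o)) = genH o := hH (genH o)
    change F (((hitSub 5 67).comap (homSub 5 67).subtype).mkQ (H (mv (gen o)))) = 0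
    rw [e]
    exact hker (Submodule.subset_span ⟨o, rfl⟩)
  have hfin := upper hL (hg none) (by
    intro r hr
    obtain ⟨k, hk, rfl⟩ := List.getElem_of_mem hr
    have h := hg (some ⟨k, by rw [← seed_len]; exact hk⟩)
    rw [gen, List.getD_eq_getElem _ _ hk] at h
    exact h) f.2 hp hS
  have e : L (f : P 5) = F (((hitSub 5 67).comap (homSub 5 67).subtype).mkQ (H (f : P 5))) := rfl
  rw [e, hH] at hfin
  exact hfin

theorem genQ_finrank :
    Module.finrank (ZMod 2)
      (Submodule.span (ZMod 2)
        (((hitSub 5 67).comap (homSub 5 67).subtype).mkQ ''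
          {f : homSub 5 67 | (f : P 5) ∈ PplusSub 5 ∧ IsHit 5 31 (S5 (f : P 5))})) =
      161 := by
  have h : Submodule.span (ZMod 2) (((hitSub 5 67).comap (homSub 5 67).subtype).mkQ ''
      {f : homSub 5 67 | (f : P 5) ∈ PplusSub 5 ∧ IsHit 5 31 (S5 (f : P 5))}) =
      Submodule.span (ZMod 2) (Set.range genQ) := by
    apply le_antisymm
    · rw [Submodule.span_le]
      rintro _ ⟨f, ⟨hp, hS⟩, rfl⟩
      exact genQ_span f hp hS
    · apply Submodule.span_mono
      rintro _ ⟨o, rfl⟩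
      exact ⟨genH o, genH_mem o, rfl⟩
  rw [h, finrank_span_eq_card genQ_li]
  simp

/-- the image in `(QP_5)_67` of the subspace
`{f ∈ (P_5^+)_67 : S_5(f) is hit}` has dimension `161` over `𝔽₂`. -/
theorem statement5 :
    Module.finrank (ZMod 2)
      (Submodule.span (ZMod 2)
        (((hitSub 5 67).comap (homSub 5 67).subtype).mkQ ''
          {f : homSub 5 67 | (f : P 5) ∈ PplusSub 5 ∧ IsHit 5 31 (S5 (f : P 5))})) =
      161 := genQ_finrank

end
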